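/- Define ε5(n) := 6√2(5−√5) if n ≡ 0 (mod 5), 2√2(5+√5) if n ≡ 1 (mod 5), 20√2 if n ≡ 2 (mod 5), 2√2(5−√5) if n ≡ 3 (mod 5), and 6√2(5+√5) if n ≡ 4 (mod 5). Then A(1/5;n) ∼ ε5(n)·sin(π/5)·cosh(π√(8n−1)/20)/(5√(8n−1)) as n → ∞; that is, the quotient A(1/5;n)·5√(8n−1)/(ε5(n)·sin(π/5)·cosh(π√(8n−1)/20)) tends to 1 as n → ∞. -/

import Mathlib

open scoped Classical

/-- The M2-rank of a partition: ⌈ℓ/2⌉ − s, where ℓ is the largest part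
(0 for the empty partition) and s is the number of parts. -/
def m2Rank {n : ℕ} (P : n.Partition) : ℤ :=
  (((P.parts.sup + 1) / 2 : ℕ) : ℤ) - (Multiset.card P.parts : ℤ)

/-- A partition has no repeated odd parts. -/
def NoRepeatedOddParts {n : ℕ} (P : n.Partition) : Prop :=
  ∀ j : ℕ, Odd j → P.parts.count j ≤ 1

/-- `N2 r m n` is the number of partitions of `n` without repeated odd parts whose
M2-rank is congruent to `r` modulo `m`. -/
noncomputable def N2 (r : ℤ) (m n : ℕ) : ℕ :=
  Nat.card {P : n.Partition // NoRepeatedOddParts P ∧ m2Rank P ≡ r [ZMOD (m : ℤ)]}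

/-- `Acoef a c n = Σ_{r=0}^{c−1} N2(r,c,n)·e^{2πiar/c}`, the coefficient of `q^n`
in the M2-rank generating function `R2(e^{2πia/c};q)`. -/
noncomputable def Acoef (a : ℤ) (c n : ℕ) : ℂ :=
  ∑ r ∈ Finset.range c,
    (N2 (r : ℤ) c n : ℂ) * Complex.exp (2 * Real.pi * Complex.I * (a : ℂ) * (r : ℂ) / (c : ℂ))

namespace M2R
open Filter Topology

/-- finite products -/
noncomputable def Fq (q z : ℂ) (M : ℕ) : ℂ :=
  ∏ j ∈ Finset.range M, (1 + z * q ^ (2 * j + 1)) / (1 - z * q ^ (2 * j + 2))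

lemma Fq_zero (q z : ℂ) : Fq q z 0 = 1 := by simp [Fq]

lemma Fq_succ (q z : ℂ) (M : ℕ) :
    Fq q z (M + 1) = Fq q z M * ((1 + z * q ^ (2 * M + 1)) / (1 - z * q ^ (2 * M + 2))) := by
  unfold Fq; rw [Finset.prod_range_succ]

lemma norm_zq_lt {q z : ℂ} {ρ : ℝ} (hq : ‖q‖ < 1) (hz : ‖z‖ ≤ ρ) (j : ℕ) :
    ‖z * q ^ (2 * j + 2)‖ ≤ ρ * ‖q‖ ^ 2 := by
  rw [norm_mul, norm_pow]
  have h1 : ‖q‖ ^ (2 * j + 2) ≤ ‖q‖ ^ 2 := pow_le_pow_of_le_one (norm_nonneg _) hq.le (by omega)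
  have : 0 ≤ ‖q‖ ^ (2 * j + 2) := by positivity
  exact mul_le_mul hz h1 this ((norm_nonneg _).trans hz)

lemma den_ne {q z : ℂ} (hq : ‖q‖ < 1) (hz : ‖z‖ * ‖q‖ ^ 2 < 1) (j : ℕ) :
    1 - z * q ^ (2 * j + 2) ≠ 0 := by
  intro h
  have h1 := norm_zq_lt hq le_rfl j (z := z)
  rw [← sub_eq_zero.mp h] at h1
  simp at h1
  linarith

lemma Fq_succ_sub {q z : ℂ} (hq : ‖q‖ < 1) (hz : ‖z‖ * ‖q‖ ^ 2 < 1) (M : ℕ) :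
    Fq q z (M + 1) - Fq q z M =
      z * q ^ (2 * M + 2) * Fq q z (M + 1) + z * q ^ (2 * M + 1) * Fq q z M := by
  rw [Fq_succ]
  have := den_ne hq hz M
  field_simp
  ring

lemma Fq_shift (q z : ℂ) (hq0 : q ≠ 0) (M : ℕ) :
    Fq q (z * (q ^ 2)⁻¹) (M + 1) = (1 + z * q⁻¹) / (1 - z) * Fq q z M := by
  unfold Fq
  rw [Finset.prod_range_succ', mul_comm]
  congr 1
  · simp only [mul_zero, zero_add, pow_one]
    congr 2 <;> field_simp
  · apply Finset.prod_congr rfl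
    intro j _
    congr 2 <;> · field_simp; ring

lemma Fq_bound {q : ℂ} (hq : ‖q‖ < 1) {ρ : ℝ} (hρ : 0 ≤ ρ) (hρ1 : ρ * ‖q‖ ^ 2 < 1) :
    ∃ C : ℝ, 0 < C ∧ ∀ z : ℂ, ‖z‖ ≤ ρ → ∀ M, ‖Fq q z M‖ ≤ C := by
  set r := ‖q‖ with hr
  have hr0 : 0 ≤ r := norm_nonneg _
  set A : ℝ := 2 * ρ / (1 - ρ * r ^ 2) with hA
  have hA0 : 0 ≤ A := div_nonneg (by positivity) (by linarith)
  refine ⟨Real.exp (A / (1 - r)), Real.exp_pos _, ?_⟩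
  intro z hz M
  unfold Fq
  rw [norm_prod]
  have key : ∀ j ∈ Finset.range M, ‖(1 + z * q ^ (2 * j + 1)) / (1 - z * q ^ (2 * j + 2))‖
      ≤ Real.exp (A * r ^ j) := by
    intro j _
    have h2 := norm_zq_lt hq hz j
    have h3 : 1 - ρ * r ^ 2 ≤ ‖1 - z * q ^ (2 * j + 2)‖ := by
      have := norm_sub_norm_le (1 : ℂ) (z * q ^ (2 * j + 2))
      rw [norm_one] at this
      linarith
    have hne := norm_pos_iff.mp (lt_of_lt_of_le (by linarith) h3)
    have e : (1 + z * q ^ (2 * j + 1)) / (1 - z * q ^ (2 * j + 2)) =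
        1 + (z * q ^ (2 * j + 1) + z * q ^ (2 * j + 2)) / (1 - z * q ^ (2 * j + 2)) := by
      field_simp; ring
    have hb : ∀ k, j ≤ k → ‖z * q ^ k‖ ≤ ρ * r ^ j := by
      intro k hk
      rw [norm_mul, norm_pow]
      exact mul_le_mul hz (pow_le_pow_of_le_one hr0 hq.le hk) (by positivity) hρ
    have h4 : ‖(z * q ^ (2 * j + 1) + z * q ^ (2 * j + 2)) / (1 - z * q ^ (2 * j + 2))‖
        ≤ A * r ^ j := by
      rw [norm_div]
      calc _ ≤ (2 * ρ * r ^ j) / (1 - ρ * r ^ 2) := by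
            apply div_le_div₀ (by positivity) _ (by linarith) h3
            refine (norm_add_le _ _).trans ?_
            have := hb (2 * j + 1) (by omega)
            have := hb (2 * j + 2) (by omega)
            linarith
        _ = A * r ^ j := by rw [hA]; ring
    rw [e]
    refine (norm_add_le _ _).trans ?_
    rw [norm_one]
    have := Real.add_one_le_exp (A * r ^ j)
    linarith
  refine (Finset.prod_le_prod (fun _ _ => norm_nonneg _) key).trans ?_
  rw [← Real.exp_sum]
  apply Real.exp_le_exp.mpr
  rw [← Finset.mul_sum, div_eq_mul_inv]
  apply mul_le_mul_of_nonneg_left _ hA0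
  rw [← tsum_geometric_of_lt_one hr0 hq]
  exact (summable_geometric_of_lt_one hr0 hq).sum_le_tsum _ (fun _ _ => by positivity)

/-- the M2-rank function -/
noncomputable def Hq (q w : ℂ) : ℂ :=
  1 + ∑' M : ℕ, w ^ (M + 1) * (Fq q w⁻¹ (M + 1) - Fq q w⁻¹ M)

lemma Hterm_bound {q : ℂ} (hq : ‖q‖ < 1) {ρ R : ℝ} (hρ : 0 ≤ ρ) (hρ1 : ρ * ‖q‖ ^ 2 < 1)
    (hR : 0 ≤ R) : ∃ C : ℝ, 0 < C ∧ ∀ w : ℂ, ‖w⁻¹‖ ≤ ρ → ‖w‖ ≤ R → ∀ M : ℕ,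
    ‖w ^ (M + 1) * (Fq q w⁻¹ (M + 1) - Fq q w⁻¹ M)‖ ≤ C * (R * ‖q‖ ^ 2) ^ M := by
  obtain ⟨C, hC, hb⟩ := Fq_bound hq hρ hρ1
  have hr0 : 0 ≤ ‖q‖ := norm_nonneg _
  refine ⟨2 * ρ * C * R + 1, by positivity, ?_⟩
  intro w hw hwR M
  have hz : ‖w⁻¹‖ * ‖q‖ ^ 2 < 1 := lt_of_le_of_lt (by gcongr) hρ1
  rw [Fq_succ_sub hq hz, norm_mul, norm_pow]
  have h1 : ∀ k N, 2 * M ≤ k → ‖w⁻¹ * q ^ k * Fq q w⁻¹ N‖ ≤ ρ * ‖q‖ ^ (2 * M) * C := by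
    intro k N hk
    rw [norm_mul, norm_mul, norm_pow]
    exact mul_le_mul (mul_le_mul hw (pow_le_pow_of_le_one hr0 hq.le hk) (by positivity) hρ)
      (hb _ hw _) (norm_nonneg _) (by positivity)
  have h2 := (norm_add_le (w⁻¹ * q ^ (2 * M + 2) * Fq q w⁻¹ (M + 1))
    (w⁻¹ * q ^ (2 * M + 1) * Fq q w⁻¹ M))
  have h3 := h1 (2 * M + 2) (M + 1) (by omega)
  have h4 := h1 (2 * M + 1) M (by omega)
  calc ‖w‖ ^ (M + 1) * _ ≤ R ^ (M + 1) * (2 * (ρ * ‖q‖ ^ (2 * M) * C)) := by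
        gcongr
        linarith
    _ = (2 * ρ * C * R) * (R * ‖q‖ ^ 2) ^ M := by
        rw [mul_pow, ← pow_mul]; ring
    _ ≤ _ := by
        gcongr
        linarith

lemma Hterm_summable {q w : ℂ} (hq : ‖q‖ < 1) (h1 : ‖w⁻¹‖ * ‖q‖ ^ 2 < 1)
    (h2 : ‖w‖ * ‖q‖ ^ 2 < 1) :
    Summable fun M : ℕ => w ^ (M + 1) * (Fq q w⁻¹ (M + 1) - Fq q w⁻¹ M) := by
  obtain ⟨C, _, hb⟩ := Hterm_bound hq (norm_nonneg w⁻¹) h1 (norm_nonneg w)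
  exact Summable.of_norm_bounded ((summable_geometric_of_lt_one (by positivity) h2).mul_left C)
    (hb w le_rfl le_rfl)

lemma Fq_differentiableAt {q w : ℂ} (hq : ‖q‖ < 1) (hw : w ≠ 0) (h1 : ‖w⁻¹‖ * ‖q‖ ^ 2 < 1) (M : ℕ) :
    DifferentiableAt ℂ (fun w => Fq q w⁻¹ M) w := by
  unfold Fq
  apply DifferentiableAt.fun_finsetProd
  intro j _
  have := den_ne hq h1 j
  have hi := differentiableAt_inv (𝕜 := ℂ) hw
  fun_prop (disch := assumption)

/-- the open annulus -/
def annul (q : ℂ) : Set ℂ := {w | w ≠ 0 ∧ ‖w⁻¹‖ * ‖q‖ ^ 2 < 1 ∧ ‖w‖ * ‖q‖ ^ 2 < 1}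

lemma Hq_differentiableAt {q : ℂ} (hq : ‖q‖ < 1) {w₀ : ℂ} (hw : w₀ ∈ annul q) :
    DifferentiableAt ℂ (Hq q) w₀ := by
  obtain ⟨h0, h1, h2⟩ := hw
  obtain ⟨ρ, hρ, hρ'⟩ : ∃ ρ, ‖w₀⁻¹‖ < ρ ∧ ρ * ‖q‖ ^ 2 < 1 := by
    have : Tendsto (fun ρ : ℝ => ρ * ‖q‖ ^ 2) (𝓝[>] ‖w₀⁻¹‖) (𝓝 (‖w₀⁻¹‖ * ‖q‖ ^ 2)) :=
      ((continuous_id.mul continuous_const).tendsto _).mono_left nhdsWithin_le_nhds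
    have := (this.eventually (gt_mem_nhds h1)).and self_mem_nhdsWithin
    obtain ⟨ρ, a, b⟩ := this.exists
    exact ⟨ρ, b, a⟩
  obtain ⟨R, hR, hR'⟩ : ∃ R, ‖w₀‖ < R ∧ R * ‖q‖ ^ 2 < 1 := by
    have : Tendsto (fun ρ : ℝ => ρ * ‖q‖ ^ 2) (𝓝[>] ‖w₀‖) (𝓝 (‖w₀‖ * ‖q‖ ^ 2)) :=
      ((continuous_id.mul continuous_const).tendsto _).mono_left nhdsWithin_le_nhds
    have := (this.eventually (gt_mem_nhds h2)).and self_mem_nhdsWithin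
    obtain ⟨ρ, a, b⟩ := this.exists
    exact ⟨ρ, b, a⟩
  have hρ0 : 0 ≤ ρ := (norm_nonneg _).trans hρ.le
  have hR0 : 0 ≤ R := (norm_nonneg _).trans hR.le
  obtain ⟨C, hC, hb⟩ := Hterm_bound hq hρ0 hρ' hR0
  set U : Set ℂ := {w | w ≠ 0} ∩ ({w | ‖w⁻¹‖ < ρ} ∩ {w | ‖w‖ < R}) with hU
  have hUo : IsOpen U := by
    have e : U = ({w : ℂ | w ≠ 0} ∩ {w | 1 < ρ * ‖w‖}) ∩ {w | ‖w‖ < R} := by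
      ext w
      simp only [hU, Set.mem_inter_iff, Set.mem_ofPred_eq, norm_inv]
      constructor
      · rintro ⟨a, b, c⟩
        refine ⟨⟨a, ?_⟩, c⟩
        rwa [inv_lt_iff_one_lt_mul₀ (norm_pos_iff.mpr a)] at b
      · rintro ⟨⟨a, b⟩, c⟩
        refine ⟨a, ?_, c⟩
        rwa [inv_lt_iff_one_lt_mul₀ (norm_pos_iff.mpr a)]
    rw [e]
    refine ((isOpen_ne).inter ?_).inter ?_
    · exact isOpen_lt continuous_const (by fun_prop)
    · exact isOpen_lt (by fun_prop) continuous_const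
  have hd : DifferentiableOn ℂ (fun w => ∑' M : ℕ, w ^ (M + 1) * (Fq q w⁻¹ (M + 1) - Fq q w⁻¹ M)) U := by
    apply Complex.differentiableOn_tsum_of_summable_norm
      ((summable_geometric_of_lt_one (by positivity) hR').mul_left C)
    · intro M w hw
      have h1' : ‖w⁻¹‖ * ‖q‖ ^ 2 < 1 := lt_of_le_of_lt (by gcongr; exact hw.2.1.le) hρ'
      have d1 := Fq_differentiableAt hq hw.1 h1' (M + 1)
      have d2 := Fq_differentiableAt hq hw.1 h1' M
      exact ((differentiableAt_id.pow _).mul (d1.sub d2)).differentiableWithinAt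
    · exact hUo
    · intro M w hw
      exact hb w hw.2.1.le hw.2.2.le M
  exact (differentiableAt_const _).add (hd.differentiableAt (hUo.mem_nhds ⟨h0, hρ, hR⟩))

/-- For `‖w q^2‖ < 1`: partial summation. -/
lemma Hq_small {q w : ℂ} (hq : ‖q‖ < 1) (h1 : ‖w⁻¹‖ * ‖q‖ ^ 2 < 1) (hw : ‖w‖ < 1) :
    Hq q w = (1 - w) * ∑' M : ℕ, w ^ M * Fq q w⁻¹ M := by
  obtain ⟨C, hC, hb⟩ := Fq_bound hq (norm_nonneg w⁻¹) h1
  have hs : Summable fun M : ℕ => w ^ M * Fq q w⁻¹ M := by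
    refine Summable.of_norm_bounded ((summable_geometric_of_lt_one (norm_nonneg w) hw).mul_left C)
      (fun M => ?_)
    rw [norm_mul, norm_pow, mul_comm]
    exact mul_le_mul_of_nonneg_right (hb _ le_rfl _) (by positivity)
  have hs1 : Summable fun M : ℕ => w ^ (M + 1) * Fq q w⁻¹ (M + 1) :=
    (summable_nat_add_iff (f := fun M : ℕ => w ^ M * Fq q w⁻¹ M) 1).mpr hs
  have e : ∀ M : ℕ, w ^ (M + 1) * (Fq q w⁻¹ (M + 1) - Fq q w⁻¹ M) =
    w ^ (M + 1) * Fq q w⁻¹ (M + 1) - w * (w ^ M * Fq q w⁻¹ M) := fun M => by ring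
  unfold Hq
  rw [tsum_congr e, hs1.tsum_sub (hs.mul_left w), tsum_mul_left]
  have e2 := hs.tsum_eq_zero_add
  rw [pow_zero, Fq_zero, mul_one] at e2
  linear_combination -e2

lemma Hq_K {q w : ℂ} (hq : ‖q‖ < 1) (hw : w ≠ 0) (h1 : ‖w⁻¹‖ * ‖q‖ ^ 2 < 1)
    (h2 : ‖w‖ * ‖q‖ ^ 2 < 1) :
    Hq q w - 1 = (w⁻¹ + q) * (∑' M : ℕ, (w * q ^ 2) ^ M * Fq q w⁻¹ M) - w⁻¹ := by
  obtain ⟨C, hC, hb⟩ := Fq_bound hq (norm_nonneg w⁻¹) h1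
  have hs : Summable fun M : ℕ => (w * q ^ 2) ^ M * Fq q w⁻¹ M := by
    refine Summable.of_norm_bounded ((summable_geometric_of_lt_one (by positivity) h2).mul_left C)
      (fun M => ?_)
    rw [norm_mul, norm_pow, norm_mul, norm_pow, mul_comm]
    exact mul_le_mul_of_nonneg_right (hb _ le_rfl _) (by positivity)
  have hs1 : Summable fun M : ℕ => (w * q ^ 2) ^ (M + 1) * Fq q w⁻¹ (M + 1) :=
    (summable_nat_add_iff (f := fun M : ℕ => (w * q ^ 2) ^ M * Fq q w⁻¹ M) 1).mpr hs
  have e : ∀ M : ℕ, w ^ (M + 1) * (Fq q w⁻¹ (M + 1) - Fq q w⁻¹ M) =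
      w⁻¹ * ((w * q ^ 2) ^ (M + 1) * Fq q w⁻¹ (M + 1)) + q * ((w * q ^ 2) ^ M * Fq q w⁻¹ M) := by
    intro M
    rw [Fq_succ_sub hq h1]
    field_simp
    ring
  unfold Hq
  rw [tsum_congr e, (hs1.mul_left _).tsum_add (hs.mul_left _), tsum_mul_left, tsum_mul_left]
  have e2 := hs.tsum_eq_zero_add
  rw [pow_zero, Fq_zero, mul_one] at e2
  linear_combination -w⁻¹ * e2

/-- Functional equation. -/
lemma Hq_feq {q w : ℂ} (hq : ‖q‖ < 1) (hq0 : q ≠ 0) (hw : 1 < ‖w‖)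
    (h2 : ‖w‖ * ‖q‖ ^ 2 < 1) :
    Hq q (w * q ^ 2) / (1 - w * q ^ 2) = -q * w ^ 2 * (Hq q w / (1 - w)) + 1 - q * w := by
  have hw0 : w ≠ 0 := norm_pos_iff.mp (by linarith)
  have hqn : 0 < ‖q‖ := norm_pos_iff.mpr hq0
  have hwi : ‖w⁻¹‖ < 1 := by rw [norm_inv]; exact inv_lt_one_of_one_lt₀ hw
  have h1 : ‖w⁻¹‖ * ‖q‖ ^ 2 < 1 := by
    have : ‖q‖ ^ 2 ≤ 1 := pow_le_one₀ hqn.le hq.le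
    nlinarith [norm_nonneg w⁻¹]
  have h3 : ‖w * q ^ 2‖ < 1 := by rwa [norm_mul, norm_pow]
  have h4 : ‖(w * q ^ 2)⁻¹‖ * ‖q‖ ^ 2 < 1 := by
    rw [mul_inv, norm_mul, norm_inv (q ^ 2), norm_pow, mul_assoc,
      inv_mul_cancel₀ (by positivity), mul_one]
    exact hwi
  have hne1 : 1 - w ≠ 0 := by
    intro h
    rw [← sub_eq_zero.mp h] at hw
    simp at hw
  have hne2 : 1 - w * q ^ 2 ≠ 0 := by
    intro h
    rw [← sub_eq_zero.mp h] at h3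
    simp at h3
  have hK := Hq_K hq hw0 h1 h2
  set K := ∑' M : ℕ, (w * q ^ 2) ^ M * Fq q w⁻¹ M with hKdef
  rw [Hq_small hq h4 h3, mul_div_cancel_left₀ _ hne2]
  obtain ⟨C, hC, hb⟩ := Fq_bound hq (norm_nonneg (w * q ^ 2)⁻¹) h4
  have hs : Summable fun M : ℕ => (w * q ^ 2) ^ M * Fq q (w * q ^ 2)⁻¹ M := by
    refine Summable.of_norm_bounded ((summable_geometric_of_lt_one (norm_nonneg _) h3).mul_left C)
      (fun M => ?_)
    rw [norm_mul, norm_pow, mul_comm]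
    exact mul_le_mul_of_nonneg_right (hb _ le_rfl _) (by positivity)
  rw [hs.tsum_eq_zero_add]
  have hne3 : 1 - w⁻¹ ≠ 0 := by
    intro h
    have := sub_eq_zero.mp h
    rw [← this] at hwi
    simp at hwi
  have e : ∀ M : ℕ, (w * q ^ 2) ^ (M + 1) * Fq q (w * q ^ 2)⁻¹ (M + 1) =
      (w * q ^ 2 * ((1 + w⁻¹ * q⁻¹) / (1 - w⁻¹))) * ((w * q ^ 2) ^ M * Fq q w⁻¹ M) := by
    intro M
    rw [mul_inv, Fq_shift q w⁻¹ hq0]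
    ring
  simp_rw [e]
  rw [tsum_mul_left, ← hKdef]
  have hH : Hq q w = (w⁻¹ + q) * K - w⁻¹ + 1 := by linear_combination hK
  rw [hH]
  have hne4 : w - 1 ≠ 0 := by intro h; apply hne1; linear_combination -h
  simp only [pow_zero, Fq_zero, mul_one]
  field_simp
  have : 1 - w = -(w - 1) := by ring
  rw [this]
  field_simp
  ring

end M2R

namespace M2R
open Filter Topology

/-- theta terms -/
noncomputable def th (q : ℂ) (n : ℤ) : ℂ := (-1) ^ n * q ^ (2 * n ^ 2 + n)

noncomputable def theta (q : ℂ) : ℂ := ∑' n : ℤ, th q n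

lemma norm_neg_one_zpow (n : ℤ) : ‖(-1 : ℂ) ^ n‖ = 1 := by
  rw [norm_zpow]; simp

lemma norm_th (q : ℂ) (n : ℤ) : ‖th q n‖ = ‖q‖ ^ (2 * n ^ 2 + n) := by
  rw [th, norm_mul, norm_neg_one_zpow, one_mul, norm_zpow]

lemma zpow_le_natAbs {r : ℝ} (h0 : 0 ≤ r) (h1 : r < 1) {m : ℤ} {k : ℕ} (h : (k : ℤ) ≤ m) :
    r ^ m ≤ r ^ k := by
  obtain ⟨l, rfl⟩ := Int.eq_ofNat_of_zero_le ((Int.natCast_nonneg k).trans h)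
  rw [zpow_natCast]
  exact pow_le_pow_of_le_one h0 h1.le (by exact_mod_cast h)

lemma abs_le_quad (n : ℤ) : (n.natAbs : ℤ) ≤ 2 * n ^ 2 + n := by
  rw [Int.natCast_natAbs]
  rcases abs_cases n with ⟨h, h'⟩ | ⟨h, h'⟩ <;> rw [h] <;> nlinarith

lemma summable_natAbs {r : ℝ} (h0 : 0 ≤ r) (h1 : r < 1) : Summable fun n : ℤ => r ^ n.natAbs := by
  have := summable_geometric_of_lt_one h0 h1
  apply Summable.of_nat_of_neg <;> simpa using this

lemma norm_th_le {q : ℂ} (hq : ‖q‖ < 1) (n : ℤ) : ‖th q n‖ ≤ ‖q‖ ^ n.natAbs := by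
  rw [norm_th]
  exact zpow_le_natAbs (norm_nonneg _) hq (abs_le_quad n)

lemma th_summable_norm {q : ℂ} (hq : ‖q‖ < 1) : Summable fun n : ℤ => ‖th q n‖ :=
  Summable.of_nonneg_of_le (fun _ => norm_nonneg _) (norm_th_le hq)
    (summable_natAbs (norm_nonneg _) hq)

lemma th_summable {q : ℂ} (hq : ‖q‖ < 1) : Summable fun n : ℤ => th q n :=
  (th_summable_norm hq).of_norm

/-- Appell-type sum -/
noncomputable def fq (q w : ℂ) : ℂ := ∑' n : ℤ, th q n / (1 - w * q ^ (2 * n))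

/-- Appell-type sum with the `n=0` term removed -/
noncomputable def fq0 (q w : ℂ) : ℂ :=
  ∑' n : ℤ, if n = 0 then 0 else th q n / (1 - w * q ^ (2 * n))

lemma den_bound {q w : ℂ} {ρ R : ℝ} (hq : ‖q‖ < 1) (hq0 : q ≠ 0) (hw : w ≠ 0)
    (hρ : ‖w⁻¹‖ ≤ ρ) (hρ1 : ρ * ‖q‖ ^ 2 < 1) (hR : ‖w‖ ≤ R) (hR1 : R * ‖q‖ ^ 2 < 1) {n : ℤ}
    (hn : n ≠ 0) :
    min (1 - R * ‖q‖ ^ 2) (1 - ρ * ‖q‖ ^ 2) ≤ ‖1 - w * q ^ (2 * n)‖ := by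
  have hqn : 0 < ‖q‖ := norm_pos_iff.mpr hq0
  have hwn : 0 < ‖w‖ := norm_pos_iff.mpr hw
  rcases lt_or_gt_of_ne hn with h | h
  · refine (min_le_right _ _).trans ?_
    have h1 : ‖q‖ ^ (-2 * n) ≤ ‖q‖ ^ 2 :=
      zpow_le_natAbs (norm_nonneg _) hq (k := 2) (by push_cast; omega)
    have e : 1 - w * q ^ (2 * n) = (w * q ^ (2 * n)) * (w⁻¹ * q ^ (-2 * n) - 1) := by
      have : q ^ (2 * n) ≠ 0 := zpow_ne_zero _ hq0
      rw [neg_mul, zpow_neg]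
      field_simp
    have h2 : ‖w⁻¹ * q ^ (-2 * n)‖ ≤ ρ * ‖q‖ ^ 2 := by
      rw [norm_mul, norm_zpow]
      exact mul_le_mul hρ h1 (by positivity) ((norm_nonneg _).trans hρ)
    have h3 : 1 - ρ * ‖q‖ ^ 2 ≤ ‖w⁻¹ * q ^ (-2 * n) - 1‖ := by
      have := norm_sub_norm_le (1 : ℂ) (w⁻¹ * q ^ (-2 * n))
      rw [norm_one, norm_sub_rev] at this
      linarith
    have h4 : 1 ≤ ‖w * q ^ (2 * n)‖ := by
      have e : w * q ^ (2 * n) = (w⁻¹ * q ^ (-2 * n))⁻¹ := by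
        rw [mul_inv, inv_inv, neg_mul, zpow_neg, inv_inv]
      rw [e, norm_inv]
      apply one_le_inv₀ _ |>.mpr (h2.trans hρ1.le)
      have : q ^ (-2 * n) ≠ 0 := zpow_ne_zero _ hq0
      exact norm_pos_iff.mpr (mul_ne_zero (inv_ne_zero hw) this)
    rw [e, norm_mul]
    nlinarith
  · refine (min_le_left _ _).trans ?_
    have h1 : ‖q‖ ^ (2 * n) ≤ ‖q‖ ^ 2 :=
      zpow_le_natAbs (norm_nonneg _) hq (k := 2) (by push_cast; omega)
    have h2 : ‖w * q ^ (2 * n)‖ ≤ R * ‖q‖ ^ 2 := by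
      rw [norm_mul, norm_zpow]
      exact mul_le_mul hR h1 (by positivity) ((norm_nonneg _).trans hR)
    have := norm_sub_norm_le (1 : ℂ) (w * q ^ (2 * n))
    rw [norm_one] at this
    linarith

lemma fterm_bound {q w : ℂ} {ρ R : ℝ} (hq : ‖q‖ < 1) (hq0 : q ≠ 0) (hw : w ≠ 0)
    (hρ : ‖w⁻¹‖ ≤ ρ) (hρ1 : ρ * ‖q‖ ^ 2 < 1) (hR : ‖w‖ ≤ R) (hR1 : R * ‖q‖ ^ 2 < 1) (n : ℤ) :
    ‖(if n = 0 then 0 else th q n / (1 - w * q ^ (2 * n)))‖ ≤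
      (min (1 - R * ‖q‖ ^ 2) (1 - ρ * ‖q‖ ^ 2))⁻¹ * ‖th q n‖ := by
  have hm : 0 < min (1 - R * ‖q‖ ^ 2) (1 - ρ * ‖q‖ ^ 2) := lt_min (by linarith) (by linarith)
  split_ifs with h
  · rw [norm_zero]; positivity
  · rw [norm_div, div_eq_inv_mul]
    have := den_bound hq hq0 hw hρ hρ1 hR hR1 h
    gcongr

lemma f0_summable {q w : ℂ} (hq : ‖q‖ < 1) (hq0 : q ≠ 0) (hw : w ∈ annul q) :
    Summable fun n : ℤ => if n = 0 then 0 else th q n / (1 - w * q ^ (2 * n)) :=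
  Summable.of_norm_bounded ((th_summable_norm hq).mul_left _)
    (fterm_bound hq hq0 hw.1 le_rfl hw.2.1 le_rfl hw.2.2)

lemma f_split_term (q w : ℂ) (n : ℤ) : th q n / (1 - w * q ^ (2 * n)) =
    (if n = 0 then 0 else th q n / (1 - w * q ^ (2 * n))) + (if n = 0 then (1 - w)⁻¹ else 0) := by
  by_cases h : n = 0
  · subst h; simp [th]
  · simp [h]

lemma f_summable {q w : ℂ} (hq : ‖q‖ < 1) (hq0 : q ≠ 0) (hw : w ∈ annul q) :
    Summable fun n : ℤ => th q n / (1 - w * q ^ (2 * n)) := by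
  rw [funext (f_split_term q w)]
  exact (f0_summable hq hq0 hw).add (hasSum_ite_eq 0 _).summable

lemma fq_eq {q w : ℂ} (hq : ‖q‖ < 1) (hq0 : q ≠ 0) (hw : w ∈ annul q) :
    fq q w = fq0 q w + (1 - w)⁻¹ := by
  unfold fq fq0
  rw [tsum_congr (f_split_term q w), (f0_summable hq hq0 hw).tsum_add (hasSum_ite_eq 0 _).summable,
    tsum_ite_eq]

lemma exists_annul {q : ℂ} {w₀ : ℂ} (hw : w₀ ∈ annul q) : ∃ ρ R : ℝ, ∃ U : Set ℂ,
    0 ≤ ρ ∧ 0 ≤ R ∧ ρ * ‖q‖ ^ 2 < 1 ∧ R * ‖q‖ ^ 2 < 1 ∧ IsOpen U ∧ w₀ ∈ U ∧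
    ∀ w ∈ U, w ≠ 0 ∧ ‖w⁻¹‖ ≤ ρ ∧ ‖w‖ ≤ R := by
  obtain ⟨h0, h1, h2⟩ := hw
  have aux : ∀ a : ℝ, a * ‖q‖ ^ 2 < 1 → ∃ ρ, a < ρ ∧ ρ * ‖q‖ ^ 2 < 1 := by
    intro a h
    have : Tendsto (fun ρ : ℝ => ρ * ‖q‖ ^ 2) (𝓝[>] a) (𝓝 (a * ‖q‖ ^ 2)) :=
      ((continuous_id.mul continuous_const).tendsto _).mono_left nhdsWithin_le_nhds
    have := (this.eventually (gt_mem_nhds h)).and self_mem_nhdsWithin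
    obtain ⟨ρ, a, b⟩ := this.exists
    exact ⟨ρ, b, a⟩
  obtain ⟨ρ, hρ, hρ'⟩ := aux _ h1
  obtain ⟨R, hR, hR'⟩ := aux _ h2
  have hU : IsOpen (({w : ℂ | w ≠ 0} ∩ {w | 1 < ρ * ‖w‖}) ∩ {w | ‖w‖ < R}) := by
    refine ((isOpen_ne).inter ?_).inter ?_
    · exact isOpen_lt continuous_const (by fun_prop)
    · exact isOpen_lt (by fun_prop) continuous_const
  refine ⟨ρ, R, _, (norm_nonneg _).trans hρ.le, (norm_nonneg _).trans hR.le, hρ', hR', hU, ?_, ?_⟩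
  · refine ⟨⟨h0, ?_⟩, hR⟩
    rw [norm_inv, inv_lt_iff_one_lt_mul₀ (norm_pos_iff.mpr h0)] at hρ
    exact hρ
  · rintro w ⟨⟨a, b⟩, c⟩
    refine ⟨a, ?_, le_of_lt c⟩
    rw [norm_inv]
    apply le_of_lt
    rw [inv_lt_iff_one_lt_mul₀ (norm_pos_iff.mpr a)]
    exact b

lemma den_ne' {q w : ℂ} (hq : ‖q‖ < 1) (hq0 : q ≠ 0) (hw : w ∈ annul q) {n : ℤ} (hn : n ≠ 0) :
    1 - w * q ^ (2 * n) ≠ 0 := by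
  have := den_bound hq hq0 hw.1 le_rfl hw.2.1 le_rfl hw.2.2 hn
  have hm : 0 < min (1 - ‖w‖ * ‖q‖ ^ 2) (1 - ‖w⁻¹‖ * ‖q‖ ^ 2) :=
    lt_min (by linarith [hw.2.2]) (by linarith [hw.2.1])
  exact norm_pos_iff.mp (hm.trans_le this)

lemma fq0_differentiableAt {q : ℂ} (hq : ‖q‖ < 1) (hq0 : q ≠ 0) {w₀ : ℂ} (hw : w₀ ∈ annul q) :
    DifferentiableAt ℂ (fq0 q) w₀ := by
  obtain ⟨ρ, R, U, hρ0, hR0, hρ, hR, hUo, hwU, hU⟩ := exists_annul hw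
  have hd : DifferentiableOn ℂ (fq0 q) U := by
    apply Complex.differentiableOn_tsum_of_summable_norm
      ((th_summable_norm hq).mul_left (min (1 - R * ‖q‖ ^ 2) (1 - ρ * ‖q‖ ^ 2))⁻¹)
    · intro n w hw
      obtain ⟨a, b, c⟩ := hU w hw
      by_cases h : n = 0
      · simp only [h, if_true]; exact differentiableWithinAt_const _
      · simp only [h, if_false]
        have hq2 : 0 ≤ ‖q‖ ^ 2 := by positivity
        have := den_ne' hq hq0 (w := w) ⟨a, by nlinarith, by nlinarith⟩ h
        apply DifferentiableAt.differentiableWithinAt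
        fun_prop (disch := assumption)
    · exact hUo
    · intro n w hw
      obtain ⟨a, b, c⟩ := hU w hw
      exact fterm_bound hq hq0 a b hρ c hR n
  exact hd.differentiableAt (hUo.mem_nhds hwU)

lemma th_pred {q : ℂ} (hq0 : q ≠ 0) (n : ℤ) : th q (n - 1) = -(th q n * (q * (q ^ (2 * n))⁻¹ ^ 2)) := by
  unfold th
  rw [zpow_sub_one₀ (by norm_num)]
  have : 2 * (n - 1) ^ 2 + (n - 1) = (2 * n ^ 2 + n) + 1 - (2 * n) - (2 * n) := by ring
  rw [this, zpow_sub₀ hq0, zpow_sub₀ hq0, zpow_add_one₀ hq0]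
  have : q ^ (2 * n) ≠ 0 := zpow_ne_zero _ hq0
  field_simp

lemma th_neg {q : ℂ} (hq0 : q ≠ 0) (n : ℤ) : th q (-n) = th q n * (q ^ (2 * n))⁻¹ := by
  unfold th
  have : 2 * (-n) ^ 2 + (-n) = (2 * n ^ 2 + n) - (2 * n) := by ring
  rw [this, zpow_sub₀ hq0]
  have : (-1 : ℂ) ^ (-n) = (-1) ^ n := by
    rw [zpow_neg, ← inv_zpow]; norm_num
  rw [this]; ring

lemma tsum_th_neg (q : ℂ) : ∑' n : ℤ, th q (-n) = theta q := by
  unfold theta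
  rw [← (Equiv.neg ℤ).tsum_eq (fun n => th q n)]
  rfl

lemma tsum_th_pred (q : ℂ) : ∑' n : ℤ, th q (n - 1) = theta q := by
  unfold theta
  rw [← (Equiv.subRight (1 : ℤ)).tsum_eq (fun n => th q n)]
  rfl

lemma summable_shift {f : ℤ → ℂ} (hf : Summable f) (k : ℤ) : Summable fun n : ℤ => f (n - k) := by
  have := (Equiv.subRight k).summable_iff (f := f)
  exact this.mpr hf

lemma summable_neg {f : ℤ → ℂ} (hf : Summable f) : Summable fun n : ℤ => f (-n) := by
  have := (Equiv.neg ℤ).summable_iff (f := f)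
  exact this.mpr hf

lemma tsum_shift (f : ℤ → ℂ) (k : ℤ) : ∑' n : ℤ, f (n - k) = ∑' n : ℤ, f n :=
  (Equiv.subRight k).tsum_eq f

lemma fq_feq {q w : ℂ} (hq : ‖q‖ < 1) (hq0 : q ≠ 0) (hw : 1 < ‖w‖) (h2 : ‖w‖ * ‖q‖ ^ 2 < 1) :
    fq q (w * q ^ 2) = -q * w ^ 2 * fq q w + (1 - q * w) * theta q := by
  have hw0 : w ≠ 0 := norm_pos_iff.mp (by linarith)
  have hqn : 0 < ‖q‖ := norm_pos_iff.mpr hq0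
  have hwi : ‖w⁻¹‖ < 1 := by rw [norm_inv]; exact inv_lt_one_of_one_lt₀ hw
  have h1 : ‖w⁻¹‖ * ‖q‖ ^ 2 < 1 := by
    have : ‖q‖ ^ 2 ≤ 1 := pow_le_one₀ hqn.le hq.le
    nlinarith [norm_nonneg w⁻¹]
  have ha : w ∈ annul q := ⟨hw0, h1, h2⟩
  have hne1 : 1 - w ≠ 0 := by
    intro h
    rw [← sub_eq_zero.mp h] at hw
    simp at hw
  have hden : ∀ n : ℤ, 1 - w * q ^ (2 * n) ≠ 0 := by
    intro n
    by_cases h : n = 0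
    · subst h; simpa using hne1
    · exact den_ne' hq hq0 ha h
  unfold fq
  rw [← tsum_shift _ 1]
  have sneg := summable_neg (th_summable hq)
  have spred := summable_shift (th_summable hq) 1
  have e : ∀ n : ℤ, th q (n - 1) / (1 - w * q ^ 2 * q ^ (2 * (n - 1))) =
      (-q * w ^ 2) * (th q n / (1 - w * q ^ (2 * n))) + (th q (n - 1) - (q * w) * th q (-n)) := by
    intro n
    have e1 : w * q ^ 2 * q ^ (2 * (n - 1)) = w * q ^ (2 * n) := by
      have : 2 * (n - 1) = 2 * n - 2 := by ring
      rw [this, zpow_sub₀ hq0]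
      norm_cast
      field_simp
    rw [e1, th_pred hq0, th_neg hq0]
    have hd := hden n
    have hX : q ^ (2 * n) ≠ 0 := zpow_ne_zero _ hq0
    generalize q ^ (2 * n) = X at hd hX ⊢
    rw [div_eq_iff hd, add_mul, mul_assoc (-q * w ^ 2), div_mul_cancel₀ _ hd]
    field_simp
    ring
  rw [tsum_congr e, ((f_summable hq hq0 ha).mul_left _).tsum_add (spred.sub (sneg.mul_left _)),
    tsum_mul_left, spred.tsum_sub (sneg.mul_left _), tsum_mul_left, tsum_th_neg, tsum_th_pred]
  ring

end M2R

namespace M2R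
open Filter Topology

lemma circle_scale (h : ℂ → ℂ) (R : ℝ) (a : ℂ) :
    (∮ z in C(0, R * ‖a‖), h z) = a * ∮ z in C(0, R), h (a * z) := by
  have key : ∀ t : ℝ, circleMap 0 (R * ‖a‖) (t + a.arg) = a * circleMap 0 R t := by
    intro t
    simp only [circleMap, zero_add]
    push_cast
    rw [add_mul, Complex.exp_add]
    conv_rhs => rw [← Complex.norm_mul_exp_arg_mul_I a]
    ring
  simp only [circleIntegral]
  have hp : Function.Periodic (fun t : ℝ => deriv (circleMap 0 (R * ‖a‖)) t •
      h (circleMap 0 (R * ‖a‖) t)) (2 * Real.pi) := by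
    intro t
    simp only [deriv_circleMap, periodic_circleMap 0 (R * ‖a‖) t]
  have h1 := hp.intervalIntegral_add_eq 0 a.arg
  rw [zero_add] at h1
  rw [h1, add_comm a.arg, ← zero_add a.arg, ← add_assoc, add_zero]
  have h2 := intervalIntegral.integral_comp_add_right (a := 0) (b := 2 * Real.pi) (fun t : ℝ =>
    deriv (circleMap 0 (R * ‖a‖)) t • h (circleMap 0 (R * ‖a‖) t)) a.arg
  rw [← h2, ← intervalIntegral.integral_const_mul]
  congr 1
  ext t
  simp only [deriv_circleMap, key, smul_eq_mul]
  ring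

/-- Laurent coefficients -/
noncomputable def Lc (g : ℂ → ℂ) (R : ℝ) (j : ℤ) : ℂ := ∮ w in C(0, R), w ^ (-j - 1) * g w

lemma Lc_annulus {q : ℂ} {g : ℂ → ℂ} (hg : ∀ w ∈ annul q, DifferentiableAt ℂ g w)
    {r R : ℝ} (hr : 0 < r) (hrR : r ≤ R) (hr1 : r⁻¹ * ‖q‖ ^ 2 < 1) (hR1 : R * ‖q‖ ^ 2 < 1) (j : ℤ) :
    Lc g R j = Lc g r j := by
  have mem : ∀ w : ℂ, r ≤ ‖w‖ → ‖w‖ ≤ R → w ∈ annul q := by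
    intro w h1 h2
    have hw : 0 < ‖w‖ := hr.trans_le h1
    refine ⟨norm_pos_iff.mp hw, ?_, ?_⟩
    · refine lt_of_le_of_lt ?_ hr1
      rw [norm_inv]
      gcongr
    · refine lt_of_le_of_lt ?_ hR1
      gcongr
  have hd : ∀ w : ℂ, r ≤ ‖w‖ → ‖w‖ ≤ R → DifferentiableAt ℂ (fun w => w ^ (-j - 1) * g w) w := by
    intro w h1 h2
    have hm := mem w h1 h2
    exact (differentiableAt_id.zpow (Or.inl hm.1)).mul (hg w hm)
  unfold Lc
  apply Complex.circleIntegral_eq_of_differentiable_on_annulus_off_countable hr hrR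
    (Set.countable_empty)
  · intro w hw
    simp only [Set.mem_sdiff, Metric.mem_closedBall, Metric.mem_ball, dist_zero_right, not_lt] at hw
    exact (hd w hw.2 hw.1).continuousAt.continuousWithinAt
  · intro w hw
    simp only [Set.mem_sdiff, Metric.mem_closedBall, Metric.mem_ball, dist_zero_right, not_le,
      Set.sdiff_empty] at hw
    exact hd w hw.2.le hw.1.le

lemma Lc_unique {g : ℂ → ℂ} (hg : ∀ w : ℂ, ‖w‖ = 1 → ContinuousAt g w)
    (h : ∀ j, Lc g 1 j = 0) : ∀ w : ℂ, ‖w‖ = 1 → g w = 0 := by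
  have : Fact (0 < 2 * Real.pi) := ⟨Real.two_pi_pos⟩
  let F : C(AddCircle (2 * Real.pi), ℂ) := ⟨fun t => g (AddCircle.toCircle t), by
    rw [continuous_iff_continuousAt]
    intro t
    have h1 : ContinuousAt g (AddCircle.toCircle t : ℂ) := hg _ (Circle.norm_coe _)
    have h2 : ContinuousAt (fun t : AddCircle (2 * Real.pi) => (AddCircle.toCircle t : ℂ)) t :=
      (by have := AddCircle.continuous_toCircle (T := 2 * Real.pi); fun_prop : Continuous _).continuousAt
    exact ContinuousAt.comp (f := fun t : AddCircle (2 * Real.pi) => (AddCircle.toCircle t : ℂ)) h1 h2⟩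
  have hF : ∀ x : ℝ, F (x : AddCircle (2 * Real.pi)) = g (circleMap 0 1 x) := by
    intro x
    change g _ = _
    rw [AddCircle.toCircle_apply_mk, Circle.coe_exp, circleMap]
    have hpi : Real.pi ≠ 0 := Real.pi_ne_zero
    congr 1
    push_cast
    rw [div_self (by simp [hpi]), one_mul, zero_add, one_mul]
  have hc : ∀ j, fourierCoeff F j = 0 := by
    intro j
    rw [fourierCoeff_eq_intervalIntegral F j 0]
    have h1 := h j
    simp only [Lc, circleIntegral] at h1
    have : ∫ x in (0:ℝ)..0 + 2 * Real.pi, (fourier (-j)) (x : AddCircle (2 * Real.pi)) • F x =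
        Complex.I⁻¹ * ∫ θ in (0:ℝ)..2 * Real.pi,
          deriv (circleMap 0 1) θ • (circleMap 0 1 θ ^ (-j - 1) * g (circleMap 0 1 θ)) := by
      rw [← intervalIntegral.integral_const_mul, zero_add]
      congr 1
      ext x
      rw [hF, fourier_coe_apply, deriv_circleMap]
      have hne : circleMap 0 1 x ≠ 0 := circleMap_ne_center (by norm_num)
      rw [zpow_sub_one₀ hne]
      have : Complex.exp (2 * Real.pi * Complex.I * ((-j : ℤ) : ℂ) * x / ((2 * Real.pi : ℝ) : ℂ)) =
          circleMap 0 1 x ^ (-j) := by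
        simp only [circleMap, zero_add, Complex.ofReal_one, one_mul]
        rw [← Complex.exp_int_mul]
        congr 1
        have hpi : (Real.pi : ℂ) ≠ 0 := by exact_mod_cast Real.pi_ne_zero
        push_cast
        field_simp
      rw [this]
      simp only [smul_eq_mul]
      have hI : Complex.I ≠ 0 := Complex.I_ne_zero
      field_simp
    rw [this, h1]
    simp
  have hs : Summable (fourierCoeff F) := by
    rw [funext hc]; exact summable_zero
  intro w hw
  have := has_pointwise_sum_fourier_series_of_summable hs ((w.arg : ℝ) : AddCircle (2 * Real.pi))
  have e : (fun i => fourierCoeff F i • (fourier i) ((w.arg : ℝ) : AddCircle (2 * Real.pi))) =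
    fun _ => 0 := by ext i; rw [hc]; simp
  rw [e, hF] at this
  have h0 := this.unique hasSum_zero
  have : circleMap 0 1 w.arg = w := by
    simp only [circleMap, zero_add]
    rw [← hw, Complex.norm_mul_exp_arg_mul_I]
  rwa [this] at h0

/-- the difference function -/
noncomputable def Phi (q w : ℂ) : ℂ := theta q * Hq q w - 1 - (1 - w) * fq0 q w

lemma Phi_diff {q : ℂ} (hq : ‖q‖ < 1) (hq0 : q ≠ 0) : ∀ w ∈ annul q, DifferentiableAt ℂ (Phi q) w := by
  intro w hw
  have h1 := Hq_differentiableAt hq hw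
  have h2 := fq0_differentiableAt hq hq0 hw
  unfold Phi
  fun_prop

lemma Phi_div {q w : ℂ} (hq : ‖q‖ < 1) (hq0 : q ≠ 0) (hw : w ∈ annul q) (hw1 : 1 - w ≠ 0) :
    Phi q w / (1 - w) = theta q * (Hq q w / (1 - w)) - fq q w := by
  rw [fq_eq hq hq0 hw, Phi]
  field_simp
  ring

lemma Phi_feq {q w : ℂ} (hq : ‖q‖ < 1) (hq0 : q ≠ 0) (hw : 1 < ‖w‖) (h2 : ‖w‖ * ‖q‖ ^ 2 < 1) :
    Phi q (q ^ 2 * w) / (1 - q ^ 2 * w) = -q * w ^ 2 * (Phi q w / (1 - w)) := by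
  have hw0 : w ≠ 0 := norm_pos_iff.mp (by linarith)
  have hqn : 0 < ‖q‖ := norm_pos_iff.mpr hq0
  have hq2 : ‖q‖ ^ 2 < 1 := pow_lt_one₀ hqn.le hq (by norm_num)
  have hwi : ‖w⁻¹‖ < 1 := by rw [norm_inv]; exact inv_lt_one_of_one_lt₀ hw
  have h1 : ‖w⁻¹‖ * ‖q‖ ^ 2 < 1 := by
    nlinarith [norm_nonneg w⁻¹]
  have h3 : ‖w * q ^ 2‖ < 1 := by rwa [norm_mul, norm_pow]
  have h4 : ‖(w * q ^ 2)⁻¹‖ * ‖q‖ ^ 2 < 1 := by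
    rw [mul_inv, norm_mul, norm_inv (q ^ 2), norm_pow, mul_assoc,
      inv_mul_cancel₀ (by positivity), mul_one]
    exact hwi
  have hne1 : 1 - w ≠ 0 := by
    intro h
    rw [← sub_eq_zero.mp h] at hw
    simp at hw
  have hne2 : 1 - w * q ^ 2 ≠ 0 := by
    intro h
    rw [← sub_eq_zero.mp h] at h3
    simp at h3
  rw [mul_comm (q ^ 2) w, Phi_div hq hq0 ⟨hw0, h1, h2⟩ hne1,
    Phi_div hq hq0 ⟨mul_ne_zero hw0 (pow_ne_zero _ hq0), h4, by nlinarith [norm_nonneg (w * q ^ 2)]⟩ hne2, Hq_feq hq hq0 hw h2,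
    fq_feq hq hq0 hw h2]
  ring

lemma Phi_zero {q : ℂ} (hq : ‖q‖ < 1) (hq0 : q ≠ 0) (hθ : theta q ≠ 0) :
    ∀ w : ℂ, ‖w‖ = 1 → Phi q w = 0 := by
  set r := ‖q‖ with hr
  have hr0 : 0 < r := norm_pos_iff.mpr hq0
  have hr2 : r ^ 2 < 1 := pow_lt_one₀ hr0.le hq (by norm_num)
  have hri : 1 < r⁻¹ := (one_lt_inv₀ hr0).mpr hq
  have hrr : r⁻¹ * r ^ 2 < 1 := by rw [pow_two, ← mul_assoc, inv_mul_cancel₀ hr0.ne', one_mul]; exact hq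
  have hrr' : r * r ^ 2 < 1 := by nlinarith
  set dd : ℂ → ℂ := fun w => Phi q w / (1 - w) with hdd
  have memA : ∀ w : ℂ, ‖w‖ = r ∨ ‖w‖ = r⁻¹ → w ∈ annul q ∧ 1 - w ≠ 0 := by
    intro w hw
    have hpos : 0 < ‖w‖ := by rcases hw with h | h <;> rw [h] <;> positivity
    refine ⟨⟨norm_pos_iff.mp hpos, ?_, ?_⟩, ?_⟩
    · rw [norm_inv]; rcases hw with h | h <;> rw [h]
      · exact hrr
      · rw [inv_inv]; exact hrr'
    · rcases hw with h | h <;> rw [h]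
      · exact hrr'
      · exact hrr
    · intro h
      rw [← sub_eq_zero.mp h, norm_one] at hw
      rcases hw with h | h <;> linarith
  have ddc : ∀ w : ℂ, ‖w‖ = r ∨ ‖w‖ = r⁻¹ → ContinuousAt dd w := by
    intro w hw
    obtain ⟨h1, h2⟩ := memA w hw
    have := (Phi_diff hq hq0 w h1).continuousAt
    exact this.div (by fun_prop) h2
  have ci : ∀ ρ : ℝ, ρ = r ∨ ρ = r⁻¹ → ∀ j : ℤ, CircleIntegrable (fun w => w ^ (-j - 1) * dd w) 0 ρ := by
    intro ρ hρ j
    have hρ0 : 0 < ρ := by rcases hρ with h | h <;> rw [h] <;> positivity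
    apply ContinuousOn.circleIntegrable hρ0.le
    intro w hw
    rw [mem_sphere_zero_iff_norm] at hw
    have h1 := ddc w (by rw [hw]; exact hρ)
    have hw0 : w ≠ 0 := norm_pos_iff.mp (hw ▸ hρ0)
    exact ((continuousAt_zpow₀ w _ (Or.inl hw0)).mul h1).continuousWithinAt
  have shift : ∀ j : ℤ, Lc dd r j = -q * (q ^ 2) ^ (-j) * Lc dd r⁻¹ (j - 2) := by
    intro j
    have h1 := circle_scale (fun w => w ^ (-j - 1) * dd w) r⁻¹ (q ^ 2)
    have e1 : r⁻¹ * ‖q ^ 2‖ = r := by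
      rw [norm_pow, ← hr, pow_two, ← mul_assoc, inv_mul_cancel₀ hr0.ne', one_mul]
    rw [e1] at h1
    unfold Lc
    rw [h1, ← circleIntegral.integral_const_mul, ← circleIntegral.integral_const_mul]
    apply circleIntegral.integral_congr (by positivity)
    intro w hw
    rw [mem_sphere_zero_iff_norm] at hw
    have hw0 : w ≠ 0 := norm_pos_iff.mp (by rw [hw]; positivity)
    have hf := Phi_feq hq hq0 (w := w) (by rw [hw]; exact hri) (by rw [hw]; exact hrr)
    simp only [hdd]
    rw [hf, mul_zpow, zpow_sub_one₀ (pow_ne_zero 2 hq0)]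
    have : -(j - 2) - 1 = (-j - 1) + 2 := by ring
    rw [this, zpow_add₀ hw0]
    norm_cast
    field_simp
  have hPhi : ∀ ρ : ℝ, ρ = r ∨ ρ = r⁻¹ → ∀ j : ℤ, Lc (Phi q) ρ j = Lc dd ρ j - Lc dd ρ (j - 1) := by
    intro ρ hρ j
    have hρ0 : 0 < ρ := by rcases hρ with h | h <;> rw [h] <;> positivity
    unfold Lc
    rw [← circleIntegral.integral_sub (ci ρ hρ _) (ci ρ hρ _)]
    apply circleIntegral.integral_congr hρ0.le
    intro w hw
    rw [mem_sphere_zero_iff_norm] at hw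
    have hw0 : w ≠ 0 := norm_pos_iff.mp (hw ▸ hρ0)
    have hw1 := (memA w (by rw [hw]; exact hρ)).2
    have : -(j - 1) - 1 = (-j - 1) + 1 := by ring
    simp only [hdd]
    rw [this, zpow_add_one₀ hw0]
    field_simp
  have hann : ∀ j, Lc (Phi q) r⁻¹ j = Lc (Phi q) r j := fun j =>
    Lc_annulus (Phi_diff hq hq0) hr0 (by linarith) hrr hrr j
  set D : ℤ → ℂ := fun j => Lc dd r j with hD
  set δ : ℂ := D 0 - Lc dd r⁻¹ 0 with hδ
  have hδc : ∀ j : ℤ, D j - Lc dd r⁻¹ j = δ := by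
    have step : ∀ j : ℤ, D j - Lc dd r⁻¹ j = D (j - 1) - Lc dd r⁻¹ (j - 1) := by
      intro j
      have h1 := hann j
      rw [hPhi r (Or.inl rfl), hPhi r⁻¹ (Or.inr rfl)] at h1
      simp only [hD]
      linear_combination -h1
    intro j
    induction j using Int.induction_on with
    | zero => rfl
    | succ i ih => rw [step, add_sub_cancel_right, ih]
    | pred i ih => rw [← ih, step (-i)]
  have recD : ∀ j : ℤ, D j = -q * (q ^ 2) ^ (-j) * (D (j - 2) - δ) := by
    intro j
    have := hδc (j - 2)
    rw [← this]
    simp only [hD]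
    rw [shift j]
    ring
  obtain ⟨B, hB0, hB⟩ : ∃ B : ℝ, 0 ≤ B ∧ ∀ w : ℂ, ‖w‖ = r → ‖dd w‖ ≤ B := by
    have hc : ContinuousOn dd (Metric.sphere 0 r) := by
      intro w hw
      rw [mem_sphere_zero_iff_norm] at hw
      exact (ddc w (Or.inl hw)).continuousWithinAt
    obtain ⟨B, hB⟩ := (isCompact_sphere (0 : ℂ) r).exists_bound_of_continuousOn hc
    refine ⟨max B 0, le_max_right _ _, fun w hw => (hB w ?_).trans (le_max_left _ _)⟩
    rwa [mem_sphere_zero_iff_norm]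
  have hDb : ∀ j : ℤ, ‖D j‖ ≤ 2 * Real.pi * B * r ^ (-j) := by
    intro j
    have := circleIntegral.norm_integral_le_of_norm_le_const (f := fun w => w ^ (-j - 1) * dd w)
      (c := 0) (R := r) (C := r ^ (-j - 1) * B) hr0.le (by
        intro w hw
        rw [mem_sphere_zero_iff_norm] at hw
        rw [norm_mul, norm_zpow, hw]
        gcongr
        exact hB w hw)
    refine this.trans (le_of_eq ?_)
    rw [zpow_sub_one₀ hr0.ne']
    field_simp
  have thn : ∀ k : ℤ, ‖th q (-k)‖ = r ^ (2 * k ^ 2 - k) := by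
    intro k; rw [norm_th]; congr 1; ring
  -- even part
  have evs : Summable fun k : ℤ => th q k * D (2 * k) := by
    refine Summable.of_norm_bounded (g := fun k => 2 * Real.pi * B * ‖th q (-k)‖) ?_ ?_
    · apply Summable.mul_left
      have := (Equiv.neg ℤ).summable_iff (f := fun k => ‖th q k‖)
      exact this.mpr (th_summable_norm hq)
    · intro k
      rw [norm_mul, thn, norm_th, ← hr]
      calc r ^ (2 * k ^ 2 + k) * ‖D (2 * k)‖ ≤ r ^ (2 * k ^ 2 + k) * (2 * Real.pi * B * r ^ (-(2 * k))) := by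
            gcongr; exact hDb _
        _ = 2 * Real.pi * B * (r ^ (2 * k ^ 2 + k) * r ^ (-(2 * k))) := by ring
        _ = _ := by rw [← zpow_add₀ hr0.ne']; congr 2; ring
  have evr : ∀ k : ℤ, th q k * D (2 * k) = th q (k - 1) * D (2 * (k - 1)) - δ * th q (k - 1) := by
    intro k
    rw [recD (2 * k), th_pred hq0]
    have : 2 * k - 2 = 2 * (k - 1) := by ring
    rw [this]
    have e : (q ^ 2) ^ (-(2 * k)) = (q ^ (2 * k))⁻¹ ^ 2 := by
      rw [zpow_neg, inv_pow, ← zpow_natCast, ← zpow_natCast, ← zpow_mul, ← zpow_mul]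
      congr 2; push_cast; ring
    rw [e]
    ring
  have hδ0 : δ = 0 := by
    have h1 := summable_shift evs 1
    have h2 := (summable_shift (th_summable hq) 1).mul_left δ
    have h3 : ∑' k : ℤ, th q k * D (2 * k) = ∑' k : ℤ, th q k * D (2 * k) - δ * theta q := by
      conv_lhs => rw [tsum_congr evr, h1.tsum_sub h2, tsum_mul_left, tsum_th_pred]
      rw [tsum_shift (fun k => th q k * D (2 * k)) 1]
    have : δ * theta q = 0 := by linear_combination h3
    exact (mul_eq_zero.mp this).resolve_right hθ
  have const_zero : ∀ v : ℤ → ℂ, Summable v → (∀ k, v k = v (k - 1)) → ∀ k, v k = 0 := by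
    intro v hs hv k
    have hc : ∀ k, v k = v 0 := by
      intro k
      induction k using Int.induction_on with
      | zero => rfl
      | succ i ih => rw [hv, add_sub_cancel_right, ih]
      | pred i ih => rw [← hv, ih]
    have : v = fun _ => v 0 := funext hc
    rw [this] at hs
    rw [hc k]
    exact tendsto_nhds_unique tendsto_const_nhds hs.tendsto_cofinite_zero
  have thne : ∀ k, th q k ≠ 0 := fun k =>
    mul_ne_zero (zpow_ne_zero _ (by norm_num)) (zpow_ne_zero _ hq0)
  have ev0 : ∀ k : ℤ, D (2 * k) = 0 := by
    intro k
    have := const_zero _ evs (fun k => by rw [evr k, hδ0]; ring) k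
    exact (mul_eq_zero.mp this).resolve_left (thne k)
  have ods : Summable fun k : ℤ => (th q k * q ^ (2 * k)) * D (2 * k + 1) := by
    refine Summable.of_norm_bounded (g := fun k => 2 * Real.pi * B * r⁻¹ * ‖th q k‖) ?_ ?_
    · exact (th_summable_norm hq).mul_left _
    · intro k
      rw [norm_mul, norm_mul, norm_th, norm_zpow, ← hr]
      calc r ^ (2 * k ^ 2 + k) * r ^ (2 * k) * ‖D (2 * k + 1)‖
          ≤ r ^ (2 * k ^ 2 + k) * r ^ (2 * k) * (2 * Real.pi * B * r ^ (-(2 * k + 1))) := by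
            gcongr; exact hDb _
        _ = _ := by
          rw [zpow_neg, zpow_add_one₀ hr0.ne' (2 * k)]
          have : r ^ (2 * k) ≠ 0 := zpow_ne_zero _ hr0.ne'
          field_simp
  have od0 : ∀ k : ℤ, D (2 * k + 1) = 0 := by
    intro k
    have := const_zero _ ods (fun k => by
      rw [recD (2 * k + 1), th_pred hq0, hδ0]
      have e1 : 2 * k + 1 - 2 = 2 * (k - 1) + 1 := by ring
      have e2 : 2 * (k - 1) = 2 * k - 2 := by ring
      have e : (q ^ 2) ^ (-(2 * k + 1)) = (q ^ (2 * k))⁻¹ ^ 2 * (q ^ 2)⁻¹ := by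
        rw [zpow_neg, zpow_add_one₀ (pow_ne_zero 2 hq0), mul_inv, inv_pow, ← zpow_natCast q 2,
          ← zpow_natCast _ 2, ← zpow_mul, ← zpow_mul]
        congr 3; push_cast; ring
      rw [e1, e2, e, zpow_sub₀ hq0]
      have : q ^ (2 * k) ≠ 0 := zpow_ne_zero _ hq0
      norm_cast
      field_simp
      ring) k
    exact (mul_eq_zero.mp this).resolve_left (mul_ne_zero (thne k) (zpow_ne_zero _ hq0))
  have D0 : ∀ j, D j = 0 := by
    intro j
    rcases Int.even_or_odd' j with ⟨k, h | h⟩ <;> rw [h]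
    · exact ev0 k
    · exact od0 k
  have L1 : ∀ j, Lc (Phi q) 1 j = 0 := by
    intro j
    rw [Lc_annulus (Phi_diff hq hq0) hr0 hq.le hrr (by rw [one_mul]; exact hr2) j,
      hPhi r (Or.inl rfl)]
    change D j - D (j - 1) = 0
    rw [D0, D0, sub_zero]
  apply Lc_unique _ L1
  intro w hw
  apply (Phi_diff hq hq0 w ⟨norm_pos_iff.mp (by rw [hw]; norm_num), ?_, ?_⟩).continuousAt
  · rw [norm_inv, hw, inv_one, one_mul]; exact hr2
  · rw [hw, one_mul]; exact hr2

end M2R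

namespace M2R
open Filter Topology

/-- Euler product -/
noncomputable def Eul (q : ℂ) : ℂ := ∏' n : ℕ, (1 - q ^ (n + 1))

lemma Eul_ne {q : ℂ} (hq : ‖q‖ < 1) : Eul q ≠ 0 := by
  unfold Eul
  have h := tprod_one_add_ne_zero_of_summable (f := fun n : ℕ => -q ^ (n + 1)) (fun n => by
    intro h
    have h1 : q ^ (n + 1) = 1 := by linear_combination -h
    have h2 : ‖q‖ ^ (n + 1) = 1 := by rw [← norm_pow, h1, norm_one]
    have := pow_lt_one₀ (norm_nonneg q) hq (by omega : n + 1 ≠ 0)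
    linarith) (by
    have := (summable_nat_add_iff 1).mpr (summable_geometric_of_lt_one (norm_nonneg _) hq)
    simpa using this)
  simpa [sub_eq_add_neg] using h

lemma Eul_tendsto {q : ℂ} (hq : ‖q‖ < 1) :
    Tendsto (fun N : ℕ => ∏ j ∈ Finset.range N, (1 - q ^ (j + 1))) atTop (𝓝 (Eul q)) :=
  (ModularForm.multipliable_one_sub_pow hq).hasProd.tendsto_prod_nat

lemma Fq_one_finite {q : ℂ} (hq : ‖q‖ < 1) (M : ℕ) :
    Fq q 1 M * (∏ j ∈ Finset.range M, (1 - (q ^ 4) ^ (j + 1))) *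
      (∏ j ∈ Finset.range (2 * M), (1 - q ^ (j + 1))) =
      ∏ j ∈ Finset.range (2 * M), (1 - (q ^ 2) ^ (j + 1)) := by
  induction M with
  | zero => simp [Fq_zero]
  | succ M ih =>
    have h2 : 2 * (M + 1) = 2 * M + 1 + 1 := by ring
    rw [h2, Finset.prod_range_succ, Finset.prod_range_succ, Finset.prod_range_succ,
      Finset.prod_range_succ, Finset.prod_range_succ, ← ih, Fq_succ]
    have hd := den_ne hq (z := 1) (by rw [norm_one, one_mul]; exact pow_lt_one₀ (norm_nonneg q) hq (by norm_num)) M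
    rw [one_mul] at hd ⊢
    rw [one_mul]
    field_simp
    ring

lemma Hq_one_tendsto {q : ℂ} (hq : ‖q‖ < 1) :
    Tendsto (fun M => Fq q 1 M) atTop (𝓝 (Hq q 1)) := by
  have hq2 : ‖q‖ ^ 2 < 1 := pow_lt_one₀ (norm_nonneg q) hq (by norm_num)
  have hs := Hterm_summable (q := q) (w := 1) hq (by simpa using hq2) (by simpa using hq2)
  have := hs.hasSum.tendsto_sum_nat.const_add 1
  unfold Hq
  refine this.congr (fun N => ?_)
  simp only [one_pow, one_mul, inv_one]
  rw [Finset.sum_range_sub (fun M => Fq q 1 M), Fq_zero]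
  ring

lemma norm_pow_lt {q : ℂ} (hq : ‖q‖ < 1) {k : ℕ} (hk : k ≠ 0) : ‖q ^ k‖ < 1 := by
  rw [norm_pow]; exact pow_lt_one₀ (norm_nonneg q) hq hk

lemma Hq_one {q : ℂ} (hq : ‖q‖ < 1) : Hq q 1 * Eul (q ^ 4) * Eul q = Eul (q ^ 2) := by
  have t2 : Tendsto (fun M : ℕ => 2 * M) atTop atTop :=
    tendsto_id.const_mul_atTop' (by norm_num)
  have h1 := ((Hq_one_tendsto hq).mul (Eul_tendsto (norm_pow_lt hq (k := 4) (by norm_num)))).mul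
    ((Eul_tendsto hq).comp t2)
  have h2 := (Eul_tendsto (norm_pow_lt hq (k := 2) (by norm_num))).comp t2
  refine tendsto_nhds_unique h1 (h2.congr (fun M => ?_))
  simp only [Function.comp_apply]
  exact (Fq_one_finite hq M).symm

lemma theta_eq_of_ne {q : ℂ} (hq : ‖q‖ < 1) (hq0 : q ≠ 0) (hθ : theta q ≠ 0) :
    theta q * Eul (q ^ 2) = Eul q * Eul (q ^ 4) := by
  have h := Phi_zero hq hq0 hθ 1 norm_one
  unfold Phi at h
  rw [sub_self, zero_mul, sub_zero] at h
  rw [← Hq_one hq]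
  linear_combination (Eul (q ^ 4) * Eul q) * h

lemma theta_diff : DifferentiableOn ℂ theta (Metric.ball 0 1) := by
  intro q₀ h0
  rw [mem_ball_zero_iff] at h0
  obtain ⟨r, hr1, hr2⟩ := exists_between h0
  have hr0 : 0 ≤ r := (norm_nonneg _).trans hr1.le
  have : DifferentiableOn ℂ theta (Metric.ball 0 r) := by
    apply Complex.differentiableOn_tsum_of_summable_norm (summable_natAbs hr0 hr2)
    · intro n q hq
      unfold th
      apply DifferentiableAt.differentiableWithinAt
      have h := abs_le_quad n
      exact (differentiableAt_const _).mul (differentiableAt_id.zpow (Or.inr (by omega)))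
    · exact Metric.isOpen_ball
    · intro n q hq
      rw [mem_ball_zero_iff] at hq
      refine (norm_th_le (hq.trans hr2) n).trans ?_
      gcongr
  exact (this.differentiableAt (Metric.isOpen_ball.mem_nhds (by rwa [mem_ball_zero_iff]))).differentiableWithinAt

lemma Eul_diff : DifferentiableOn ℂ Eul (Metric.ball 0 1) :=
  ModularForm.differentiableOn_tprod_one_sub_pow

lemma Eul_pow_diff (k : ℕ) (hk : k ≠ 0) : DifferentiableOn ℂ (fun q => Eul (q ^ k)) (Metric.ball 0 1) := by
  apply Eul_diff.comp (by fun_prop)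
  intro q hq
  rw [mem_ball_zero_iff] at hq ⊢
  exact norm_pow_lt hq hk

lemma theta_zero : theta 0 = 1 := by
  unfold theta
  rw [tsum_eq_single 0]
  · simp [th]
  · intro n hn
    have h := abs_le_quad n
    have : 2 * n ^ 2 + n ≠ 0 := by
      have := Int.natAbs_pos.mpr hn
      omega
    simp [th, zero_zpow _ this]

lemma theta_eq {q : ℂ} (hq : ‖q‖ < 1) : theta q * Eul (q ^ 2) = Eul q * Eul (q ^ 4) := by
  have hL : AnalyticOnNhd ℂ (fun q => theta q * Eul (q ^ 2)) (Metric.ball 0 1) :=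
    (theta_diff.mul (Eul_pow_diff 2 (by norm_num))).analyticOnNhd Metric.isOpen_ball
  have hR : AnalyticOnNhd ℂ (fun q => Eul q * Eul (q ^ 4)) (Metric.ball 0 1) :=
    (Eul_diff.mul (Eul_pow_diff 4 (by norm_num))).analyticOnNhd Metric.isOpen_ball
  have hne : ∀ᶠ q in 𝓝 (0 : ℂ), theta q ≠ 0 := by
    have : ContinuousAt theta 0 :=
      (theta_diff.differentiableAt (Metric.ball_mem_nhds 0 one_pos)).continuousAt
    exact this.eventually_ne (by rw [theta_zero]; norm_num)
  have hev : ∀ᶠ q in 𝓝[≠] (0 : ℂ), theta q * Eul (q ^ 2) = Eul q * Eul (q ^ 4) := by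
    filter_upwards [nhdsWithin_le_nhds hne, self_mem_nhdsWithin,
      nhdsWithin_le_nhds (Metric.ball_mem_nhds (0:ℂ) one_pos)] with q h1 h2 h3
    rw [mem_ball_zero_iff] at h3
    exact theta_eq_of_ne h3 h2 h1
  exact hL.eqOn_of_preconnected_of_frequently_eq hR (convex_ball 0 1).isPreconnected
    (Metric.mem_ball_self one_pos) hev.frequently (by rwa [mem_ball_zero_iff])

lemma theta_ne {q : ℂ} (hq : ‖q‖ < 1) : theta q ≠ 0 := by
  intro h
  have := theta_eq hq
  rw [h, zero_mul] at this
  exact mul_ne_zero (Eul_ne hq) (Eul_ne (norm_pow_lt hq (by norm_num))) this.symm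

lemma mem_annul_of_norm {q w : ℂ} (hq : ‖q‖ < 1) (hw : ‖w‖ = 1) : w ∈ annul q := by
  have hq2 : ‖q‖ ^ 2 < 1 := pow_lt_one₀ (norm_nonneg q) hq (by norm_num)
  refine ⟨norm_pos_iff.mp (by rw [hw]; norm_num), ?_, ?_⟩
  · rw [norm_inv, hw, inv_one, one_mul]; exact hq2
  · rw [hw, one_mul]; exact hq2

lemma Hq_eq {q w : ℂ} (hq : ‖q‖ < 1) (hq0 : q ≠ 0) (hw : ‖w‖ = 1) (hw1 : w ≠ 1) :
    Hq q w = (1 - w) * fq q w / theta q := by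
  have h := Phi_zero hq hq0 (theta_ne hq) w hw
  have hne : 1 - w ≠ 0 := sub_ne_zero.mpr (Ne.symm hw1)
  rw [eq_div_iff (theta_ne hq), fq_eq hq hq0 (mem_annul_of_norm hq hw), mul_add,
    mul_inv_cancel₀ hne]
  unfold Phi at h
  linear_combination h

end M2R

namespace M2R
open Filter Topology

/-- evaluation predicate for power series -/
def Ev (φ : PowerSeries ℂ) (q v : ℂ) : Prop :=
  (Summable fun n : ℕ => ‖φ.coeff n * q ^ n‖) ∧ ∑' n : ℕ, φ.coeff n * q ^ n = v

lemma Ev_mul {φ ψ : PowerSeries ℂ} {q v u : ℂ} (h1 : Ev φ q v) (h2 : Ev ψ q u) :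
    Ev (φ * ψ) q (v * u) := by
  have e : ∀ n : ℕ, (φ * ψ).coeff n * q ^ n = ∑ kl ∈ Finset.HasAntidiagonal.antidiagonal n,
      (φ.coeff kl.1 * q ^ kl.1) * (ψ.coeff kl.2 * q ^ kl.2) := by
    intro n
    rw [PowerSeries.coeff_mul, Finset.sum_mul]
    apply Finset.sum_congr rfl
    intro kl hkl
    rw [← Finset.HasAntidiagonal.mem_antidiagonal.mp hkl, pow_add]
    ring
  have s1 := summable_norm_sum_mul_antidiagonal_of_summable_norm (f := fun n => φ.coeff n * q ^ n)
    (g := fun n => ψ.coeff n * q ^ n) h1.1 h2.1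
  have s2 := tsum_mul_tsum_eq_tsum_sum_antidiagonal_of_summable_norm (f := fun n => φ.coeff n * q ^ n)
    (g := fun n => ψ.coeff n * q ^ n) h1.1 h2.1
  constructor
  · exact s1.congr (fun n => by rw [e])
  · rw [tsum_congr e, ← h1.2, ← h2.2]
    exact s2.symm

lemma Ev_one (q : ℂ) : Ev 1 q 1 := by
  have hz : ∀ n : ℕ, n ≠ 0 → (1 : PowerSeries ℂ).coeff n * q ^ n = 0 := by
    intro n hn; rw [PowerSeries.coeff_one, if_neg hn, zero_mul]
  constructor
  · apply summable_of_ne_finset_zero (s := {0})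
    intro n hn
    rw [hz n (by simpa using hn), norm_zero]
  · rw [tsum_eq_single 0 hz]; simp

lemma Ev_binom (q z : ℂ) {m : ℕ} (hm : m ≠ 0) :
    Ev (1 + PowerSeries.C z * PowerSeries.X ^ m) q (1 + z * q ^ m) := by
  have hc : ∀ n : ℕ, (1 + PowerSeries.C z * PowerSeries.X ^ m).coeff n =
      (if n = 0 then 1 else 0) + (if n = m then z else 0) := by
    intro n
    rw [map_add, PowerSeries.coeff_one, PowerSeries.coeff_C_mul, PowerSeries.coeff_X_pow]
    split_ifs <;> simp
  have hz : ∀ n : ℕ, n ∉ ({0, m} : Finset ℕ) → (1 + PowerSeries.C z * PowerSeries.X ^ m).coeff n * q ^ n = 0 := by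
    intro n hn
    simp only [Finset.mem_insert, Finset.mem_singleton, not_or] at hn
    rw [hc, if_neg hn.1, if_neg hn.2]; simp
  constructor
  · apply summable_of_ne_finset_zero (s := {0, m})
    intro n hn
    rw [hz n hn, norm_zero]
  · rw [tsum_eq_sum hz, Finset.sum_pair (Ne.symm hm), hc, hc]
    simp [hm, Ne.symm hm]

lemma Ev_inv {φ : PowerSeries ℂ} {q z : ℂ} (hq : ‖q‖ < 1) (hz : ‖z‖ ≤ 1) {m : ℕ} (hm : m ≠ 0)
    (h : φ * (1 + PowerSeries.C (-z) * PowerSeries.X ^ m) = 1) : Ev φ q (1 - z * q ^ m)⁻¹ := by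
  have hrec : φ = 1 + PowerSeries.C z * (φ * PowerSeries.X ^ m) := by
    rw [← h, map_neg]; ring
  have hb : ∀ n, ‖φ.coeff n‖ ≤ 1 := by
    intro n
    induction n using Nat.strong_induction_on with
    | _ n ih =>
      rw [hrec, map_add, PowerSeries.coeff_one, PowerSeries.coeff_C_mul, PowerSeries.coeff_mul_X_pow']
      by_cases hn : n = 0
      · subst hn
        simp [hm]
      · rw [if_neg hn, zero_add]
        split_ifs with h1
        · rw [norm_mul]
          have := ih (n - m) (by omega)
          exact mul_le_one₀ hz (norm_nonneg _) this
        · simp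
  have hs : Summable fun n : ℕ => ‖φ.coeff n * q ^ n‖ := by
    refine Summable.of_nonneg_of_le (fun _ => norm_nonneg _) (fun n => ?_)
      (summable_geometric_of_lt_one (norm_nonneg q) hq)
    rw [norm_mul, norm_pow]
    exact mul_le_of_le_one_left (by positivity) (hb n)
  refine ⟨hs, ?_⟩
  have h1 : Ev φ q (∑' n : ℕ, φ.coeff n * q ^ n) := ⟨hs, rfl⟩
  have h2 := Ev_mul h1 (Ev_binom q (-z) hm)
  rw [h] at h2
  have h3 := h2.2.symm.trans (Ev_one q).2
  apply eq_inv_of_mul_eq_one_left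
  linear_combination h3

/-- weights -/
noncomputable def wt (z : ℂ) (M i c : ℕ) : ℂ := if i ≤ 2 * M ∧ (Odd i → c ≤ 1) then z ^ c else 0

open PowerSeries PowerSeries.WithPiTopology in
lemma factor_big (z : ℂ) (M i : ℕ) (hi : 2 * M ≤ i) :
    (1 + ∑' j : ℕ, wt z M (i + 1) (j + 1) • (X : PowerSeries ℂ) ^ ((i + 1) * (j + 1))) = 1 := by
  have : ∀ j : ℕ, wt z M (i + 1) (j + 1) • (X : PowerSeries ℂ) ^ ((i + 1) * (j + 1)) = 0 := by
    intro j
    rw [wt, if_neg (by omega), zero_smul]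
  simp_rw [this]
  simp

open PowerSeries PowerSeries.WithPiTopology in
lemma factor_odd (z : ℂ) (M i : ℕ) (hi : i < 2 * M) (ho : Even i) :
    (1 + ∑' j : ℕ, wt z M (i + 1) (j + 1) • (X : PowerSeries ℂ) ^ ((i + 1) * (j + 1))) =
     1 + C z * X ^ (i + 1) := by
  rw [tsum_eq_single 0]
  · rw [wt, if_pos ⟨by omega, fun _ => by omega⟩, PowerSeries.smul_eq_C_mul]
    simp
  · intro j hj
    rw [wt, if_neg (by
      rintro ⟨_, h⟩
      have := h (Even.add_one ho)
      omega), zero_smul]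

open PowerSeries PowerSeries.WithPiTopology in
lemma factor_even (z : ℂ) (M i : ℕ) (hi : i < 2 * M) (ho : Odd i) :
    (1 + ∑' j : ℕ, wt z M (i + 1) (j + 1) • (X : PowerSeries ℂ) ^ ((i + 1) * (j + 1))) *
     (1 + C (-z) * X ^ (i + 1)) = 1 := by
  have hne : ¬ Odd (i + 1) := by
    rw [Nat.not_odd_iff_even]; exact Odd.add_one ho
  have hw : ∀ j, wt z M (i + 1) (j + 1) • (X : PowerSeries ℂ) ^ ((i + 1) * (j + 1)) =
      (C z * X ^ (i + 1)) ^ (j + 1) := by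
    intro j
    rw [wt, if_pos ⟨by omega, fun h => absurd h hne⟩, PowerSeries.smul_eq_C_mul, mul_pow, ← pow_mul,
      map_pow]
  have hs := Nat.Partition.summable_genFun_term (R := ℂ) (wt z M) i
  simp_rw [hw] at hs ⊢
  set Y : PowerSeries ℂ := C z * X ^ (i + 1) with hY
  have e1 : ∑' j : ℕ, Y ^ (j + 1) = Y + Y * ∑' j : ℕ, Y ^ (j + 1) := by
    conv_lhs => rw [hs.tsum_eq_zero_add]
    rw [← hs.tsum_mul_left]
    simp only [zero_add, pow_one]
    congr 1
    apply tsum_congr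
    intro j
    ring
  have e2 : (1 + C (-z) * X ^ (i + 1) : PowerSeries ℂ) = 1 - Y := by
    rw [hY, map_neg]; ring
  rw [e2]
  linear_combination e1

open PowerSeries PowerSeries.WithPiTopology in
/-- the factors of the generating function -/
noncomputable def fac (z : ℂ) (M i : ℕ) : PowerSeries ℂ :=
  1 + ∑' j : ℕ, wt z M (i + 1) (j + 1) • (X : PowerSeries ℂ) ^ ((i + 1) * (j + 1))

open PowerSeries PowerSeries.WithPiTopology in
lemma genFun_fac (z : ℂ) (M : ℕ) :
    Nat.Partition.genFun (wt z M) = ∏ i ∈ Finset.range (2 * M), fac z M i := by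
  have h1 := Nat.Partition.hasProd_genFun (R := ℂ) (wt z M)
  refine h1.unique (hasProd_prod_of_ne_finset_one ?_)
  intro i hi
  apply factor_big
  simpa using hi

lemma genFun_eval {q z : ℂ} (hq : ‖q‖ < 1) (hz : ‖z‖ ≤ 1) (M : ℕ) :
    Ev (Nat.Partition.genFun (wt z M)) q (Fq q z M) := by
  rw [genFun_fac]
  have key : ∀ L, L ≤ M → Ev (∏ i ∈ Finset.range (2 * L), fac z M i) q (Fq q z L) := by
    intro L
    induction L with
    | zero =>
      intro _
      rw [mul_zero, Finset.prod_range_zero, Fq_zero]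
      exact Ev_one q
    | succ L ih =>
      intro hL
      have h2 : 2 * (L + 1) = 2 * L + 1 + 1 := by ring
      have f1 : Ev (fac z M (2 * L)) q (1 + z * q ^ (2 * L + 1)) := by
        have : fac z M (2 * L) = _ := factor_odd z M _ (by omega) ⟨L, by ring⟩
        rw [this]
        exact Ev_binom q z (by omega)
      have f2 : Ev (fac z M (2 * L + 1)) q (1 - z * q ^ (2 * L + 1 + 1))⁻¹ :=
        Ev_inv hq hz (by omega) (factor_even z M _ (by omega) ⟨L, by ring⟩)
      have := Ev_mul (Ev_mul (ih (by omega)) f1) f2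
      rw [h2, Finset.prod_range_succ, Finset.prod_range_succ, Fq_succ]
      convert this using 1
      try field_simp
      try ring
  exact key M le_rfl

/-- half of the largest part rounded up -/
def hl {n : ℕ} (P : n.Partition) : ℕ := (P.parts.sup + 1) / 2

lemma wt_prod (z : ℂ) (M : ℕ) {n : ℕ} (P : n.Partition) :
    P.parts.toFinsupp.prod (wt z M) =
      if NoRepeatedOddParts P ∧ hl P ≤ M then z ^ (Multiset.card P.parts) else 0 := by
  simp only [Finsupp.prod, Multiset.toFinsupp_support, Multiset.toFinsupp_apply]
  have hsup : hl P ≤ M ↔ ∀ i ∈ P.parts, i ≤ 2 * M := by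
    rw [← Multiset.sup_le, hl]; omega
  split_ifs with h
  · rw [hsup] at h
    rw [← Multiset.toFinset_sum_count_eq, ← Finset.prod_pow_eq_pow_sum]
    apply Finset.prod_congr rfl
    intro i hi
    rw [Multiset.mem_toFinset] at hi
    rw [wt, if_pos ⟨h.2 i hi, fun ho => h.1 i ho⟩]
  · rw [hsup] at h
    rw [not_and_or] at h
    rcases h with h | h
    · unfold NoRepeatedOddParts at h
      push Not at h
      obtain ⟨j, hj, hc⟩ := h
      apply Finset.prod_eq_zero (i := j)
      · rw [Multiset.mem_toFinset, ← Multiset.count_pos]; omega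
      · rw [wt, if_neg]
        rintro ⟨_, h2⟩
        have := h2 hj
        omega
    · push Not at h
      obtain ⟨j, hj, hc⟩ := h
      apply Finset.prod_eq_zero (i := j)
      · rwa [Multiset.mem_toFinset]
      · rw [wt, if_neg]
        rintro ⟨h2, _⟩
        omega

/-- count by half largest part -/
noncomputable def bM (z : ℂ) (M n : ℕ) : ℂ :=
  ∑ P : n.Partition, if NoRepeatedOddParts P ∧ hl P = M then z ^ (Multiset.card P.parts) else 0

lemma coeff_sub (z : ℂ) (M n : ℕ) :
    (Nat.Partition.genFun (wt z (M + 1))).coeff n - (Nat.Partition.genFun (wt z M)).coeff n =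
      bM z (M + 1) n := by
  rw [Nat.Partition.coeff_genFun, Nat.Partition.coeff_genFun, ← Finset.sum_sub_distrib, bM]
  apply Finset.sum_congr rfl
  intro P _
  rw [wt_prod, wt_prod]
  by_cases h : NoRepeatedOddParts P
  · simp only [h, true_and]
    rcases lt_trichotomy (hl P) (M + 1) with h1 | h1 | h1
    · rw [if_pos (by omega), if_pos (by omega), if_neg (by omega), sub_self]
    · rw [if_pos (by omega), if_neg (by omega), if_pos (by omega), sub_zero]
    · rw [if_neg (by omega), if_neg (by omega), if_neg (by omega), sub_self]
  · simp [h]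

lemma bM_norm_le {z : ℂ} (hz : ‖z‖ ≤ 1) (M n : ℕ) : ‖bM z M n‖ ≤ ‖bM 1 M n‖ := by
  have e : bM 1 M n = ((∑ P : n.Partition, if NoRepeatedOddParts P ∧ hl P = M then (1 : ℝ) else 0 : ℝ) : ℂ) := by
    rw [bM]
    push_cast
    apply Finset.sum_congr rfl
    intro P _
    split_ifs <;> simp
  rw [e, Complex.norm_of_nonneg (Finset.sum_nonneg (fun P _ => by split_ifs <;> norm_num))]
  refine (norm_sum_le _ _).trans (Finset.sum_le_sum (fun P _ => ?_))
  split_ifs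
  · rw [norm_pow]; exact pow_le_one₀ (norm_nonneg _) hz
  · simp

lemma bM_eval {q z : ℂ} (hq : ‖q‖ < 1) (hz : ‖z‖ ≤ 1) (M : ℕ) :
    (Summable fun n : ℕ => ‖bM z (M + 1) n * q ^ n‖) ∧
    ∑' n : ℕ, bM z (M + 1) n * q ^ n = Fq q z (M + 1) - Fq q z M := by
  have h1 := genFun_eval hq hz (M + 1)
  have h2 := genFun_eval hq hz M
  have e : ∀ n : ℕ, bM z (M + 1) n * q ^ n = (Nat.Partition.genFun (wt z (M + 1))).coeff n * q ^ n -
    (Nat.Partition.genFun (wt z M)).coeff n * q ^ n := fun n => by rw [← coeff_sub]; ring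
  constructor
  · simp_rw [e]
    exact (h1.1.add h2.1).of_nonneg_of_le (fun _ => norm_nonneg _) (fun _ => norm_sub_le _ _)
  · rw [tsum_congr e, h1.1.of_norm.tsum_sub h2.1.of_norm, h1.2, h2.2]

lemma bM_summable {q z w : ℂ} (hq : ‖q‖ < 1) (hz : ‖z‖ ≤ 1) (hw : ‖w‖ = 1) :
    Summable fun p : ℕ × ℕ => w ^ (p.1 + 1) * (bM z (p.1 + 1) p.2 * q ^ p.2) := by
  set r : ℂ := ((‖q‖ : ℝ) : ℂ) with hr
  have hrn : ‖r‖ = ‖q‖ := by rw [hr]; simp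
  have hr1 : ‖r‖ < 1 := by rw [hrn]; exact hq
  have hq2 : ‖q‖ ^ 2 < 1 := pow_lt_one₀ (norm_nonneg q) hq (by norm_num)
  have hs := Hterm_summable (q := r) (w := 1) hr1 (by rw [hrn]; simpa using hq2)
    (by rw [hrn]; simpa using hq2)
  have hn : ∀ M n : ℕ, bM 1 (M + 1) n * r ^ n = ((‖bM 1 (M + 1) n * r ^ n‖ : ℝ) : ℂ) := by
    intro M n
    have e : bM 1 (M + 1) n = ((∑ P : n.Partition, if NoRepeatedOddParts P ∧ hl P = M + 1 then (1 : ℝ) else 0 : ℝ) : ℂ) := by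
      rw [bM]
      push_cast
      apply Finset.sum_congr rfl
      intro P _
      split_ifs <;> simp
    have h0 : 0 ≤ ∑ P : n.Partition, if NoRepeatedOddParts P ∧ hl P = M + 1 then (1 : ℝ) else 0 :=
      Finset.sum_nonneg (fun P _ => by split_ifs <;> norm_num)
    rw [e, hr, ← Complex.ofReal_pow, ← Complex.ofReal_mul, Complex.norm_of_nonneg (by positivity)]
  have hF : ∀ M : ℕ, Fq r 1 (M + 1) - Fq r 1 M = ((∑' n : ℕ, ‖bM 1 (M + 1) n * r ^ n‖ : ℝ) : ℂ) := by
    intro M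
    rw [← (bM_eval hr1 (z := 1) (by simp) M).2, Complex.ofReal_tsum]
    exact tsum_congr (hn M)
  have key : Summable fun p : ℕ × ℕ => ‖bM 1 (p.1 + 1) p.2 * r ^ p.2‖ := by
    rw [summable_prod_of_nonneg (fun _ => norm_nonneg _)]
    refine ⟨fun M => (bM_eval hr1 (z := 1) (by simp) M).1, ?_⟩
    have : Summable fun M : ℕ => ((∑' n : ℕ, ‖bM 1 (M + 1) n * r ^ n‖ : ℝ) : ℂ) := by
      refine hs.congr (fun M => ?_)
      rw [← hF M]; simp
    exact_mod_cast this
  refine Summable.of_norm_bounded key (fun p => ?_)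
  rw [norm_mul, norm_pow, hw, one_pow, one_mul, norm_mul, norm_mul, norm_pow, norm_pow, hrn]
  exact mul_le_mul_of_nonneg_right (bM_norm_le hz _ _) (by positivity)

/-- the complex weight sum -/
lemma sum_bM (w : ℂ) (hw : ‖w‖ = 1) (n : ℕ) :
    HasSum (fun M : ℕ => w ^ (M + 1) * bM w⁻¹ (M + 1) n)
      ((∑ P : n.Partition, if NoRepeatedOddParts P then w ^ (m2Rank P) else 0) - if n = 0 then 1 else 0) := by
  have hw0 : w ≠ 0 := norm_pos_iff.mp (by rw [hw]; norm_num)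
  have h0 : ∀ P : n.Partition, hl P = 0 ↔ n = 0 := by
    intro P
    rw [hl]
    constructor
    · intro h
      have h1 : P.parts.sup ≤ 0 := by omega
      rw [Multiset.sup_le] at h1
      by_contra hn
      have : P.parts ≠ 0 := by
        intro he
        have := P.parts_sum
        rw [he] at this
        simp at this
        omega
      obtain ⟨a, ha⟩ := Multiset.exists_mem_of_ne_zero this
      have := P.parts_pos ha
      have := h1 a ha
      omega
    · intro h
      subst h
      have : P.parts.sup ≤ 0 := by
        rw [Multiset.sup_le]
        intro b hb
        have := Multiset.le_sum_of_mem hb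
        rw [P.parts_sum] at this
        exact this
      omega
  have h1 : ∀ P : n.Partition, HasSum (fun M : ℕ => if NoRepeatedOddParts P ∧ hl P = M + 1 then
      w ^ (M + 1) * w⁻¹ ^ (Multiset.card P.parts) else 0)
      (if NoRepeatedOddParts P ∧ hl P ≠ 0 then w ^ (m2Rank P) else 0) := by
    intro P
    by_cases hP : NoRepeatedOddParts P ∧ hl P ≠ 0
    · rw [if_pos hP]
      have hc := hasSum_ite_eq (hl P - 1) (w ^ (m2Rank P))
      refine hc.congr_fun ?_ |> id
      intro M
      by_cases hM : M = hl P - 1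
      · rw [if_pos hM, if_pos ⟨hP.1, by omega⟩]
        have : M + 1 = hl P := by omega
        rw [this, m2Rank, zpow_sub₀ hw0, zpow_natCast, zpow_natCast, inv_pow]
        rfl
      · rw [if_neg hM, if_neg (by omega)]
    · rw [if_neg hP]
      have : ∀ M : ℕ, (if NoRepeatedOddParts P ∧ hl P = M + 1 then
        w ^ (M + 1) * w⁻¹ ^ (Multiset.card P.parts) else 0) = 0 := by
        intro M
        rw [if_neg]
        rintro ⟨a, b⟩
        exact hP ⟨a, by omega⟩
      simp_rw [this]
      exact hasSum_zero
  have h2 := hasSum_sum (s := Finset.univ) (fun P _ => h1 P)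
  convert h2 using 1
  · ext M
    rw [bM, Finset.mul_sum]
    apply Finset.sum_congr rfl
    intro P _
    split_ifs <;> simp
  · by_cases hn : n = 0
    · subst hn
      have : ∀ P : (0:ℕ).Partition, hl P = 0 := fun P => (h0 P).mpr rfl
      simp only [this, ne_eq, not_true_eq_false, and_false, if_false, Finset.sum_const_zero, if_true]
      rw [Fintype.sum_unique]
      have hp : (default : (0:ℕ).Partition).parts = 0 := by
        have := (default : (0:ℕ).Partition).parts_sum
        by_contra hne
        obtain ⟨a, ha⟩ := Multiset.exists_mem_of_ne_zero hne
        have h3 := Multiset.le_sum_of_mem ha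
        rw [this] at h3
        have := (default : (0:ℕ).Partition).parts_pos ha
        omega
      rw [if_pos (by intro j _; rw [hp]; simp), m2Rank, hp]
      simp
    · rw [if_neg hn, sub_zero]
      apply Finset.sum_congr rfl
      intro P _
      have : hl P ≠ 0 := fun h => hn ((h0 P).mp h)
      simp [this]

end M2R

namespace M2R
open Filter Topology

/-- the fifth root of unity -/
noncomputable def zt : ℂ := Complex.exp (2 * Real.pi * Complex.I / 5)

lemma zt_pow : zt ^ 5 = 1 := by
  rw [zt, ← Complex.exp_nat_mul]
  rw [show ((5 : ℕ) : ℂ) * (2 * Real.pi * Complex.I / 5) = 2 * Real.pi * Complex.I by push_cast; ring]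
  exact Complex.exp_two_pi_mul_I

lemma zt_norm : ‖zt‖ = 1 := by
  rw [zt, show (2 * Real.pi * Complex.I / 5 : ℂ) = ((2 * Real.pi / 5 : ℝ) : ℂ) * Complex.I by push_cast; ring]
  exact Complex.norm_exp_ofReal_mul_I _

lemma zt_ne_zero : zt ≠ 0 := Complex.exp_ne_zero _

lemma zt_ne_one : zt ≠ 1 := by
  intro h
  rw [zt, Complex.exp_eq_one_iff] at h
  obtain ⟨n, hn⟩ := h
  have h1 : ((n : ℂ) * 5 - 1) * (2 * Real.pi * Complex.I) = 0 := by linear_combination (-5) * hn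
  rcases mul_eq_zero.mp h1 with h2 | h2
  · have : n * 5 - 1 = 0 := by exact_mod_cast h2
    omega
  · exact Complex.two_pi_I_ne_zero h2

lemma zt_pow_eq (r : ℕ) : Complex.exp (2 * Real.pi * Complex.I * ((1 : ℤ) : ℂ) * (r : ℂ) / ((5 : ℕ) : ℂ)) = zt ^ r := by
  rw [zt, ← Complex.exp_nat_mul]
  congr 1
  push_cast
  ring

lemma zt_zpow_emod (m : ℤ) (r : ℕ) (h : m ≡ r [ZMOD 5]) : zt ^ m = zt ^ r := by
  obtain ⟨k, hk⟩ := h.symm.dvd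
  have : m = r + 5 * k := by omega
  rw [this, zpow_add₀ zt_ne_zero, zpow_mul, zpow_natCast]
  have : zt ^ (5 : ℤ) = 1 := by exact_mod_cast zt_pow
  rw [this, one_zpow, mul_one]

lemma Acoef_eq (n : ℕ) : Acoef 1 5 n =
    ∑ P : n.Partition, if NoRepeatedOddParts P then zt ^ (m2Rank P) else 0 := by
  unfold Acoef
  have h1 : ∀ r ∈ Finset.range 5, (N2 (r : ℤ) 5 n : ℂ) *
      Complex.exp (2 * Real.pi * Complex.I * ((1 : ℤ) : ℂ) * (r : ℂ) / ((5 : ℕ) : ℂ)) =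
      ∑ P : n.Partition, if NoRepeatedOddParts P ∧ m2Rank P ≡ r [ZMOD 5] then zt ^ r else 0 := by
    intro r _
    rw [zt_pow_eq, N2, Nat.card_eq_fintype_card, Fintype.card_subtype, ← Finset.sum_filter,
      Finset.sum_const, nsmul_eq_mul]
    norm_num
  rw [Finset.sum_congr rfl h1, Finset.sum_comm]
  apply Finset.sum_congr rfl
  intro P _
  by_cases hP : NoRepeatedOddParts P
  · simp only [hP, true_and, if_true]
    have hr0 := Int.emod_nonneg (m2Rank P) (b := 5) (by norm_num)
    have hr1 := Int.emod_lt_of_pos (m2Rank P) (b := 5) (by norm_num)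
    obtain ⟨r, hr⟩ := Int.eq_ofNat_of_zero_le hr0
    have hrc : m2Rank P ≡ r [ZMOD 5] := by
      unfold Int.ModEq; omega
    rw [Finset.sum_eq_single r]
    · rw [if_pos hrc, zt_zpow_emod _ _ hrc]
    · intro s hs hsr
      rw [if_neg]
      intro h
      unfold Int.ModEq at h
      rw [Finset.mem_range] at hs
      omega
    · intro h
      rw [Finset.mem_range] at h
      omega
  · simp [hP]

lemma Acoef_hasSum {q : ℂ} (hq : ‖q‖ < 1) :
    HasSum (fun n : ℕ => Acoef 1 5 n * q ^ n) (Hq q zt) := by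
  have hz : ‖zt⁻¹‖ ≤ 1 := by rw [norm_inv, zt_norm]; norm_num
  have hs := bM_summable (w := zt) hq hz zt_norm
  have hs' : Summable fun p : ℕ × ℕ => zt ^ (p.2 + 1) * (bM zt⁻¹ (p.2 + 1) p.1 * q ^ p.1) :=
    (hs.comp_injective (i := Prod.swap) Prod.swap_injective)
  have e1 : ∑' p : ℕ × ℕ, zt ^ (p.2 + 1) * (bM zt⁻¹ (p.2 + 1) p.1 * q ^ p.1) = Hq q zt - 1 := by
    have : ∑' p : ℕ × ℕ, zt ^ (p.2 + 1) * (bM zt⁻¹ (p.2 + 1) p.1 * q ^ p.1) =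
       ∑' p : ℕ × ℕ, zt ^ (p.1 + 1) * (bM zt⁻¹ (p.1 + 1) p.2 * q ^ p.2) :=
      (Equiv.prodComm ℕ ℕ).tsum_eq (fun p : ℕ × ℕ => zt ^ (p.1 + 1) * (bM zt⁻¹ (p.1 + 1) p.2 * q ^ p.2))
    rw [this, hs.tsum_prod]
    unfold Hq
    rw [add_sub_cancel_left]
    apply tsum_congr
    intro M
    simp only
    rw [tsum_mul_left, (bM_eval hq hz M).2]
  have h2 := hs'.hasSum
  rw [e1] at h2
  have h3 := h2.prod_fiberwise (g := fun n => (Acoef 1 5 n - if n = 0 then 1 else 0) * q ^ n) (by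
    intro n
    have := (sum_bM zt zt_norm n).mul_right (q ^ n)
    rw [← Acoef_eq] at this
    exact this.congr_fun (fun M => by simp only [mul_assoc]))
  have h4 : HasSum (fun n : ℕ => if n = 0 then (1 : ℂ) else 0) 1 := hasSum_ite_eq 0 1
  have h5 := h3.add h4
  rw [sub_add_cancel] at h5
  convert h5 using 1
  ext n
  by_cases hn : n = 0
  · subst hn; simp
  · simp [hn]

/-- the generating function -/
lemma Acoef_gen {q : ℂ} (hq : ‖q‖ < 1) (hq0 : q ≠ 0) :
    HasSum (fun n : ℕ => Acoef 1 5 n * q ^ n) ((1 - zt) * fq q zt / theta q) := by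
  rw [← Hq_eq hq hq0 zt_norm zt_ne_one]
  exact Acoef_hasSum hq

end M2R

namespace M2R
open Filter Topology Set
open Complex (I)

/-- boundary integral of a rectangle -/
noncomputable def bdry (f : ℂ → ℂ) (x0 x1 y0 y1 : ℝ) : ℂ :=
  (∫ x in x0..x1, f (x + y0 * I)) - (∫ x in x0..x1, f (x + y1 * I)) +
    I * (∫ y in y0..y1, f (x1 + y * I)) - I * (∫ y in y0..y1, f (x0 + y * I))

lemma log_rot {z : ℂ} (h1 : 0 < z.re) (h2 : 0 < z.im) :
    Complex.log z - Complex.log (-I * z) = I * (Real.pi / 2) := by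
  have hz : z ≠ 0 := by intro h; rw [h] at h1; simp at h1
  have e : Complex.log (-I * z) = Complex.log (-I) + Complex.log z := by
    apply Complex.log_mul (by simp) hz
    rw [Complex.arg_neg_I]
    have := Complex.arg_le_pi_div_two_iff (z := z) |>.mpr (Or.inl h1.le)
    have h4 := Complex.arg_nonneg_iff.mpr h2.le
    have h5 : Complex.arg z ≠ 0 := by
      intro h
      rw [Complex.arg_eq_zero_iff] at h
      linarith [h.2]
    have h6 : 0 < Complex.arg z := lt_of_le_of_ne h4 (Ne.symm h5)
    constructor <;> linarith [Real.pi_pos]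
  rw [e, Complex.log_neg_I]
  ring

lemma side_int {a b : ℝ} {c d p : ℂ} (hpos : ∀ x ∈ uIcc a b, 0 < (c * (d * x + p)).re) (hc : c ≠ 0) :
    d * ∫ x in a..b, (d * x + p)⁻¹ = Complex.log (c * (d * b + p)) - Complex.log (c * (d * a + p)) := by
  have hne : ∀ x ∈ uIcc a b, d * (x : ℂ) + p ≠ 0 := by
    intro x hx h
    have := hpos x hx
    rw [h] at this
    simp at this
  rw [← intervalIntegral.integral_const_mul]
  apply intervalIntegral.integral_eq_sub_of_hasDerivAt (f := fun x : ℝ => Complex.log (c * (d * x + p)))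
  · intro x hx
    have h1 : HasDerivAt (fun x : ℝ => c * (d * (x : ℂ) + p)) (c * d) x := by
      have := ((Complex.ofRealCLM.hasDerivAt (x := x)).const_mul d).add_const p |>.const_mul c
      simpa using this
    have h2 := h1.clog_real (Or.inl (hpos x hx))
    rw [mul_div_mul_left _ _ hc, div_eq_mul_inv] at h2
    exact h2
  · apply ContinuousOn.intervalIntegrable
    apply ContinuousOn.mul continuousOn_const
    apply ContinuousOn.inv₀ (by fun_prop) hne

lemma bdry_inv {x0 x1 y0 y1 : ℝ} {p : ℂ} (h1 : x0 < p.re) (h2 : p.re < x1) (h3 : y0 < p.im) (h4 : p.im < y1) :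
    bdry (fun z => (z - p)⁻¹) x0 x1 y0 y1 = 2 * Real.pi * I := by
  have hI : (I : ℂ) ≠ 0 := Complex.I_ne_zero
  have b1 := side_int (a := x0) (b := x1) (c := I) (d := 1) (p := y0 * I - p) (by
    intro x hx
    simp
    linarith) hI
  have b2 := side_int (a := x0) (b := x1) (c := -I) (d := 1) (p := y1 * I - p) (by
    intro x hx
    simp
    linarith) (by simp)
  have b3 := side_int (a := y0) (b := y1) (c := 1) (d := I) (p := x1 - p) (by
    intro x hx
    simp
    linarith) (by simp)
  have b4 := side_int (a := y0) (b := y1) (c := -1) (d := I) (p := x0 - p) (by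
    intro x hx
    simp
    linarith) (by simp)
  have c1 := log_rot (z := x1 + y1 * I - p) (by simp; linarith) (by simp; linarith)
  have c2 := log_rot (z := -I * (x0 + y1 * I - p)) (by simp; linarith) (by simp; linarith)
  have c3 := log_rot (z := - (x0 + y0 * I - p)) (by simp; linarith) (by simp; linarith)
  have c4 := log_rot (z := I * (x1 + y0 * I - p)) (by simp; linarith) (by simp; linarith)
  unfold bdry
  have e1 : ∀ x : ℝ, ((x : ℂ) + y0 * I - p)⁻¹ = (1 * (x : ℂ) + (y0 * I - p))⁻¹ := fun x => by congr 1; ring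
  have e2 : ∀ x : ℝ, ((x : ℂ) + y1 * I - p)⁻¹ = (1 * (x : ℂ) + (y1 * I - p))⁻¹ := fun x => by congr 1; ring
  have e3 : ∀ y : ℝ, ((x1 : ℂ) + y * I - p)⁻¹ = (I * (y : ℂ) + (x1 - p))⁻¹ := fun x => by congr 1; ring
  have e4 : ∀ y : ℝ, ((x0 : ℂ) + y * I - p)⁻¹ = (I * (y : ℂ) + (x0 - p))⁻¹ := fun x => by congr 1; ring
  simp only [e1, e2, e3, e4]
  rw [one_mul] at b1 b2
  rw [b1, b2, b3, b4]
  have I2 : I * I = -1 := Complex.I_mul_I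
  have k1 : -I * (-I * (x0 + y1 * I - p)) = -1 * (I * (y1 : ℂ) + (x0 - p)) := by linear_combination (x0 + y1 * I - p) * I2
  have k2 : -I * -(x0 + y0 * I - p) = I * (1 * (x0 : ℂ) + (y0 * I - p)) := by ring
  have k3 : -I * (I * (x1 + y0 * I - p)) = 1 * (I * (y0 : ℂ) + (x1 - p)) := by linear_combination -(x1 + y0 * I - p) * I2
  have k4 : (x1 + y1 * I - p) = 1 * (I * (y1 : ℂ) + (x1 - p)) := by ring
  have k5 : -I * (x1 + y1 * I - p) = -I * (1 * (x1 : ℂ) + (y1 * I - p)) := by ring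
  have k6 : -I * (x0 + y1 * I - p) = -I * (1 * (x0 : ℂ) + (y1 * I - p)) := by ring
  have k7 : -(x0 + y0 * I - p) = -1 * (I * (y0 : ℂ) + (x0 - p)) := by ring
  have k8 : I * (x1 + y0 * I - p) = I * (1 * (x1 : ℂ) + (y0 * I - p)) := by ring
  rw [k5, k4] at c1
  rw [k1, k6] at c2
  rw [k2, k7] at c3
  rw [k3, k8] at c4
  linear_combination c1 + c2 + c3 + c4

lemma bdry_congr_add {f g : ℂ → ℂ} {R p : ℂ} {x0 x1 y0 y1 : ℝ} (hx : x0 ≤ x1) (hy : y0 ≤ y1)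
    (h1 : x0 < p.re) (h2 : p.re < x1) (h3 : y0 < p.im) (h4 : p.im < y1)
    (hg : ∀ z : ℂ, x0 ≤ z.re → z.re ≤ x1 → y0 ≤ z.im → z.im ≤ y1 →
      (z.re = x0 ∨ z.re = x1 ∨ z.im = y0 ∨ z.im = y1) → ContinuousAt g z)
    (hfg : ∀ z, z ≠ p → f z = g z + R * (z - p)⁻¹) :
    bdry f x0 x1 y0 y1 = bdry g x0 x1 y0 y1 + R * (2 * Real.pi * I) := by
  rw [← bdry_inv h1 h2 h3 h4]
  have hside : ∀ (a b : ℝ) (φ : ℝ → ℂ), Continuous φ → a ≤ b →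
      (∀ x ∈ Icc a b, φ x ≠ p ∧ ContinuousAt g (φ x)) →
      ∫ x in a..b, f (φ x) = (∫ x in a..b, g (φ x)) + R * ∫ x in a..b, (φ x - p)⁻¹ := by
    intro a b φ hφ hab h
    rw [← intervalIntegral.integral_const_mul, ← intervalIntegral.integral_add]
    · apply intervalIntegral.integral_congr
      intro x hx
      rw [uIcc_of_le hab] at hx
      exact hfg _ (h x hx).1
    · apply ContinuousOn.intervalIntegrable
      rw [uIcc_of_le hab]
      intro x hx
      exact ((h x hx).2.comp hφ.continuousAt).continuousWithinAt
    · apply ContinuousOn.intervalIntegrable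
      rw [uIcc_of_le hab]
      apply ContinuousOn.mul continuousOn_const
      apply ContinuousOn.inv₀ (by fun_prop)
      intro x hx
      exact sub_ne_zero.mpr (h x hx).1
  have s1 := hside x0 x1 (fun x => x + y0 * I) (by fun_prop) hx (by
    intro x hx
    refine ⟨fun h => ?_, hg _ (by simpa using hx.1) (by simpa using hx.2) (by simp) (by simpa using hy) (by simp)⟩
    have := congrArg Complex.im h
    simp at this
    linarith)
  have s2 := hside x0 x1 (fun x => x + y1 * I) (by fun_prop) hx (by
    intro x hx
    refine ⟨fun h => ?_, hg _ (by simpa using hx.1) (by simpa using hx.2) (by simpa using hy) (by simp) (by simp)⟩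
    have := congrArg Complex.im h
    simp at this
    linarith)
  have s3 := hside y0 y1 (fun y => x1 + y * I) (by fun_prop) hy (by
    intro y hy'
    refine ⟨fun h => ?_, hg _ (by simpa using hx) (by simp) (by simpa using hy'.1) (by simpa using hy'.2) (by simp)⟩
    have := congrArg Complex.re h
    simp at this
    linarith)
  have s4 := hside y0 y1 (fun y => x0 + y * I) (by fun_prop) hy (by
    intro y hy'
    refine ⟨fun h => ?_, hg _ (by simp) (by simpa using hx) (by simpa using hy'.1) (by simpa using hy'.2) (by simp)⟩
    have := congrArg Complex.re h
    simp at this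
    linarith)
  unfold bdry
  rw [s1, s2, s3, s4]
  ring

theorem rect_residue {x0 x1 y0 y1 : ℝ} (hx : x0 ≤ x1) (hy : y0 ≤ y1) (R : ℂ → ℂ) (S : Finset ℂ) :
    ∀ f : ℂ → ℂ, (∀ p ∈ S, x0 < p.re ∧ p.re < x1 ∧ y0 < p.im ∧ p.im < y1) →
    (∀ z : ℂ, x0 ≤ z.re → z.re ≤ x1 → y0 ≤ z.im → z.im ≤ y1 → z ∉ S → DifferentiableAt ℂ f z) →
    (∀ p ∈ S, Tendsto (fun z => (z - p) * f z) (𝓝[≠] p) (𝓝 (R p))) →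
    bdry f x0 x1 y0 y1 = 2 * Real.pi * I * ∑ p ∈ S, R p := by
  induction S using Finset.induction_on with
  | empty =>
    intro f _ hd _
    have := Complex.integral_boundary_rect_eq_zero_of_differentiableOn f (x0 + y0 * I) (x1 + y1 * I) (by
      intro z hz
      rw [Complex.mem_reProdIm] at hz
      simp only [Complex.add_re, Complex.ofReal_re, Complex.mul_re, Complex.I_re, mul_zero, Complex.ofReal_im,
        Complex.I_im, mul_one, sub_self, add_zero, Complex.add_im, Complex.mul_im, zero_add] at hz
      rw [uIcc_of_le hx, uIcc_of_le hy] at hz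
      exact (hd z hz.1.1 hz.1.2 hz.2.1 hz.2.2 (by simp)).differentiableWithinAt)
    simp only [Complex.add_re, Complex.ofReal_re, Complex.mul_re, Complex.I_re, mul_zero, Complex.ofReal_im,
        Complex.I_im, mul_one, sub_self, add_zero, Complex.add_im, Complex.mul_im, zero_add, smul_eq_mul] at this
    simpa [bdry] using this
  | insert p S hpS ih =>
    intro f hS hd hr
    obtain ⟨hp1, hp2, hp3, hp4⟩ := hS p (Finset.mem_insert_self p S)
    set g0 : ℂ → ℂ := fun z => f z - R p * (z - p)⁻¹ with hg0
    set g : ℂ → ℂ := Function.update g0 p (limUnder (𝓝[≠] p) g0) with hg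
    have hgne : ∀ z, z ≠ p → g z = g0 z := fun z hz => Function.update_of_ne hz _ _
    set s : Set ℂ := (Ioo x0 x1 ×ℂ Ioo y0 y1) ∩ (S : Set ℂ)ᶜ with hs
    have hsn : s ∈ 𝓝 p := by
      apply IsOpen.mem_nhds
      · exact (isOpen_Ioo.reProdIm isOpen_Ioo).inter S.finite_toSet.isClosed.isOpen_compl
      · refine ⟨?_, by simpa using hpS⟩
        rw [Complex.mem_reProdIm]
        exact ⟨⟨hp1, hp2⟩, ⟨hp3, hp4⟩⟩
    have hg0d : ∀ z : ℂ, x0 ≤ z.re → z.re ≤ x1 → y0 ≤ z.im → z.im ≤ y1 → z ∉ S → z ≠ p →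
        DifferentiableAt ℂ g0 z := by
      intro z a b c d e e'
      have h1 := hd z a b c d (by simp [e, e'])
      have h2 : z - p ≠ 0 := sub_ne_zero.mpr e'
      have h3 : DifferentiableAt ℂ (fun z => (z - p)⁻¹) z := by
        exact DifferentiableAt.fun_inv (h := fun z : ℂ => z - p) (by fun_prop) h2
      exact h1.sub (h3.const_mul (R p))
    have hgp : DifferentiableAt ℂ g p := by
      apply DifferentiableOn.differentiableAt (s := s) _ hsn
      apply Complex.differentiableOn_update_limUnder_of_isLittleO hsn
      · intro z hz
        obtain ⟨⟨hz1, hz2⟩, hz3⟩ := hz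
        rw [Complex.mem_reProdIm] at hz1
        exact (hg0d z hz1.1.1.le hz1.1.2.le hz1.2.1.le hz1.2.2.le (by simpa using hz2) (by simpa using hz3)).differentiableWithinAt
      · rw [Asymptotics.isLittleO_iff_tendsto']
        · have h1 := hr p (Finset.mem_insert_self p S)
          have h2 : Tendsto (fun z : ℂ => (z - p) * g0 p) (𝓝[≠] p) (𝓝 0) := by
            have : Tendsto (fun z : ℂ => (z - p) * g0 p) (𝓝 p) (𝓝 ((p - p) * g0 p)) :=
              Continuous.tendsto (by fun_prop) p
            rw [sub_self, zero_mul] at this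
            exact this.mono_left nhdsWithin_le_nhds
          have h3 := (h1.sub_const (R p)).sub h2
          rw [sub_self, sub_zero] at h3
          refine h3.congr' ?_
          filter_upwards [self_mem_nhdsWithin] with z hz
          have hz' : z - p ≠ 0 := sub_ne_zero.mpr (by simpa using hz)
          simp only [hg0]
          field_simp
        · filter_upwards [self_mem_nhdsWithin] with z hz h
          have hz' : z - p ≠ 0 := sub_ne_zero.mpr (by simpa using hz)
          exact absurd (inv_eq_zero.mp h) hz'
    have hgd : ∀ z : ℂ, x0 ≤ z.re → z.re ≤ x1 → y0 ≤ z.im → z.im ≤ y1 → z ∉ S → DifferentiableAt ℂ g z := by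
      intro z a b c d e
      by_cases hzp : z = p
      · rw [hzp]; exact hgp
      · refine (hg0d z a b c d e hzp).congr_of_eventuallyEq ?_
        filter_upwards [isOpen_ne.mem_nhds hzp] with y hy
        exact hgne y hy
    have key := ih g (fun q hq => hS q (Finset.mem_insert_of_mem hq)) hgd (by
      intro q hq
      have hqp : q ≠ p := fun h => hpS (h ▸ hq)
      have h1 := hr q (Finset.mem_insert_of_mem hq)
      have h2 : Tendsto (fun z : ℂ => (z - q) * (R p * (z - p)⁻¹)) (𝓝[≠] q) (𝓝 0) := by
        have : ContinuousAt (fun z : ℂ => (z - q) * (R p * (z - p)⁻¹)) q := by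
          have h2 : q - p ≠ 0 := sub_ne_zero.mpr hqp
          have h3 : ContinuousAt (fun z : ℂ => (z - p)⁻¹) q := ContinuousAt.inv₀ (by fun_prop) h2
          fun_prop
        have h3 := this.tendsto
        rw [sub_self, zero_mul] at h3
        exact h3.mono_left nhdsWithin_le_nhds
      have h3 := h1.sub h2
      rw [sub_zero] at h3
      refine h3.congr' ?_
      have : ∀ᶠ z in 𝓝[≠] q, z ≠ p := (isOpen_ne.mem_nhds hqp : {z | z ≠ p} ∈ 𝓝 q) |> fun h => mem_nhdsWithin_of_mem_nhds h
      filter_upwards [this] with z hz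
      rw [hgne z hz]
      simp only [hg0]
      ring)
    rw [bdry_congr_add (g := g) (R := R p) hx hy hp1 hp2 hp3 hp4, key, Finset.sum_insert hpS]
    · ring
    · intro z a b c d e
      apply (hgd z a b c d _).continuousAt
      intro hzS
      obtain ⟨k1, k2, k3, k4⟩ := hS z (Finset.mem_insert_of_mem hzS)
      rcases e with e | e | e | e <;> linarith
    · intro z hz
      rw [hgne z hz]
      simp only [hg0]
      ring

end M2R

namespace M2R
open Filter Topology Set
open Complex (I)

lemma tendsto_residue {φ ψ : ℂ → ℂ} {p d : ℂ} (h1 : ContinuousAt φ p) (h2 : HasDerivAt ψ d p) (h3 : ψ p = 0)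
    (hd : d ≠ 0) : Tendsto (fun z => (z - p) * (φ z / ψ z)) (𝓝[≠] p) (𝓝 (φ p / d)) := by
  have h4 := hasDerivAt_iff_tendsto_slope.mp h2
  have h5 := (h1.tendsto.mono_left (nhdsWithin_le_nhds (s := {p}ᶜ))).div h4 hd
  refine h5.congr' ?_
  filter_upwards [self_mem_nhdsWithin] with z hz
  have hz' : z - p ≠ 0 := sub_ne_zero.mpr (by simpa using hz)
  rw [Pi.div_apply, slope_def_field, h3, sub_zero, div_div_eq_mul_div]
  ring

lemma delta_bound (ω : ℂ) (hω : ‖ω‖ = 1) (h1 : ω ≠ 1) : ∃ δ : ℝ, 0 < δ ∧ ∀ v : ℂ, |v.im| ≤ 5 * |v.re| →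
    δ ≤ ‖Complex.exp v - ω * Complex.exp (-v)‖ := by
  set S : Set ℂ := {v | |v.im| ≤ 5 * |v.re| ∧ |v.re| ≤ 1} with hS
  have hcl : IsClosed S := by
    have e1 : IsClosed {v : ℂ | |v.im| ≤ 5 * |v.re|} := isClosed_le (by fun_prop) (by fun_prop)
    have e2 : IsClosed {v : ℂ | |v.re| ≤ 1} := isClosed_le (by fun_prop) (by fun_prop)
    exact e1.inter e2
  have hbd : Bornology.IsBounded S := by
    rw [isBounded_iff_forall_norm_le]
    refine ⟨6, fun v hv => ?_⟩
    have := Complex.norm_le_abs_re_add_abs_im v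
    linarith [hv.1, hv.2]
  have hc : IsCompact S := Metric.isCompact_of_isClosed_isBounded hcl hbd
  have hne : S.Nonempty := ⟨0, by simp [hS]⟩
  have lower : ∀ v : ℂ, |Real.exp v.re - Real.exp (-v.re)| ≤ ‖Complex.exp v - ω * Complex.exp (-v)‖ := by
    intro v
    have := abs_norm_sub_norm_le (Complex.exp v) (ω * Complex.exp (-v))
    rwa [norm_mul, hω, one_mul, Complex.norm_exp, Complex.norm_exp, Complex.neg_re] at this
  obtain ⟨v0, hv0, hmin⟩ := hc.exists_isMinOn hne
    (f := fun v => ‖Complex.exp v - ω * Complex.exp (-v)‖) (by fun_prop)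
  have hpos : 0 < ‖Complex.exp v0 - ω * Complex.exp (-v0)‖ := by
    by_contra hcon
    have h0 : ‖Complex.exp v0 - ω * Complex.exp (-v0)‖ = 0 := le_antisymm (not_lt.mp hcon) (norm_nonneg _)
    have h2 := lower v0
    rw [h0] at h2
    have h3 : Real.exp v0.re = Real.exp (-v0.re) := by
      have := abs_eq_zero.mp (le_antisymm h2 (abs_nonneg _))
      linarith
    have h4 : v0.re = 0 := by
      have := Real.exp_injective h3
      linarith
    have h5 : v0.im = 0 := by
      have := hv0.1
      rw [h4] at this
      simpa using this
    have h6 : v0 = 0 := Complex.ext h4 h5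
    rw [h6] at h0
    simp at h0
    exact h1 (sub_eq_zero.mp h0).symm
  refine ⟨min (‖Complex.exp v0 - ω * Complex.exp (-v0)‖) 1, lt_min hpos one_pos, fun v hv => ?_⟩
  by_cases h : |v.re| ≤ 1
  · exact (min_le_left _ _).trans (hmin ⟨hv, h⟩)
  · refine (min_le_right _ _).trans (le_trans ?_ (lower v))
    push Not at h
    rcases lt_abs.mp h with h | h
    · have e1 := Real.add_one_le_exp v.re
      have e2 : Real.exp (-v.re) ≤ 1 := Real.exp_le_one_iff.mpr (by linarith)
      exact le_trans (by linarith) (le_abs_self _)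
    · have e1 := Real.add_one_le_exp (-v.re)
      have e2 : Real.exp (v.re) ≤ 1 := Real.exp_le_one_iff.mpr (by linarith)
      exact le_trans (by linarith) (neg_le_abs _)

/-- the denominator -/
noncomputable def DB (t : ℂ) (K : ℕ) (r : ℤ) (u : ℝ) (ξ : ℂ) : ℂ :=
  Complex.exp (t * (K * ξ + r)) - Complex.exp (2 * Real.pi * I * u) * Complex.exp (-(t * (K * ξ + r)))

/-- the summand -/
noncomputable def gB (t : ℂ) (K : ℕ) (r : ℤ) (u : ℝ) (ξ : ℂ) : ℂ :=
  Complex.exp (-2 * t * (K * ξ + r) ^ 2) / DB t K r u ξ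

/-- the meromorphic integrand -/
noncomputable def hB (t : ℂ) (K : ℕ) (r : ℤ) (u : ℝ) (ξ : ℂ) : ℂ :=
  Real.pi * gB t K r u ξ / Complex.sin (Real.pi * ξ)

/-- the extra pole -/
noncomputable def xB (t : ℂ) (K : ℕ) (r : ℤ) (u : ℝ) : ℂ := (Real.pi * I * u / t - r) / K

/-- the extra residue -/
noncomputable def RB (t : ℂ) (K : ℕ) (r : ℤ) (u : ℝ) : ℂ :=
  Real.pi * Complex.exp (2 * Real.pi ^ 2 * u ^ 2 / t) /
    (2 * t * K * Complex.exp (Real.pi * I * u) * Complex.sin (Real.pi * xB t K r u))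

/-- the height of the strip -/
noncomputable def cB (t : ℂ) (K : ℕ) : ℝ := Real.pi * (t⁻¹).re / (4 * K ^ 2)

lemma DB_zero {t : ℂ} {K : ℕ} {r : ℤ} {u : ℝ} {ξ : ℂ} (ht : t ≠ 0) (h : DB t K r u ξ = 0) :
    ∃ j : ℤ, K * ξ + r = Real.pi * I * (u + j) / t := by
  unfold DB at h
  rw [sub_eq_zero, ← Complex.exp_add, Complex.exp_eq_exp_iff_exists_int] at h
  obtain ⟨j, hj⟩ := h
  refine ⟨j, ?_⟩
  field_simp
  linear_combination hj / 2

lemma DB_hasDerivAt (t : ℂ) (K : ℕ) (r : ℤ) (u : ℝ) (ξ : ℂ) :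
    HasDerivAt (DB t K r u) (t * K * (Complex.exp (t * (K * ξ + r)) +
      Complex.exp (2 * Real.pi * I * u) * Complex.exp (-(t * (K * ξ + r))))) ξ := by
  have h1 : HasDerivAt (fun ξ : ℂ => t * (K * ξ + r)) (t * K) ξ := by
    have := (((hasDerivAt_id ξ).const_mul (K : ℂ)).add_const (r : ℂ)).const_mul t
    simpa using this
  have h2 := h1.cexp.sub ((h1.neg.cexp).const_mul (Complex.exp (2 * Real.pi * I * u)))
  have e : ∀ a b c : ℂ, a * (t * K) - c * (b * (-(t * K))) = t * K * (a + c * b) := fun a b c => by ring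
  rw [← e]
  exact h2

lemma exp_u (u : ℝ) : Complex.exp (2 * Real.pi * I * u) = Complex.exp (Real.pi * I * u) * Complex.exp (Real.pi * I * u) := by
  rw [← Complex.exp_add]; congr 1; ring

lemma xB_eq {t : ℂ} {K : ℕ} {r : ℤ} {u : ℝ} (hK : 0 < K) (ht : t ≠ 0) :
    t * (K * xB t K r u + r) = Real.pi * I * u := by
  have : (K : ℂ) ≠ 0 := by exact_mod_cast hK.ne'
  unfold xB
  field_simp
  ring

lemma DB_xB {t : ℂ} {K : ℕ} {r : ℤ} {u : ℝ} (hK : 0 < K) (ht : t ≠ 0) : DB t K r u (xB t K r u) = 0 := by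
  unfold DB
  rw [xB_eq hK ht, exp_u, mul_assoc (Complex.exp _), ← Complex.exp_add (_ * _) (-_), add_neg_cancel, Complex.exp_zero, mul_one, sub_self]

lemma im_div (v : ℝ) (t : ℂ) : (Real.pi * I * v / t : ℂ).im = Real.pi * v * (t⁻¹).re := by
  rw [div_eq_mul_inv, show (Real.pi * I * v : ℂ) = ((Real.pi * v : ℝ) : ℂ) * I by push_cast; ring]
  simp

lemma re_div (v : ℝ) (t : ℂ) : (Real.pi * I * v / t : ℂ).re = -Real.pi * v * (t⁻¹).im := by
  rw [div_eq_mul_inv, show (Real.pi * I * v : ℂ) = ((Real.pi * v : ℝ) : ℂ) * I by push_cast; ring]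
  simp

lemma xB_im {t : ℂ} {K : ℕ} {r : ℤ} {u : ℝ} : (xB t K r u).im = Real.pi * u * (t⁻¹).re / K := by
  unfold xB
  rw [Complex.div_natCast_im, Complex.sub_im, im_div]
  simp

lemma inv_re_pos {t : ℂ} (ht : 0 < t.re) : 0 < (t⁻¹).re := by
  rw [Complex.inv_re]
  exact div_pos ht (Complex.normSq_pos.mpr (fun h => by rw [h] at ht; simp at ht))

/-- zeros of the denominator in the strip -/
lemma DB_strip {t : ℂ} {K : ℕ} {r : ℤ} {u : ℝ} {ξ : ℂ} (hK : 0 < K) (ht : 0 < t.re) (hu : |u| ≤ 1 / 2)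
    (hξ : |ξ.im| ≤ cB t K) (h : DB t K r u ξ = 0) : ξ = xB t K r u ∧ |u| ≤ 1 / (4 * K) := by
  have ht0 : t ≠ 0 := fun h => by rw [h] at ht; simp at ht
  have hK0 : (0 : ℝ) < K := by exact_mod_cast hK
  have hK1 : (1 : ℝ) ≤ K := by exact_mod_cast hK
  obtain ⟨j, hj⟩ := DB_zero ht0 h
  have hρ := inv_re_pos ht
  have hi : (K : ℝ) * ξ.im = Real.pi * (u + j) * (t⁻¹).re := by
    have := congrArg Complex.im hj
    have e := im_div (u + j) t
    push_cast at e
    rw [e] at this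
    simpa using this
  have hb : |u + j| ≤ 1 / (4 * K) := by
    have h1 : |(K : ℝ) * ξ.im| = K * |ξ.im| := by rw [abs_mul, abs_of_pos hK0]
    rw [hi, abs_mul, abs_mul, abs_of_pos Real.pi_pos, abs_of_pos hρ] at h1
    have h2 : K * |ξ.im| ≤ K * cB t K := by gcongr
    have h3 : K * cB t K = Real.pi * (t⁻¹).re * (1 / (4 * K)) := by
      unfold cB; field_simp
    have h4 : Real.pi * (t⁻¹).re * |u + j| ≤ Real.pi * (t⁻¹).re * (1 / (4 * K)) := by
      rw [← h3]; linarith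
    exact le_of_mul_le_mul_left h4 (by positivity)
  have hj0 : j = 0 := by
    have h1 : (1 : ℝ) / (4 * K) ≤ 1 / 4 := by
      apply one_div_le_one_div_of_le <;> linarith
    have h2 : |(j : ℝ)| < 1 := by
      have := abs_sub_abs_le_abs_sub (j : ℝ) (-u)
      rw [abs_neg, sub_neg_eq_add, add_comm (j:ℝ) u] at this
      linarith
    have h3 : |j| < 1 := by exact_mod_cast h2
    exact Int.abs_lt_one_iff.mp h3
  subst hj0
  refine ⟨?_, by simpa using hb⟩
  have : (K : ℂ) ≠ 0 := by exact_mod_cast hK.ne'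
  unfold xB
  rw [eq_div_iff this]
  push_cast at hj
  linear_combination hj

lemma DB_ne_int {t : ℂ} {K : ℕ} {r : ℤ} {u : ℝ} (hK : 0 < K) (ht : 0 < t.re) (hu : |u| ≤ 1 / 2)
    (h0 : u = 0 → ∀ m : ℤ, K * m + r ≠ 0) (m : ℤ) : DB t K r u m ≠ 0 := by
  intro h
  have ht0 : t ≠ 0 := fun h => by rw [h] at ht; simp at ht
  obtain ⟨j, hj⟩ := DB_zero ht0 h
  have hρ := inv_re_pos ht
  have hi : Real.pi * (u + j) * (t⁻¹).re = 0 := by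
    have := congrArg Complex.im hj
    have e := im_div (u + j) t
    push_cast at e
    rw [e] at this
    simpa using this.symm
  have h1 : u + j = 0 := by
    rcases mul_eq_zero.mp hi with h | h
    · rcases mul_eq_zero.mp h with h | h
      · exact absurd h Real.pi_ne_zero
      · exact h
    · exact absurd h hρ.ne'
  have h2 : (K : ℂ) * m + r = 0 := by
    rw [hj]
    have : ((u : ℂ) + j) = 0 := by exact_mod_cast h1
    rw [this]; simp
  have h3 : |(j : ℝ)| < 1 := by
    have : (j : ℝ) = -u := by linarith
    rw [this, abs_neg]; linarith
  have h4 : j = 0 := Int.abs_lt_one_iff.mp (by exact_mod_cast h3)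
  rw [h4] at h1
  exact h0 (by simpa using h1) m (by exact_mod_cast h2)

lemma sin_int_iff {z : ℂ} : Complex.sin (Real.pi * z) = 0 ↔ ∃ m : ℤ, z = m := by
  rw [Complex.sin_eq_zero_iff]
  have hp : (Real.pi : ℂ) ≠ 0 := by exact_mod_cast Real.pi_ne_zero
  constructor
  · rintro ⟨k, hk⟩
    exact ⟨k, mul_left_cancel₀ hp (by rw [hk]; ring)⟩
  · rintro ⟨k, hk⟩
    exact ⟨k, by rw [hk]; ring⟩

lemma hB_diff {t : ℂ} {K : ℕ} {r : ℤ} {u : ℝ} {z : ℂ} (h1 : DB t K r u z ≠ 0) (h2 : ∀ m : ℤ, z ≠ m) :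
    DifferentiableAt ℂ (hB t K r u) z := by
  have h3 : Complex.sin (Real.pi * z) ≠ 0 := fun h => by
    obtain ⟨m, hm⟩ := sin_int_iff.mp h
    exact h2 m hm
  have h4 := (DB_hasDerivAt t K r u z).differentiableAt
  unfold hB gB
  apply DifferentiableAt.fun_div
  · apply DifferentiableAt.const_mul
    apply DifferentiableAt.fun_div _ h4 h1
    fun_prop
  · fun_prop
  · exact h3

lemma gB_cont {t : ℂ} {K : ℕ} {r : ℤ} {u : ℝ} {z : ℂ} (h1 : DB t K r u z ≠ 0) :
    ContinuousAt (gB t K r u) z := by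
  have h4 := (DB_hasDerivAt t K r u z).differentiableAt.continuousAt
  unfold gB
  apply ContinuousAt.div _ h4 h1
  fun_prop

lemma sin_deriv (m : ℤ) : HasDerivAt (fun z : ℂ => Complex.sin (Real.pi * z)) (Real.pi * (-1) ^ m) m := by
  have h1 : HasDerivAt (fun z : ℂ => (Real.pi : ℂ) * z) (Real.pi) (m : ℂ) := by
    simpa using (hasDerivAt_id (m : ℂ)).const_mul (Real.pi : ℂ)
  have h2 := h1.csin
  have e : Complex.cos (Real.pi * m) = (-1) ^ m := by
    rw [mul_comm]
    have := Real.cos_int_mul_pi m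
    have h3 := congrArg (fun x : ℝ => (x : ℂ)) this
    push_cast at h3
    exact h3
  rw [e] at h2
  convert h2 using 1
  ring

lemma res_int {t : ℂ} {K : ℕ} {r : ℤ} {u : ℝ} {m : ℤ} (h1 : DB t K r u m ≠ 0) :
    Tendsto (fun z => (z - m) * hB t K r u z) (𝓝[≠] (m : ℂ)) (𝓝 ((-1) ^ m * gB t K r u m)) := by
  have hp : (Real.pi : ℂ) ≠ 0 := by exact_mod_cast Real.pi_ne_zero
  have hm : ((-1 : ℂ) ^ m) ≠ 0 := zpow_ne_zero _ (by norm_num)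
  have := tendsto_residue (φ := fun z => Real.pi * gB t K r u z) (p := (m : ℂ))
    (continuousAt_const.mul (gB_cont h1)) (sin_deriv m) (sin_int_iff.mpr ⟨m, rfl⟩) (mul_ne_zero hp hm)
  have e : (Real.pi * gB t K r u m : ℂ) / (Real.pi * (-1) ^ m) = (-1) ^ m * gB t K r u m := by
    rw [mul_div_mul_left _ _ hp, div_eq_iff hm]
    have : ((-1 : ℂ) ^ m) * (-1) ^ m = 1 := by
      rw [← mul_zpow]; simp
    linear_combination -(gB t K r u m) * this
  rw [e] at this
  exact this

lemma res_x {t : ℂ} {K : ℕ} {r : ℤ} {u : ℝ} (hK : 0 < K) (ht : t ≠ 0) (h1 : ∀ m : ℤ, xB t K r u ≠ m) :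
    Tendsto (fun z => (z - xB t K r u) * hB t K r u z) (𝓝[≠] (xB t K r u)) (𝓝 (RB t K r u)) := by
  have hKc : (K : ℂ) ≠ 0 := by exact_mod_cast hK.ne'
  have h3 : Complex.sin (Real.pi * xB t K r u) ≠ 0 := fun h => by
    obtain ⟨m, hm⟩ := sin_int_iff.mp h
    exact h1 m hm
  have hd := DB_hasDerivAt t K r u (xB t K r u)
  have e1 : (t * K * (Complex.exp (t * (K * xB t K r u + r)) +
      Complex.exp (2 * Real.pi * I * u) * Complex.exp (-(t * (K * xB t K r u + r))))) =
      2 * t * K * Complex.exp (Real.pi * I * u) := by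
    rw [xB_eq hK ht, exp_u, mul_assoc (Complex.exp _), ← Complex.exp_add]
    simp
    ring
  rw [e1] at hd
  have hne : 2 * t * K * Complex.exp (Real.pi * I * u) ≠ 0 := by
    simp [ht, hKc, Complex.exp_ne_zero]
  have := tendsto_residue (φ := fun z => Real.pi * Complex.exp (-2 * t * (K * z + r) ^ 2) / Complex.sin (Real.pi * z))
    (p := xB t K r u) (by
      exact ContinuousAt.div (f := fun z : ℂ => Real.pi * Complex.exp (-2 * t * (K * z + r) ^ 2))
        (g := fun z : ℂ => Complex.sin (Real.pi * z)) (by fun_prop) (by fun_prop) h3) hd (DB_xB hK ht) hne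
  have e2 : -2 * t * (K * xB t K r u + r) ^ 2 = 2 * Real.pi ^ 2 * u ^ 2 / t := by
    have := xB_eq (r := r) (u := u) hK ht
    rw [eq_div_iff ht]
    linear_combination (-2) * (t * (K * xB t K r u + r) + Real.pi * I * u) * this - 2 * Real.pi ^ 2 * u ^ 2 * Complex.I_sq
  have e3 : (Real.pi * Complex.exp (-2 * t * (K * xB t K r u + r) ^ 2) / Complex.sin (Real.pi * xB t K r u)) /
      (2 * t * K * Complex.exp (Real.pi * I * u)) = RB t K r u := by
    unfold RB
    rw [e2, div_div]
    congr 1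
    ring
  rw [e3] at this
  refine this.congr (fun z => ?_)
  unfold hB gB
  simp only [div_eq_mul_inv]
  ring

end M2R

namespace M2R
open Filter Topology Set
open Complex (I)

/-- indicator residue -/
noncomputable def RB' (t : ℂ) (K : ℕ) (r : ℤ) (u : ℝ) : ℂ := if |u| < 1 / (4 * K) then RB t K r u else 0

lemma xB_ne_int {t : ℂ} {K : ℕ} {r : ℤ} {u : ℝ} (hK : 0 < K) (ht : 0 < t.re) (hu : |u| ≤ 1 / 2)
    (h0 : u = 0 → ∀ m : ℤ, K * m + r ≠ 0) (m : ℤ) : xB t K r u ≠ m := by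
  have ht0 : t ≠ 0 := fun h => by rw [h] at ht; simp at ht
  intro h
  apply DB_ne_int hK ht hu h0 m
  rw [← h]
  exact DB_xB hK ht0

lemma cB_pos {t : ℂ} {K : ℕ} (hK : 0 < K) (ht : 0 < t.re) : 0 < cB t K := by
  have := inv_re_pos ht
  have hK0 : (0 : ℝ) < K := by exact_mod_cast hK
  unfold cB
  have := Real.pi_pos
  positivity

lemma bdry_hB {t : ℂ} {K : ℕ} {r : ℤ} {u : ℝ} (hK : 0 < K) (ht : 0 < t.re) (hu : |u| ≤ 1 / 2)
    (hu' : |u| ≠ 1 / (4 * K)) (h0 : u = 0 → ∀ m : ℤ, K * m + r ≠ 0) (N : ℕ) (hN : |(xB t K r u).re| < N) :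
    bdry (hB t K r u) (-(N + 1 / 2)) (N + 1 / 2) (-cB t K) (cB t K) =
      2 * Real.pi * I * (∑ m ∈ Finset.Icc (-N : ℤ) N, (-1) ^ m * gB t K r u m + RB' t K r u) := by
  have ht0 : t ≠ 0 := fun h => by rw [h] at ht; simp at ht
  have hc := cB_pos hK ht
  have hK0 : (0 : ℝ) < K := by exact_mod_cast hK
  have hρ := inv_re_pos ht
  set T1 : Finset ℂ := (Finset.Icc (-N : ℤ) N).image (fun m : ℤ => (m : ℂ)) with hT1
  set T2 : Finset ℂ := if |u| < 1 / (4 * K) then {xB t K r u} else ∅ with hT2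
  have hmem : ∀ z, z ∈ T2 ↔ |u| < 1 / (4 * K) ∧ z = xB t K r u := by
    intro z
    rw [hT2]
    split_ifs with h
    · simp only [Finset.mem_singleton, h, true_and]
    · simp only [Finset.notMem_empty, h, false_and]
  have hdisj : Disjoint T1 T2 := by
    rw [Finset.disjoint_left]
    intro z hz hz2
    rw [hT1, Finset.mem_image] at hz
    obtain ⟨m, _, rfl⟩ := hz
    exact xB_ne_int hK ht hu h0 m ((hmem _).mp hz2).2.symm
  have hlim1 : ∀ m : ℤ, Tendsto (fun z => (z - m) * hB t K r u z) (𝓝[≠] (m : ℂ)) (𝓝 ((-1) ^ m * gB t K r u m)) :=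
    fun m => res_int (DB_ne_int hK ht hu h0 m)
  have hlim2 := res_x (t := t) (K := K) (r := r) (u := u) hK ht0 (xB_ne_int hK ht hu h0)
  rw [rect_residue (by have : (0:ℝ) ≤ N := Nat.cast_nonneg N
                       linarith) (by linarith)
    (fun p => limUnder (𝓝[≠] p) (fun z => (z - p) * hB t K r u z)) (T1 ∪ T2), Finset.sum_union hdisj]
  · congr 2
    · rw [hT1, Finset.sum_image (by intro a _ b _ h; exact Int.cast_injective h)]
      apply Finset.sum_congr rfl
      intro m _
      exact (hlim1 m).limUnder_eq
    · unfold RB'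
      rw [hT2]
      split_ifs with h
      · rw [Finset.sum_singleton]
        exact hlim2.limUnder_eq
      · simp
  · intro p hp
    rw [Finset.mem_union] at hp
    rcases hp with hp | hp
    · rw [hT1, Finset.mem_image] at hp
      obtain ⟨m, hm, rfl⟩ := hp
      rw [Finset.mem_Icc] at hm
      have h1 : (-N : ℝ) ≤ m := by exact_mod_cast hm.1
      have h2 : (m : ℝ) ≤ N := by exact_mod_cast hm.2
      simp only [Complex.intCast_re, Complex.intCast_im]
      refine ⟨by linarith, by linarith, by linarith, by linarith⟩
    · obtain ⟨h1, rfl⟩ := (hmem _).mp hp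
      have h2 := abs_lt.mp hN
      have h3 : |(xB t K r u).im| < cB t K := by
        rw [xB_im, abs_div, abs_mul, abs_mul, abs_of_pos Real.pi_pos, abs_of_pos hρ, abs_of_pos hK0]
        have : cB t K = Real.pi * (1 / (4 * K)) * (t⁻¹).re / K := by unfold cB; field_simp
        rw [this]
        have := Real.pi_pos
        gcongr
      have h4 := abs_lt.mp h3
      exact ⟨by linarith, by linarith, h4.1, h4.2⟩
  · intro z a b c d hz
    rw [Finset.mem_union, not_or] at hz
    apply hB_diff
    · intro hD
      obtain ⟨h1, h2⟩ := DB_strip hK ht hu (abs_le.mpr ⟨c, d⟩) hD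
      exact hz.2 ((hmem z).mpr ⟨lt_of_le_of_ne h2 hu', h1⟩)
    · intro m hm
      apply hz.1
      rw [hT1, Finset.mem_image]
      refine ⟨m, ?_, hm.symm⟩
      rw [hm] at a b
      simp only [Complex.intCast_re] at a b
      rw [Finset.mem_Icc]
      constructor
      · have : (-N - 1 : ℝ) < m := by linarith
        have : (-N - 1 : ℤ) < m := by exact_mod_cast this
        omega
      · have : (m : ℝ) < N + 1 := by linarith
        have : m < N + 1 := by exact_mod_cast this
        omega
  · intro p hp
    rw [Finset.mem_union] at hp
    rcases hp with hp | hp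
    · rw [hT1, Finset.mem_image] at hp
      obtain ⟨m, hm, rfl⟩ := hp
      exact tendsto_nhds_limUnder ⟨_, hlim1 m⟩
    · obtain ⟨h1, rfl⟩ := (hmem _).mp hp
      exact tendsto_nhds_limUnder ⟨_, hlim2⟩

lemma sin_norm (x y : ℝ) : ‖Complex.sin (x + y * I)‖ ^ 2 = Real.sin x ^ 2 + Real.sinh y ^ 2 := by
  have e : Complex.sin (x + y * I) = ((Real.sin x * Real.cosh y : ℝ) : ℂ) + ((Real.cos x * Real.sinh y : ℝ) : ℂ) * I := by
    rw [Complex.sin_add_mul_I]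
    push_cast
    ring
  rw [Complex.sq_norm, e, Complex.normSq_add_mul_I]
  have e1 := Real.sin_sq_add_cos_sq x
  have e2 := Real.cosh_sq y
  linear_combination (Real.sin x ^ 2) * e2 + (Real.sinh y) ^ 2 * e1

lemma sin_lower (x y : ℝ) : Real.sinh |y| ≤ ‖Complex.sin (x + y * I)‖ := by
  rw [← Real.abs_sinh]
  apply abs_le_of_sq_le_sq _ (norm_nonneg _)
  rw [sin_norm]
  nlinarith [sq_nonneg (Real.sin x)]

lemma sin_lower_half (N : ℤ) (y : ℝ) : 1 ≤ ‖Complex.sin (Real.pi * ((N + 1 / 2 : ℝ) + y * I))‖ := by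
  have e : (Real.pi * ((N + 1 / 2 : ℝ) + y * I) : ℂ) = ((Real.pi / 2 + N * Real.pi : ℝ) : ℂ) + ((Real.pi * y : ℝ) : ℂ) * I := by
    push_cast; ring
  have h : ‖Complex.sin (Real.pi * ((N + 1 / 2 : ℝ) + y * I))‖ ^ 2 = 1 + Real.sinh (Real.pi * y) ^ 2 := by
    rw [e, sin_norm, Real.sin_add_int_mul_pi, Real.sin_pi_div_two]
    have e3 : ((-1 : ℝ) ^ N) * (-1) ^ N = 1 := by
      rw [← mul_zpow]; simp
    linear_combination e3
  nlinarith [sq_nonneg (Real.sinh (Real.pi * y)), norm_nonneg (Complex.sin (Real.pi * ((N + 1 / 2 : ℝ) + y * I)))]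

lemma cB_mul {t : ℂ} {K : ℕ} (hK : 0 < K) (ht : 0 < t.re) :
    cB t K * (t.re ^ 2 + t.im ^ 2) * (4 * K ^ 2) = Real.pi * t.re := by
  have hK0 : (K : ℝ) ≠ 0 := by exact_mod_cast hK.ne'
  have hn : Complex.normSq t = t.re ^ 2 + t.im ^ 2 := by rw [Complex.normSq_apply]; ring
  have hnp : t.re ^ 2 + t.im ^ 2 ≠ 0 := by nlinarith [mul_self_nonneg t.im, mul_pos ht ht]
  unfold cB
  rw [Complex.inv_re, hn]
  field_simp

/-- the key shift identity -/
lemma shift_id {t : ℂ} {K : ℕ} {r : ℤ} (hK : 0 < K) (ht : 0 < t.re) (σ : ℝ) (s : ℝ) :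
    t * (K * (s + (σ * cB t K : ℝ) * I) + r) =
      t * ((K * s + r - σ * t.im * K * cB t K / t.re : ℝ) : ℂ) + ((σ * (Real.pi / (4 * K)) : ℝ) : ℂ) * I := by
  have hK0 : (K : ℝ) ≠ 0 := by exact_mod_cast hK.ne'
  have h := cB_mul hK ht
  have hne := ht.ne'
  set c := cB t K
  have e1 : (t * (K * (s + (σ * c : ℝ) * I) + r)) = t * (((K * s + r : ℝ) : ℂ) + ((K * σ * c : ℝ) : ℂ) * I) := by
    push_cast; ring
  rw [e1]
  apply Complex.ext
  · simp only [Complex.add_re, Complex.add_im, Complex.mul_re, Complex.mul_im, Complex.ofReal_re, Complex.ofReal_im, Complex.I_re, Complex.I_im]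
    field_simp
    ring
  · simp only [Complex.add_re, Complex.add_im, Complex.mul_re, Complex.mul_im, Complex.ofReal_re, Complex.ofReal_im, Complex.I_re, Complex.I_im]
    have : Real.pi = c * (t.re ^ 2 + t.im ^ 2) * (4 * K ^ 2) / t.re := by rw [h]; field_simp
    rw [this]
    field_simp
    ring

lemma num_norm {t : ℂ} (ht : t ≠ 0) (X : ℂ) (A θ : ℝ) (h : t * X = t * A + θ * I) :
    ‖Complex.exp (-2 * t * X ^ 2)‖ = Real.exp (-2 * t.re * A ^ 2 + 2 * θ ^ 2 * (t⁻¹).re) := by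
  rw [Complex.norm_exp]
  congr 1
  have e : -2 * t * X ^ 2 = ((-2 * A ^ 2 : ℝ) : ℂ) * t + ((2 * θ ^ 2 : ℝ) : ℂ) * t⁻¹ - ((4 * A * θ : ℝ) : ℂ) * I := by
    have h1 : -2 * t * X ^ 2 = -2 * (t * X) ^ 2 * t⁻¹ := by field_simp
    rw [h1, h]
    push_cast
    field_simp
    linear_combination (-2) * θ ^ 2 * Complex.I_sq
  rw [e]
  simp only [Complex.sub_re, Complex.add_re, Complex.re_ofReal_mul, Complex.I_re]
  ring

lemma gauss_bound {a K d : ℝ} (ha : 0 < a) (hK : 1 ≤ K) (L : ℝ) (hL : 0 ≤ L) :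
    ∫ s in (-L)..L, Real.exp (-2 * a * (K * s + d) ^ 2) ≤ 2 / √a ∧
    IntervalIntegrable (fun s => Real.exp (-2 * a * (K * s + d) ^ 2)) MeasureTheory.volume (-L) L := by
  have hK0 : 0 < K := by linarith
  have e : (fun s => Real.exp (-2 * a * (K * s + d) ^ 2)) =
      fun s => (fun x => Real.exp (-(2 * a * K ^ 2) * x ^ 2)) (s + d / K) := by
    ext s
    simp only
    congr 1
    field_simp
  have hi : MeasureTheory.Integrable (fun s => Real.exp (-2 * a * (K * s + d) ^ 2)) := by
    rw [e]
    exact (integrable_exp_neg_mul_sq (by positivity : 0 < 2 * a * K ^ 2)).comp_add_right (d / K)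
  refine ⟨?_, hi.intervalIntegrable⟩
  rw [intervalIntegral.integral_of_le (by linarith)]
  refine (MeasureTheory.setIntegral_le_integral hi (Eventually.of_forall (fun s => Real.exp_nonneg _))).trans ?_
  rw [e, MeasureTheory.integral_add_right_eq_self (fun x => Real.exp (-(2 * a * K ^ 2) * x ^ 2)) (d / K), integral_gaussian]
  rw [show Real.pi / (2 * a * K ^ 2) = (Real.pi / (2 * K ^ 2)) / a by field_simp, Real.sqrt_div (by positivity)]
  have : √(Real.pi / (2 * K ^ 2)) ≤ 2 := by
    rw [Real.sqrt_le_left (by norm_num), div_le_iff₀ (by positivity)]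
    nlinarith [Real.pi_lt_four]
  gcongr

lemma sinh_ge {x : ℝ} (hx : 1 ≤ x) : Real.exp x / 4 ≤ Real.sinh x := by
  rw [Real.sinh_eq]
  have h1 := Real.add_one_le_exp x
  have h2 : Real.exp (-x) * Real.exp x = 1 := by rw [← Real.exp_add]; simp
  have h3 : 0 < Real.exp (-x) := Real.exp_pos _
  nlinarith

lemma hB_line {K : ℕ} {r : ℤ} {u : ℝ} (hK : 0 < K) (σ : ℝ) (hσ : |σ| = 1)
    (hω : Complex.exp (2 * Real.pi * I * u) * Complex.exp (-2 * (σ * (Real.pi / (4 * K)) : ℝ) * I) ≠ 1) :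
    ∃ C : ℝ, 0 < C ∧ ∀ t : ℂ, 0 < t.re → |t.im| ≤ 5 * t.re → 1 ≤ Real.pi * cB t K → ∀ L : ℝ, 0 ≤ L →
      ‖∫ s in (-L)..L, hB t K r u (s + (σ * cB t K : ℝ) * I)‖ ≤
        C / √t.re * Real.exp (-(Real.pi ^ 2 / (8 * K ^ 2) * (t⁻¹).re)) := by
  have hK0 : (0 : ℝ) < K := by exact_mod_cast hK
  have hK1 : (1 : ℝ) ≤ K := by exact_mod_cast hK
  have hpi := Real.pi_pos
  set θ : ℝ := σ * (Real.pi / (4 * K)) with hθ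
  have hσ2 : σ ^ 2 = 1 := by rw [← sq_abs, hσ]; norm_num
  obtain ⟨δ, hδ, hδb⟩ := delta_bound (Complex.exp (2 * Real.pi * I * u) * Complex.exp (-2 * θ * I)) (by
    rw [norm_mul, show (2 * Real.pi * I * u : ℂ) = ((2 * Real.pi * u : ℝ) : ℂ) * I by push_cast; ring,
      show (-2 * θ * I : ℂ) = ((-2 * θ : ℝ) : ℂ) * I by push_cast; ring, Complex.norm_exp_ofReal_mul_I,
      Complex.norm_exp_ofReal_mul_I, one_mul]) hω
  refine ⟨8 * Real.pi / δ, by positivity, fun t ht hsec hc L hL => ?_⟩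
  have ht0 : t ≠ 0 := fun h => by rw [h] at ht; simp at ht
  set E := Real.exp (-(Real.pi ^ 2 / (8 * K ^ 2) * (t⁻¹).re)) with hE
  set d : ℝ := r - σ * t.im * K * cB t K / t.re with hd
  have hcp := cB_pos hK ht
  have key : ∀ s : ℝ, ‖hB t K r u (s + (σ * cB t K : ℝ) * I)‖ ≤
      (4 * Real.pi / δ * E) * Real.exp (-2 * t.re * (K * s + d) ^ 2) := by
    intro s
    have hsh := shift_id (r := r) hK ht σ s
    rw [add_sub_assoc, ← hd, ← hθ] at hsh
    unfold hB gB
    rw [norm_div, norm_mul, norm_div, num_norm ht0 _ _ _ hsh, Complex.norm_of_nonneg hpi.le]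
    have hD : δ ≤ ‖DB t K r u (s + (σ * cB t K : ℝ) * I)‖ := by
      unfold DB
      rw [hsh]
      have e : Complex.exp (t * ((K * s + d : ℝ) : ℂ) + θ * I) - Complex.exp (2 * Real.pi * I * u) *
          Complex.exp (-(t * ((K * s + d : ℝ) : ℂ) + θ * I)) = Complex.exp (θ * I) *
          (Complex.exp (t * ((K * s + d : ℝ) : ℂ)) - Complex.exp (2 * Real.pi * I * u) * Complex.exp (-2 * θ * I) *
            Complex.exp (-(t * ((K * s + d : ℝ) : ℂ)))) := by
        generalize t * ((K * s + d : ℝ) : ℂ) = v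
        have a1 : Complex.exp (v + θ * I) = Complex.exp (θ * I) * Complex.exp v := by
          rw [← Complex.exp_add, add_comm]
        have a2 : Complex.exp (-(v + θ * I)) = Complex.exp (θ * I) * Complex.exp (-2 * θ * I) * Complex.exp (-v) := by
          rw [← Complex.exp_add, ← Complex.exp_add]
          congr 1
          ring
        rw [a1, a2]
        ring
      rw [e, norm_mul, Complex.norm_exp_ofReal_mul_I, one_mul]
      apply hδb
      rw [Complex.im_mul_ofReal, Complex.re_mul_ofReal, abs_mul, abs_mul, abs_of_pos ht, ← mul_assoc]
      exact mul_le_mul_of_nonneg_right hsec (abs_nonneg _)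
    have hS : Real.exp (Real.pi * cB t K) / 4 ≤ ‖Complex.sin (Real.pi * (s + (σ * cB t K : ℝ) * I))‖ := by
      have e : (Real.pi * (s + (σ * cB t K : ℝ) * I) : ℂ) = ((Real.pi * s : ℝ) : ℂ) + ((Real.pi * (σ * cB t K) : ℝ) : ℂ) * I := by
        push_cast; ring
      rw [e]
      refine le_trans ?_ (sin_lower _ _)
      rw [abs_mul, abs_mul, hσ, one_mul, abs_of_pos hpi, abs_of_pos hcp]
      exact sinh_ge hc
    have hnum : Real.exp (-2 * t.re * (K * s + d) ^ 2 + 2 * θ ^ 2 * (t⁻¹).re) =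
        Real.exp (-2 * t.re * (K * s + d) ^ 2) * (E * Real.exp (Real.pi * cB t K)) := by
      rw [hE, ← Real.exp_add, ← Real.exp_add]
      congr 2
      rw [hθ, mul_pow, hσ2]
      unfold cB
      field_simp
      ring
    rw [hnum]
    calc Real.pi * (Real.exp (-2 * t.re * (K * s + d) ^ 2) * (E * Real.exp (Real.pi * cB t K)) / ‖DB t K r u (s + (σ * cB t K : ℝ) * I)‖) / ‖Complex.sin (Real.pi * (s + (σ * cB t K : ℝ) * I))‖
        ≤ Real.pi * (Real.exp (-2 * t.re * (K * s + d) ^ 2) * (E * Real.exp (Real.pi * cB t K)) / δ) / (Real.exp (Real.pi * cB t K) / 4) := by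
          gcongr
      _ = _ := by
          have := (Real.exp_pos (Real.pi * cB t K)).ne'
          field_simp
  obtain ⟨g1, g2⟩ := gauss_bound (d := d) ht hK1 L hL
  refine (intervalIntegral.norm_integral_le_of_norm_le (by linarith) (Eventually.of_forall fun s _ => key s)
    (g2.const_mul _)).trans ?_
  rw [intervalIntegral.integral_const_mul]
  calc _ ≤ (4 * Real.pi / δ * E) * (2 / √t.re) := by gcongr
    _ = _ := by ring

end M2R

namespace M2R
open Filter Topology Set
open Complex (I)

lemma DB_lower {t : ℂ} {u : ℝ} {X : ℂ} {A θ : ℝ} (ht : 0 < t.re) (h : t * X = t * A + θ * I) (hA : 1 ≤ t.re * |A|) :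
    1 / 2 ≤ ‖Complex.exp (t * X) - Complex.exp (2 * Real.pi * I * u) * Complex.exp (-(t * X))‖ := by
  have hu : ‖Complex.exp (2 * Real.pi * I * u)‖ = 1 := by
    rw [show (2 * Real.pi * I * u : ℂ) = ((2 * Real.pi * u : ℝ) : ℂ) * I by push_cast; ring, Complex.norm_exp_ofReal_mul_I]
  have hre : (t * X).re = t.re * A := by rw [h]; simp
  have h1 : ‖Complex.exp (t * X)‖ = Real.exp (t.re * A) := by rw [Complex.norm_exp, hre]
  have h2 : ‖Complex.exp (2 * Real.pi * I * u) * Complex.exp (-(t * X))‖ = Real.exp (-(t.re * A)) := by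
    rw [norm_mul, hu, one_mul, Complex.norm_exp, Complex.neg_re, hre]
  have h3 := abs_norm_sub_norm_le (Complex.exp (t * X)) (Complex.exp (2 * Real.pi * I * u) * Complex.exp (-(t * X)))
  rw [h1, h2] at h3
  refine le_trans ?_ h3
  have h4 : |Real.exp (t.re * A) - Real.exp (-(t.re * A))| = 2 * Real.sinh (t.re * |A|) := by
    rw [show Real.exp (t.re * A) - Real.exp (-(t.re * A)) = 2 * Real.sinh (t.re * A) by rw [Real.sinh_eq]; ring,
      abs_mul, Real.abs_sinh, abs_mul, abs_of_pos ht]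
    norm_num
  rw [h4]
  have h5 := sinh_ge hA
  have h6 := Real.add_one_le_exp (t.re * |A|)
  linarith

lemma hB_vert {t : ℂ} {K : ℕ} {r : ℤ} {u : ℝ} (hK : 0 < K) (ht : 0 < t.re) :
    ∃ M B : ℝ, 0 < B ∧ ∀ j : ℤ, ∀ y : ℝ, |y| ≤ cB t K → M + 1 + 1 / t.re ≤ |(j + 1 / 2 : ℝ)| →
      ‖hB t K r u ((j + 1 / 2 : ℝ) + y * I)‖ ≤ B * Real.exp (-(2 * t.re * (|(j + 1 / 2 : ℝ)| - M))) := by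
  have ht0 : t ≠ 0 := fun h => by rw [h] at ht; simp at ht
  have hK0 : (0 : ℝ) < K := by exact_mod_cast hK
  have hK1 : (1 : ℝ) ≤ K := by exact_mod_cast hK
  have hpi := Real.pi_pos
  have hc := cB_pos hK ht
  have hρ := inv_re_pos ht
  refine ⟨|(r : ℝ)| + |t.im| * K * cB t K / t.re, 2 * Real.pi * Real.exp (2 * (Real.pi / (4 * K)) ^ 2 * (t⁻¹).re), by positivity, ?_⟩
  intro j y hy hj
  set M := |(r : ℝ)| + |t.im| * K * cB t K / t.re with hM
  have hM0 : 0 ≤ M := by positivity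
  set x : ℝ := j + 1 / 2 with hx
  set σ := y / cB t K with hσ
  have hσ1 : |σ| ≤ 1 := by
    rw [hσ, abs_div, abs_of_pos hc, div_le_one hc]; exact hy
  have hyσ : y = σ * cB t K := by rw [hσ]; field_simp
  have hsh := shift_id (r := r) hK ht σ x
  rw [← hyσ, add_sub_assoc] at hsh
  set A : ℝ := K * x + (r - σ * t.im * K * cB t K / t.re) with hA
  have hA1 : |x| - M ≤ |A| := by
    have e1 : |(r - σ * t.im * K * cB t K / t.re : ℝ)| ≤ M := by
      refine (abs_sub _ _).trans ?_
      rw [hM]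
      gcongr
      rw [abs_div, abs_mul, abs_mul, abs_mul, abs_of_pos hc, abs_of_pos hK0, abs_of_pos ht]
      have : |σ| * |t.im| ≤ |t.im| := mul_le_of_le_one_left (abs_nonneg _) hσ1
      gcongr
    have e2 : |(K * x : ℝ)| - |(r - σ * t.im * K * cB t K / t.re : ℝ)| ≤ |A| := by
      have := abs_sub_abs_le_abs_sub (K * x : ℝ) (-(r - σ * t.im * K * cB t K / t.re))
      rw [abs_neg, sub_neg_eq_add] at this
      exact this
    have e3 : |x| ≤ |(K * x : ℝ)| := by
      rw [abs_mul, abs_of_pos hK0]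
      exact le_mul_of_one_le_left (abs_nonneg _) hK1
    linarith
  have hA2 : 1 ≤ |A| := by
    have : 0 < 1 / t.re := by positivity
    linarith
  have hA3 : 1 ≤ t.re * |A| := by
    have : 1 / t.re ≤ |A| := by linarith
    rw [div_le_iff₀ ht] at this
    linarith
  have hD := DB_lower (u := u) ht hsh hA3
  have hS := sin_lower_half j y
  rw [← hx] at hS
  unfold hB gB DB
  rw [norm_div, norm_mul, norm_div, num_norm ht0 _ _ _ hsh, Complex.norm_of_nonneg hpi.le]
  have hθ : 2 * (σ * (Real.pi / (4 * K))) ^ 2 * (t⁻¹).re ≤ 2 * (Real.pi / (4 * K)) ^ 2 * (t⁻¹).re := by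
    rw [mul_pow]
    have : σ ^ 2 ≤ 1 := by rw [← sq_abs]; exact pow_le_one₀ (abs_nonneg _) hσ1
    have h2 : σ ^ 2 * (Real.pi / (4 * K)) ^ 2 ≤ (Real.pi / (4 * K)) ^ 2 := mul_le_of_le_one_left (by positivity) this
    gcongr
  have hAA : -2 * t.re * A ^ 2 ≤ -(2 * t.re * (|x| - M)) := by
    have : |x| - M ≤ A ^ 2 := by
      rw [← sq_abs]
      nlinarith
    nlinarith
  calc _ ≤ Real.pi * (Real.exp (-(2 * t.re * (|x| - M)) + 2 * (Real.pi / (4 * K)) ^ 2 * (t⁻¹).re) / (1 / 2)) / 1 := by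
        gcongr
    _ = _ := by rw [Real.exp_add]; ring

lemma vert_tendsto {t : ℂ} {K : ℕ} {r : ℤ} {u : ℝ} (hK : 0 < K) (ht : 0 < t.re) (j : ℕ → ℤ)
    (hj : Tendsto (fun N => |(j N + 1 / 2 : ℝ)|) atTop atTop) :
    Tendsto (fun N => ∫ y in (-cB t K)..(cB t K), hB t K r u ((j N + 1 / 2 : ℝ) + y * I)) atTop (𝓝 0) := by
  obtain ⟨M, B, hB0, h⟩ := hB_vert (r := r) (u := u) hK ht
  have hc := cB_pos hK ht
  have hlim : Tendsto (fun N => B * Real.exp (-(2 * t.re * (|(j N + 1 / 2 : ℝ)| - M))) * |cB t K - -cB t K|) atTop (𝓝 (B * 0 * |cB t K - -cB t K|)) := by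
    apply Tendsto.mul_const
    apply Tendsto.const_mul
    refine Real.tendsto_exp_neg_atTop_nhds_zero.comp ?_
    apply Tendsto.const_mul_atTop (by positivity)
    exact tendsto_atTop_add_const_right _ (-M) hj
  rw [mul_zero, zero_mul] at hlim
  refine squeeze_zero_norm' ?_ hlim
  filter_upwards [hj.eventually_ge_atTop (M + 1 + 1 / t.re)] with N hN
  apply intervalIntegral.norm_integral_le_of_norm_le_const
  intro y hy
  rw [Set.uIoc_of_le (by linarith)] at hy
  exact h (j N) y (abs_le.mpr ⟨hy.1.le, hy.2⟩) hN

lemma omega_ne {K : ℕ} {u σ : ℝ} (hK : 0 < K) (hσ : |σ| = 1) (hu : |u| ≤ 1 / 2) (hu' : |u| ≠ 1 / (4 * K)) :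
    Complex.exp (2 * Real.pi * I * u) * Complex.exp (-2 * (σ * (Real.pi / (4 * K)) : ℝ) * I) ≠ 1 := by
  have hK0 : (0 : ℝ) < K := by exact_mod_cast hK
  have hK1 : (1 : ℝ) ≤ K := by exact_mod_cast hK
  rw [← Complex.exp_add, Ne, Complex.exp_eq_one_iff]
  rintro ⟨n, hn⟩
  have h1 : (2 * Real.pi * I * u + -2 * (σ * (Real.pi / (4 * K)) : ℝ) * I : ℂ) = ((2 * Real.pi * (u - σ / (4 * K)) : ℝ) : ℂ) * I := by
    push_cast
    ring
  have h2 : (n * (2 * Real.pi * I) : ℂ) = ((2 * Real.pi * n : ℝ) : ℂ) * I := by push_cast; ring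
  rw [h1, h2] at hn
  have h3 := Complex.ofReal_injective (mul_right_cancel₀ Complex.I_ne_zero hn)
  have h4 : u - σ / (4 * K) = n := mul_left_cancel₀ (by have := Real.pi_pos; positivity) h3
  have h5 : |σ / (4 * K)| = 1 / (4 * K) := by rw [abs_div, hσ, abs_of_pos (by positivity)]
  have h6 : (1 : ℝ) / (4 * K) ≤ 1 / 4 := by
    apply one_div_le_one_div_of_le (by norm_num); linarith
  have h7 : |(n : ℝ)| < 1 := by
    rw [← h4]
    refine (abs_sub _ _).trans_lt ?_
    rw [h5]
    linarith
  have h8 : n = 0 := by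
    have : |n| < 1 := by exact_mod_cast h7
    exact Int.abs_lt_one_iff.mp this
  rw [h8] at h4
  apply hu'
  rw [← h5]
  congr 1
  push_cast at h4
  linarith

theorem lemmaB {K : ℕ} {r : ℤ} {u : ℝ} (hK : 0 < K) (hu : |u| ≤ 1 / 2)
    (hu' : |u| ≠ 1 / (4 * K)) (h0 : u = 0 → ∀ m : ℤ, K * m + r ≠ 0) :
    ∃ C : ℝ, 0 < C ∧ ∀ t : ℂ, 0 < t.re → |t.im| ≤ 5 * t.re → 1 ≤ Real.pi * cB t K → ∀ S : ℂ,
      HasSum (fun m : ℤ => (-1) ^ m * gB t K r u m) S →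
      ‖S + RB' t K r u‖ ≤ C / √t.re * Real.exp (-(Real.pi ^ 2 / (8 * K ^ 2) * (t⁻¹).re)) := by
  obtain ⟨C1, hC1, h1⟩ := hB_line (r := r) hK 1 (by simp) (omega_ne hK (by simp) hu hu')
  obtain ⟨C2, hC2, h2⟩ := hB_line (r := r) hK (-1) (by simp) (omega_ne hK (by simp) hu hu')
  refine ⟨C1 + C2, by positivity, fun t ht hsec hc S hS => ?_⟩
  set E := Real.exp (-(Real.pi ^ 2 / (8 * K ^ 2) * (t⁻¹).re)) with hE
  have hsum : Tendsto (fun N : ℕ => ∑ m ∈ Finset.Icc (-N : ℤ) N, (-1) ^ m * gB t K r u m) atTop (𝓝 S) :=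
    hS.comp Finset.tendsto_Icc_neg
  have v1 := vert_tendsto (r := r) (u := u) hK ht (fun N => (N : ℤ)) (by
    have : Tendsto (fun N : ℕ => (N : ℝ) + 1 / 2) atTop atTop :=
      tendsto_atTop_add_const_right _ _ tendsto_natCast_atTop_atTop
    refine this.congr (fun N => ?_)
    rw [abs_of_nonneg (by push_cast; positivity)]
    push_cast; rfl)
  have v2 := vert_tendsto (r := r) (u := u) hK ht (fun N => -(N : ℤ) - 1) (by
    have : Tendsto (fun N : ℕ => (N : ℝ) + 1 / 2) atTop atTop :=
      tendsto_atTop_add_const_right _ _ tendsto_natCast_atTop_atTop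
    refine this.congr (fun N => ?_)
    rw [abs_of_nonpos (by push_cast; linarith [(Nat.cast_nonneg N : (0:ℝ) ≤ N)])]
    push_cast; ring)
  have hL : Tendsto (fun N : ℕ => 2 * Real.pi * I * (∑ m ∈ Finset.Icc (-N : ℤ) N, (-1) ^ m * gB t K r u m + RB' t K r u)
      - I * (∫ y in (-cB t K)..(cB t K), hB t K r u ((((N : ℤ) : ℝ) + 1 / 2 : ℝ) + y * I))
      + I * (∫ y in (-cB t K)..(cB t K), hB t K r u ((((-(N : ℤ) - 1 : ℤ) : ℝ) + 1 / 2 : ℝ) + y * I))) atTop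
      (𝓝 (2 * Real.pi * I * (S + RB' t K r u) - I * 0 + I * 0)) :=
    (((hsum.add_const _).const_mul _).sub (v1.const_mul I)).add (v2.const_mul I)
  have hle := le_of_tendsto hL.norm (b := (C1 + C2) / √t.re * E) (by
    filter_upwards [eventually_gt_atTop ⌈|(xB t K r u).re|⌉₊] with N hN
    have hN' : |(xB t K r u).re| < N := Nat.lt_of_ceil_lt hN
    have hb := bdry_hB hK ht hu hu' h0 N hN'
    rw [← hb]
    unfold bdry
    have hLpos : (0 : ℝ) ≤ N + 1 / 2 := by positivity
    have a1 := h1 t ht hsec hc (N + 1 / 2) hLpos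
    have a2 := h2 t ht hsec hc (N + 1 / 2) hLpos
    rw [one_mul] at a1
    rw [neg_one_mul] at a2
    have e2 : (((-(N : ℤ) - 1 : ℤ) : ℝ) + 1 / 2 : ℝ) = -((N : ℝ) + 1 / 2) := by push_cast; ring
    have e1 : (((N : ℤ) : ℝ) + 1 / 2 : ℝ) = (N : ℝ) + 1 / 2 := by push_cast; ring
    rw [e1, e2]
    refine le_trans (le_of_eq ?_) ((norm_sub_le _ _).trans ((add_le_add a2 a1).trans (le_of_eq ?_)))
    · congr 1
      ring
    · rw [hE]; ring)
  rw [mul_zero, sub_zero, add_zero, norm_mul] at hle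
  have e3 : ‖(2 * Real.pi * I : ℂ)‖ = 2 * Real.pi := by
    simp [abs_of_pos Real.pi_pos]
  rw [e3] at hle
  have := Real.pi_gt_three
  nlinarith [norm_nonneg (S + RB' t K r u)]

end M2R

namespace M2R
open Filter Topology Set
open Complex (I)

lemma dissect {F : ℤ → ℂ} (hF : Summable F) {K : ℕ} (hK : 0 < K) :
    (∑' n, F n = ∑ r ∈ Finset.range K, ∑' m : ℤ, F (K * m + r)) ∧ ∀ r : ℤ, Summable (fun m : ℤ => F (K * m + r)) := by
  have : NeZero K := ⟨hK.ne'⟩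
  have hinj : ∀ r : ℤ, Function.Injective (fun m : ℤ => (K : ℤ) * m + r) := by
    intro r a b h
    have h2 : (K : ℤ) * a = K * b := by simpa using h
    exact mul_left_cancel₀ (by exact_mod_cast hK.ne') h2
  refine ⟨?_, fun r => hF.comp_injective (hinj r)⟩
  have e := (Int.divModEquiv K).symm
  have hs : Summable (fun p : ℤ × Fin K => F (K * p.1 + (p.2 : ℕ))) := by
    have := (Int.divModEquiv K).symm.summable_iff.mpr hF
    refine this.congr (fun p => ?_)
    simp only [Function.comp, Int.divModEquiv, Equiv.coe_fn_symm_mk]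
    congr 1
    ring
  have h1 : ∑' n, F n = ∑' p : ℤ × Fin K, F (K * p.1 + (p.2 : ℕ)) := by
    rw [← (Int.divModEquiv K).symm.tsum_eq F]
    apply tsum_congr
    intro p
    simp only [Int.divModEquiv, Equiv.coe_fn_symm_mk]
    congr 1
    ring
  rw [h1, ← (Equiv.prodComm (Fin K) ℤ).tsum_eq]
  have hs' : Summable (fun p : Fin K × ℤ => F (K * p.2 + (p.1 : ℕ))) := (Equiv.prodComm (Fin K) ℤ).summable_iff.mpr hs
  have h2 := hs'.tsum_prod
  simp only [Equiv.prodComm_apply, Prod.fst_swap, Prod.snd_swap]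
  rw [h2, tsum_fintype, Finset.sum_range]

/-- point near a root of unity -/
noncomputable def qf (h k : ℕ) (t : ℂ) : ℂ := Complex.exp (2 * Real.pi * I * h / k - t)
/-- multiplier -/
noncomputable def cR (h k : ℕ) (r : ℤ) : ℂ := (-1) ^ r * Complex.exp (2 * Real.pi * I * (h * (2 * r ^ 2 + r)) / k)
noncomputable def vR (h k : ℕ) (r : ℤ) : ℝ := 1 / 5 + 2 * h * r / k
noncomputable def uR (h k : ℕ) (r : ℤ) : ℝ := vR h k r - round (vR h k r)

/-- admissible triples -/
def Good (h k K : ℕ) : Prop := 0 < K ∧ ((k = K ∧ Odd K) ∨ (k = 2 * K ∧ Even K ∧ Odd h))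

lemma exp_int_two_pi (n : ℤ) : Complex.exp (2 * Real.pi * I * n) = 1 := by
  rw [mul_comm]; exact Complex.exp_int_mul_two_pi_mul_I n

lemma exp_int_pi (n : ℤ) : Complex.exp (Real.pi * I * n) = (-1) ^ n := by
  rw [mul_comm, Complex.exp_int_mul, Complex.exp_pi_mul_I]

lemma cR_shift {h k K : ℕ} (hg : Good h k K) (m r : ℤ) : cR h k (K * m + r) = (-1) ^ m * cR h k r := by
  obtain ⟨hK, hg⟩ := hg
  have hKc : (K : ℂ) ≠ 0 := by exact_mod_cast hK.ne'
  have hn1 : (-1 : ℂ) ≠ 0 := by norm_num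
  unfold cR
  rcases hg with ⟨rfl, hodd⟩ | ⟨rfl, hev, hh⟩
  · have e1 : (2 * Real.pi * I * (h * (2 * ((k * m + r : ℤ) : ℂ) ^ 2 + ((k * m + r : ℤ) : ℂ))) / k : ℂ) =
        2 * Real.pi * I * ((h * (2 * k * m ^ 2 + 4 * m * r + m) : ℤ) : ℂ) + 2 * Real.pi * I * (h * (2 * r ^ 2 + r)) / k := by
      push_cast
      field_simp
      ring
    rw [e1, Complex.exp_add, exp_int_two_pi, one_mul, zpow_add₀ hn1, zpow_mul]
    have : ((-1 : ℂ) ^ (k : ℤ)) = -1 := by rw [zpow_natCast]; exact hodd.neg_one_pow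
    rw [this]
    ring
  · have e1 : (2 * Real.pi * I * (h * (2 * ((K * m + r : ℤ) : ℂ) ^ 2 + ((K * m + r : ℤ) : ℂ))) / ((2 * K : ℕ) : ℂ)) =
        Real.pi * I * ((m * (h * (2 * K * m + 4 * r + 1)) : ℤ) : ℂ) + 2 * Real.pi * I * (h * (2 * r ^ 2 + r)) / ((2 * K : ℕ) : ℂ) := by
      push_cast
      field_simp
      ring
    rw [e1, Complex.exp_add, exp_int_pi, zpow_add₀ hn1, zpow_mul, mul_comm m, zpow_mul (-1 : ℂ) (h * _)]
    have h1 : ((-1 : ℂ) ^ (K : ℤ)) = 1 := by rw [zpow_natCast]; exact hev.neg_one_pow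
    have h2 : ((-1 : ℂ) ^ ((h : ℤ) * (2 * K * m + 4 * r + 1))) = -1 := by
      apply Odd.neg_one_zpow
      apply Odd.mul
      · exact_mod_cast hh
      · exact ⟨K * m + 2 * r, by ring⟩
    rw [h1, h2, one_zpow]
    ring

lemma uR_exp {h k K : ℕ} (hg : Good h k K) (m r : ℤ) :
    Complex.exp (2 * Real.pi * I * uR h k r) = zt * Complex.exp (2 * Real.pi * I * (2 * h * ((K * m + r : ℤ) : ℂ)) / k) := by
  obtain ⟨hK, hg⟩ := hg
  have hKc : (K : ℂ) ≠ 0 := by exact_mod_cast hK.ne'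
  have e : ∃ j : ℤ, (2 * Real.pi * I * (2 * h * ((K * m + r : ℤ) : ℂ)) / k : ℂ) = 2 * Real.pi * I * (2 * h * r) / k + 2 * Real.pi * I * j := by
    rcases hg with ⟨rfl, _⟩ | ⟨rfl, _⟩
    · refine ⟨2 * h * m, ?_⟩
      push_cast
      field_simp
      ring
    · refine ⟨h * m, ?_⟩
      push_cast
      field_simp
      ring
  obtain ⟨j, hj⟩ := e
  rw [hj, Complex.exp_add, exp_int_two_pi, mul_one, zt, ← Complex.exp_add]
  unfold uR vR
  rw [show (2 * Real.pi * I * ((1 / 5 + 2 * h * r / k - round (1 / 5 + 2 * h * r / k : ℝ) : ℝ) : ℂ)) =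
    (2 * Real.pi * I / 5 + 2 * Real.pi * I * (2 * h * r) / k) + 2 * Real.pi * I * ((-round (1 / 5 + 2 * h * r / k : ℝ) : ℤ) : ℂ) by push_cast; ring,
    Complex.exp_add, exp_int_two_pi, mul_one]

lemma qf_norm (h k : ℕ) (t : ℂ) : ‖qf h k t‖ = Real.exp (-t.re) := by
  unfold qf
  rw [Complex.norm_exp]
  congr 1
  rw [show (2 * Real.pi * I * h / k : ℂ) = ((2 * Real.pi * h / k : ℝ) : ℂ) * I by push_cast; ring]
  simp

lemma qf_ne (h k : ℕ) (t : ℂ) : qf h k t ≠ 0 := Complex.exp_ne_zero _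

lemma qf_lt {h k : ℕ} {t : ℂ} (ht : 0 < t.re) : ‖qf h k t‖ < 1 := by
  rw [qf_norm, Real.exp_lt_one_iff]; linarith

lemma qf_zpow (h k : ℕ) (t : ℂ) (n : ℤ) : qf h k t ^ n = Complex.exp (2 * Real.pi * I * (h * n) / k - t * n) := by
  unfold qf
  rw [← Complex.exp_int_mul]
  congr 1
  ring

lemma th_qf (h k : ℕ) (t : ℂ) (n : ℤ) : th (qf h k t) n = cR h k n * Complex.exp (-2 * t * n ^ 2 - t * n) := by
  unfold th cR
  rw [qf_zpow, mul_assoc ((-1 : ℂ) ^ n), ← Complex.exp_add]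
  congr 2
  push_cast
  ring

lemma term_qf {h k K : ℕ} (hg : Good h k K) (t : ℂ) (m r : ℤ) :
    th (qf h k t) (K * m + r) / (1 - zt * qf h k t ^ (2 * (K * m + r))) = cR h k r * ((-1) ^ m * gB t K r (uR h k r) m) := by
  rw [th_qf, cR_shift hg, qf_zpow]
  unfold gB DB
  rw [uR_exp hg m r]
  set n : ℤ := K * m + r with hn
  have hnc : (K * (m : ℂ) + r) = (n : ℂ) := by rw [hn]; push_cast; ring
  rw [hnc]
  have a1 : Complex.exp (-2 * t * n ^ 2 - t * n) = Complex.exp (-2 * t * n ^ 2) * Complex.exp (-(t * n)) := by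
    rw [← Complex.exp_add]; ring_nf
  have a2 : (1 - zt * Complex.exp (2 * Real.pi * I * (h * ((2 * n : ℤ) : ℂ)) / k - t * ((2 * n : ℤ) : ℂ))) =
      Complex.exp (-(t * n)) * (Complex.exp (t * n) - zt * Complex.exp (2 * Real.pi * I * (2 * h * n) / k) * Complex.exp (-(t * n))) := by
    have b1 : Complex.exp (2 * Real.pi * I * (h * ((2 * n : ℤ) : ℂ)) / k - t * ((2 * n : ℤ) : ℂ)) =
      Complex.exp (-(t * n)) * Complex.exp (2 * Real.pi * I * (2 * h * n) / k) * Complex.exp (-(t * n)) := by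
      rw [← Complex.exp_add, ← Complex.exp_add]
      congr 1
      push_cast
      ring
    have b2 : Complex.exp (-(t * n)) * Complex.exp (t * n) = 1 := by rw [← Complex.exp_add]; simp
    rw [b1, mul_sub, b2]
    ring
  rw [a1, a2]
  have := Complex.exp_ne_zero (-(t * n))
  rw [show (-1) ^ m * cR h k r * (Complex.exp (-2 * t * n ^ 2) * Complex.exp (-(t * n))) =
    Complex.exp (-(t * n)) * (cR h k r * ((-1) ^ m * Complex.exp (-2 * t * n ^ 2))) by ring, mul_div_mul_left _ _ this]
  ring

lemma uR_abs (h k : ℕ) (r : ℤ) : |uR h k r| ≤ 1 / 2 := abs_sub_round _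

lemma uR_int {h k : ℕ} (hk : 0 < k) (r : ℤ) : ∃ j : ℤ, uR h k r * (5 * k) = k + 10 * h * r - 5 * k * j := by
  have hk0 : (k : ℝ) ≠ 0 := by exact_mod_cast hk.ne'
  refine ⟨round (vR h k r), ?_⟩
  have e : vR h k r * (5 * k) = k + 10 * h * r := by
    unfold vR
    field_simp
    ring
  unfold uR
  linear_combination e

lemma uR_ne {h k K : ℕ} (hg : Good h k K) (r : ℤ) : |uR h k r| ≠ 1 / (4 * K) := by
  obtain ⟨hK, hg⟩ := hg
  have hK0 : (0 : ℝ) < K := by exact_mod_cast hK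
  have hk : 0 < k := by rcases hg with ⟨rfl, _⟩ | ⟨rfl, _⟩ <;> omega
  have hk0 : (0 : ℝ) < k := by exact_mod_cast hk
  obtain ⟨j, hj⟩ := uR_int (h := h) hk r
  intro hu
  have h1 : |(k + 10 * h * r - 5 * k * j : ℝ)| * (4 * K) = 5 * k := by
    rw [← hj, abs_mul, hu, abs_of_pos (by positivity : (0 : ℝ) < 5 * k)]
    field_simp
  have h2 : |(k + 10 * h * r - 5 * k * j : ℤ)| * (4 * K) = 5 * k := by exact_mod_cast h1
  rcases hg with ⟨rfl, _⟩ | ⟨rfl, _⟩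
  · have h3 : |(k + 10 * h * r - 5 * k * j : ℤ)| * 4 = 5 :=
      mul_right_cancel₀ (by exact_mod_cast hK.ne' : (k : ℤ) ≠ 0) (by rw [mul_assoc]; exact h2)
    omega
  · have h3 : |((2 * K : ℕ) + 10 * h * r - 5 * (2 * K : ℕ) * j : ℤ)| * 4 = 10 :=
      mul_right_cancel₀ (by exact_mod_cast hK.ne' : (K : ℤ) ≠ 0) (by rw [mul_assoc, h2]; push_cast; ring)
    omega

lemma uR_zero {h k K : ℕ} (hg : Good h k K) (r : ℤ) (h0 : uR h k r = 0) (m : ℤ) : K * m + r ≠ 0 := by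
  intro hr
  have h1 := uR_exp hg m r
  rw [hr, h0] at h1
  simp at h1
  exact zt_ne_one h1.symm

lemma zt_annul {q : ℂ} (hq : ‖q‖ < 1) : zt ∈ annul q := by
  have : ‖q‖ ^ 2 < 1 := pow_lt_one₀ (norm_nonneg _) hq (by norm_num)
  refine ⟨zt_ne_zero, ?_, ?_⟩
  · rw [norm_inv, zt_norm]; simpa using this
  · rw [zt_norm]; simpa using this

theorem f_near {h k K : ℕ} (hg : Good h k K) : ∃ C : ℝ, 0 < C ∧ ∀ t : ℂ, 0 < t.re → |t.im| ≤ 5 * t.re → 1 ≤ Real.pi * cB t K →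
    ‖fq (qf h k t) zt + ∑ r ∈ Finset.range K, cR h k r * RB' t K r (uR h k r)‖ ≤
      C / √t.re * Real.exp (-(Real.pi ^ 2 / (8 * K ^ 2) * (t⁻¹).re)) := by
  have hB := fun r : ℤ => lemmaB (r := r) hg.1 (uR_abs h k r) (uR_ne hg r) (uR_zero hg r)
  choose C hC hB using hB
  refine ⟨1 + ∑ r ∈ Finset.range K, ‖cR h k r‖ * C r, ?_, fun t ht hsec hc => ?_⟩
  · have : 0 ≤ ∑ r ∈ Finset.range K, ‖cR h k r‖ * C r := Finset.sum_nonneg (fun r _ => mul_nonneg (norm_nonneg _) (hC r).le)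
    linarith
  set E := Real.exp (-(Real.pi ^ 2 / (8 * K ^ 2) * (t⁻¹).re)) with hE
  have hsum := f_summable (qf_lt (h := h) (k := k) ht) (qf_ne h k t) (zt_annul (qf_lt ht))
  obtain ⟨d1, d2⟩ := dissect hsum hg.1
  have hcne : ∀ r, cR h k r ≠ 0 := fun r => mul_ne_zero (zpow_ne_zero _ (by norm_num)) (Complex.exp_ne_zero _)
  have d3 : ∀ r : ℤ, Summable (fun m : ℤ => ((-1) ^ m * gB t K r (uR h k r) m)) := by
    intro r
    have := d2 r
    simp only [term_qf hg] at this
    exact (summable_mul_left_iff (hcne r)).mp this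
  have e : fq (qf h k t) zt = ∑ r ∈ Finset.range K, cR h k r * ∑' m : ℤ, ((-1) ^ m * gB t K r (uR h k r) m) := by
    unfold fq
    rw [d1]
    apply Finset.sum_congr rfl
    intro r _
    simp only [term_qf hg]
    rw [tsum_mul_left]
  rw [e, ← Finset.sum_add_distrib]
  refine (norm_sum_le _ _).trans ?_
  have hpos : 0 ≤ 1 / √t.re * E := by positivity
  calc _ ≤ ∑ r ∈ Finset.range K, (‖cR h k r‖ * C r) * (1 / √t.re * E) := by
        apply Finset.sum_le_sum
        intro r _
        rw [← mul_add, norm_mul, mul_assoc]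
        refine mul_le_mul_of_nonneg_left ((hB r t ht hsec hc _ (d3 r).hasSum).trans (le_of_eq ?_)) (norm_nonneg _)
        rw [hE]; ring
    _ = (∑ r ∈ Finset.range K, ‖cR h k r‖ * C r) * (1 / √t.re * E) := by rw [Finset.sum_mul]
    _ ≤ (1 + ∑ r ∈ Finset.range K, ‖cR h k r‖ * C r) * (1 / √t.re * E) := by gcongr; linarith
    _ = _ := by rw [hE]; ring

end M2R

namespace M2R
open Filter Topology Set
open Complex (I)

/-- sector filter at zero -/
noncomputable def SF : Filter ℂ := 𝓝[{t : ℂ | 0 < t.re ∧ |t.im| ≤ 5 * t.re}] 0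

lemma SF_mem : ∀ᶠ t in SF, 0 < t.re ∧ |t.im| ≤ 5 * t.re := self_mem_nhdsWithin

lemma sec_norm {t : ℂ} (h : 0 < t.re ∧ |t.im| ≤ 5 * t.re) : ‖t‖ ≤ 6 * t.re := by
  have := Complex.norm_le_abs_re_add_abs_im t
  rw [abs_of_pos h.1] at this
  linarith [h.2]

lemma sec_inv {t : ℂ} (h : 0 < t.re ∧ |t.im| ≤ 5 * t.re) : 1 / (36 * t.re) ≤ (t⁻¹).re := by
  rw [Complex.inv_re, ← Complex.sq_norm]
  have h1 := sec_norm h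
  have h2 : 0 < ‖t‖ := norm_pos_iff.mpr (fun h' => by rw [h'] at h; simp at h)
  rw [div_le_div_iff₀ (by linarith [h.1]) (by positivity)]
  nlinarith [h.1]

lemma SF_re : Tendsto (fun t : ℂ => t.re) SF (𝓝[>] 0) := by
  rw [tendsto_nhdsWithin_iff]
  refine ⟨?_, SF_mem.mono (fun t h => h.1)⟩
  have : Tendsto (fun t : ℂ => t.re) (𝓝 0) (𝓝 (0 : ℂ).re) := Complex.continuous_re.tendsto 0
  exact this.mono_left nhdsWithin_le_nhds

lemma SF_inv : Tendsto (fun t : ℂ => (t⁻¹).re) SF atTop := by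
  have h1 : Tendsto (fun t : ℂ => 1 / (36 * t.re)) SF atTop := by
    have := (tendsto_inv_nhdsGT_zero (𝕜 := ℝ)).comp SF_re
    have h2 := this.const_mul_atTop (by norm_num : (0 : ℝ) < 1 / 36)
    refine h2.congr (fun t => ?_)
    simp only [Function.comp]
    rw [one_div, one_div, mul_inv]
  exact tendsto_atTop_mono' _ (SF_mem.mono fun t h => sec_inv h) h1

lemma SF_zero : Tendsto (fun t : ℂ => t) SF (𝓝 0) := tendsto_id.mono_left nhdsWithin_le_nhds

lemma pois_aux (β : ℝ) (c : ℝ) (hc : 0 < c) : Tendsto (fun t : ℂ => ∑' n : ℤ, Complex.exp (-(c * (n * (n - 1))) * t⁻¹ + 2 * Real.pi * I * β * (n - 1 / 2))) SF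
    (𝓝 (2 * Real.cos (Real.pi * β))) := by
  have hlim : ∀ n : ℤ, Tendsto (fun t : ℂ => Complex.exp (-(c * (n * (n - 1))) * t⁻¹ + 2 * Real.pi * I * β * (n - 1 / 2))) SF
      (𝓝 (if n = 0 ∨ n = 1 then Complex.exp (2 * Real.pi * I * β * (n - 1 / 2)) else 0)) := by
    intro n
    split_ifs with h
    · have : ((n : ℂ) * (n - 1)) = 0 := by
        rcases h with h | h <;> simp [h]
      rw [this]
      simp only [mul_zero, neg_zero, zero_mul, zero_add]
      exact tendsto_const_nhds
    · have hn : (0 : ℝ) < n * (n - 1) := by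
        push Not at h
        have : 0 < n * (n - 1) := by
          rcases lt_or_ge n 0 with h1 | h1
          · nlinarith
          · have : 2 ≤ n := by omega
            nlinarith
        exact_mod_cast this
      rw [tendsto_zero_iff_norm_tendsto_zero]
      simp_rw [Complex.norm_exp]
      refine (Real.tendsto_exp_neg_atTop_nhds_zero.comp (SF_inv.const_mul_atTop (mul_pos hc hn))).congr (fun t => ?_)
      simp only [Function.comp]
      congr 1
      rw [show (-(c * (n * (n - 1))) * t⁻¹ + 2 * Real.pi * I * β * (n - 1 / 2) : ℂ) = ((-(c * (n * (n - 1))) : ℝ) : ℂ) * t⁻¹ + ((2 * Real.pi * β * (n - 1 / 2) : ℝ) : ℂ) * I by push_cast; ring]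
      rw [Complex.add_re, Complex.re_ofReal_mul]
      simp
  have hb : Summable (fun n : ℤ => Real.exp (-(n.natAbs : ℝ)) * Real.exp 1) := by
    apply Summable.mul_right
    have := summable_natAbs (r := Real.exp (-1)) (Real.exp_nonneg _) (by rw [Real.exp_lt_one_iff]; norm_num)
    refine this.congr (fun n => ?_)
    rw [← Real.exp_nat_mul]
    congr 1
    ring
  have key := tendsto_tsum_of_dominated_convergence hb hlim (by
    filter_upwards [SF_inv.eventually_ge_atTop (1 / c)] with t ht n
    rw [Complex.norm_exp, ← Real.exp_add]
    apply Real.exp_le_exp.mpr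
    rw [show (-(c * (n * (n - 1))) * t⁻¹ + 2 * Real.pi * I * β * (n - 1 / 2) : ℂ) = ((-(c * (n * (n - 1))) : ℝ) : ℂ) * t⁻¹ + ((2 * Real.pi * β * (n - 1 / 2) : ℝ) : ℂ) * I by push_cast; ring]
    rw [Complex.add_re, Complex.re_ofReal_mul]
    simp only [Complex.mul_re, Complex.ofReal_re, Complex.ofReal_im, Complex.I_re, Complex.I_im, mul_zero, zero_mul, sub_zero, add_zero]
    have h1 : (0 : ℝ) ≤ n * (n - 1) := by
      have : 0 ≤ n * (n - 1) := by
        rcases lt_or_ge n 1 with h1 | h1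
        · nlinarith
        · nlinarith
      exact_mod_cast this
    have h2 : (n.natAbs : ℝ) ≤ n * (n - 1) + 1 := by
      have : |n| ≤ n * (n - 1) + 1 := by
        rw [abs_le]
        constructor <;> nlinarith [sq_nonneg n, sq_nonneg (n - 1)]
      rw [Nat.cast_natAbs]
      exact_mod_cast this
    have h3 : 1 ≤ c * (t⁻¹).re := by
      rw [div_le_iff₀ hc] at ht
      linarith
    nlinarith)
  have e : ∑' n : ℤ, (if n = 0 ∨ n = 1 then Complex.exp (2 * Real.pi * I * β * (n - 1 / 2)) else 0) = 2 * Real.cos (Real.pi * β) := by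
    rw [tsum_eq_sum (s := {0, 1})]
    · rw [Finset.sum_pair (by norm_num)]
      simp only [true_or, or_true, if_true]
      push_cast
      rw [Complex.cos]
      rw [show (2 * Real.pi * I * β * (0 - 1 / 2) : ℂ) = -(Real.pi * β) * I by ring, show (2 * Real.pi * I * β * (1 - 1 / 2) : ℂ) = (Real.pi * β) * I by ring]
      ring
    · intro n hn
      simp only [Finset.mem_insert, Finset.mem_singleton] at hn
      rw [if_neg hn]
  rw [e] at key
  exact key

lemma cpow_half_mul {c : ℝ} (hc : 0 < c) (t : ℂ) (ht : t ≠ 0) : ((c : ℂ) * t) ^ (1 / 2 : ℂ) = (√c : ℝ) * t ^ (1 / 2 : ℂ) := by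
  have hcc : (c : ℂ) ≠ 0 := by exact_mod_cast hc.ne'
  rw [Complex.cpow_def_of_ne_zero (mul_ne_zero hcc ht), Complex.cpow_def_of_ne_zero ht, Complex.log_ofReal_mul hc ht, add_mul,
    Complex.exp_add]
  congr 1
  rw [Real.sqrt_eq_rpow, Complex.ofReal_cpow hc.le, Complex.cpow_def_of_ne_zero hcc, Complex.ofReal_log hc.le]
  norm_num

lemma theta_part {K : ℕ} (hK : 0 < K) (r : ℤ) {t : ℂ} (ht : 0 < t.re) :
    ∑' m : ℤ, (-1) ^ m * Complex.exp (-2 * t * (K * m + r) ^ 2 - t * (K * m + r)) =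
    Complex.exp (t / 8) * (1 / ((√(2 * K ^ 2 / Real.pi) : ℝ) * t ^ (1 / 2 : ℂ))) * Complex.exp (-(Real.pi ^ 2 / (8 * K ^ 2)) * t⁻¹) *
      ∑' n : ℤ, Complex.exp (-((Real.pi ^ 2 / (2 * K ^ 2) : ℝ) * (n * (n - 1))) * t⁻¹ + 2 * Real.pi * I * ((4 * r + 1) / (4 * K) : ℝ) * (n - 1 / 2)) := by
  have hK0 : (0 : ℝ) < K := by exact_mod_cast hK
  have hKc : (K : ℂ) ≠ 0 := by exact_mod_cast hK.ne'
  have ht0 : t ≠ 0 := fun h => by rw [h] at ht; simp at ht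
  have hpi := Real.pi_pos
  have hpc : (Real.pi : ℂ) ≠ 0 := by exact_mod_cast hpi.ne'
  set a : ℂ := ((2 * K ^ 2 / Real.pi : ℝ) : ℂ) * t with ha
  set β : ℝ := (4 * r + 1) / (4 * K) with hβ
  have hβc : (β : ℂ) = (4 * r + 1) / (4 * K) := by rw [hβ]; push_cast; ring
  have hare : 0 < a.re := by rw [ha, Complex.re_ofReal_mul]; positivity
  have hac : a = 2 * K ^ 2 * t / Real.pi := by rw [ha]; push_cast; ring
  have ha0 : a ≠ 0 := fun h => by rw [h] at hare; simp at hare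
  have hP := Complex.tsum_exp_neg_quadratic hare (I / 2 - a * β)
  have e1 : ∀ m : ℤ, (-1) ^ m * Complex.exp (-2 * t * (K * m + r) ^ 2 - t * (K * m + r)) =
      Complex.exp (t / 8 - Real.pi * a * β ^ 2) * Complex.exp (-Real.pi * a * m ^ 2 + 2 * Real.pi * (I / 2 - a * β) * m) := by
    intro m
    rw [← exp_int_pi, ← Complex.exp_add, ← Complex.exp_add]
    congr 1
    rw [hac, hβc]
    field_simp
    ring
  have e2 : ∀ n : ℤ, Complex.exp (-Real.pi / a * (n + I * (I / 2 - a * β)) ^ 2) =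
      Complex.exp (Real.pi * a * β ^ 2) * Complex.exp (-(Real.pi ^ 2 / (8 * K ^ 2)) * t⁻¹) *
      Complex.exp (-((Real.pi ^ 2 / (2 * K ^ 2) : ℝ) * (n * (n - 1))) * t⁻¹ + 2 * Real.pi * I * β * (n - 1 / 2)) := by
    intro n
    rw [← Complex.exp_add, ← Complex.exp_add]
    congr 1
    have b1 : (-(Real.pi ^ 2 / (8 * K ^ 2)) * t⁻¹ : ℂ) = -(Real.pi / (4 * a)) := by
      rw [hac]; field_simp; norm_num
    have b2 : (-((Real.pi ^ 2 / (2 * K ^ 2) : ℝ) * (n * (n - 1))) * t⁻¹ : ℂ) = -(Real.pi / a * (n * (n - 1))) := by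
      rw [hac]; push_cast; field_simp
    rw [b1, b2]
    have b3 : (n + I * (I / 2 - a * β)) = ((n : ℂ) - 1 / 2) - I * (a * β) := by
      linear_combination (1 / 2) * Complex.I_sq
    rw [b3]
    field_simp
    ring_nf
    rw [Complex.I_sq]
    ring
  rw [tsum_congr e1, tsum_mul_left, hP, tsum_congr e2, tsum_mul_left, ← cpow_half_mul (by positivity) t ht0, ← ha]
  have e3 : Complex.exp (t / 8 - Real.pi * a * β ^ 2) * Complex.exp (Real.pi * a * β ^ 2) = Complex.exp (t / 8) := by
    rw [← Complex.exp_add]; congr 1; ring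
  rw [← e3]
  ring

/-- theta limit constant -/
noncomputable def Gm (h K : ℕ) : ℂ := ∑ r ∈ Finset.range K, cR h K r * (1 / (√(2 * K ^ 2 / Real.pi) : ℝ) * (2 * Real.cos (Real.pi * ((4 * r + 1) / (4 * K)))))

theorem theta_lim {h K : ℕ} (hK : Odd K) :
    Tendsto (fun t : ℂ => t ^ (1 / 2 : ℂ) * Complex.exp ((Real.pi ^ 2 / (8 * K ^ 2)) * t⁻¹) * theta (qf h K t)) SF (𝓝 (Gm h K)) := by
  have hg : Good h K K := ⟨hK.pos, Or.inl ⟨rfl, hK⟩⟩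
  have hK0 : (0 : ℝ) < K := by exact_mod_cast hK.pos
  have hpi := Real.pi_pos
  have hp : ∀ r : ℕ, Tendsto (fun t : ℂ => cR h K r * (Complex.exp (t / 8) * (1 / (√(2 * K ^ 2 / Real.pi) : ℝ) *
      ∑' n : ℤ, Complex.exp (-((Real.pi ^ 2 / (2 * K ^ 2) : ℝ) * (n * (n - 1))) * t⁻¹ + 2 * Real.pi * I * ((4 * (r : ℤ) + 1) / (4 * K) : ℝ) * (n - 1 / 2))))) SF
      (𝓝 (cR h K r * (Complex.exp (0 / 8) * (1 / (√(2 * K ^ 2 / Real.pi) : ℝ) * (2 * Real.cos (Real.pi * ((4 * (r : ℤ) + 1) / (4 * K)))))))) := by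
    intro r
    apply Tendsto.const_mul
    apply Tendsto.mul
    · exact (Complex.continuous_exp.tendsto _).comp (SF_zero.div_const 8)
    · apply Tendsto.const_mul
      exact pois_aux _ _ (by positivity)
  have hsum := tendsto_finsetSum (Finset.range K) (fun r _ => hp r)
  have e0 : ∑ r ∈ Finset.range K, (cR h K r * (Complex.exp (0 / 8) * (1 / (√(2 * K ^ 2 / Real.pi) : ℝ) * (2 * Real.cos (Real.pi * ((4 * (r : ℤ) + 1) / (4 * K)))) : ℂ))) = Gm h K := by
    unfold Gm
    simp
  rw [e0] at hsum
  refine hsum.congr' ?_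
  filter_upwards [SF_mem] with t ht
  have ht0 : t ≠ 0 := fun h => by rw [h] at ht; simp at ht
  obtain ⟨d1, d2⟩ := dissect (th_summable (qf_lt (h := h) (k := K) ht.1)) hg.1
  unfold theta
  rw [d1, Finset.mul_sum]
  apply Finset.sum_congr rfl
  intro r _
  have e1 : ∀ m : ℤ, th (qf h K t) (K * m + r) = cR h K r * ((-1) ^ m * Complex.exp (-2 * t * (K * m + (r : ℤ)) ^ 2 - t * (K * m + (r : ℤ)))) := by
    intro m
    rw [th_qf, cR_shift hg]
    push_cast
    ring
  rw [tsum_congr e1, tsum_mul_left, theta_part hg.1 r ht.1]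
  have hs : t ^ (1 / 2 : ℂ) ≠ 0 := by
    rw [Complex.cpow_def_of_ne_zero ht0]; exact Complex.exp_ne_zero _
  have e2 : Complex.exp ((Real.pi ^ 2 / (8 * K ^ 2)) * t⁻¹) * Complex.exp (-(Real.pi ^ 2 / (8 * K ^ 2)) * t⁻¹) = 1 := by
    rw [← Complex.exp_add]; ring_nf; exact Complex.exp_zero
  generalize (∑' n : ℤ, Complex.exp (-((Real.pi ^ 2 / (2 * K ^ 2) : ℝ) * (n * (n - 1))) * t⁻¹ + 2 * Real.pi * I * ((4 * (r : ℤ) + 1) / (4 * K) : ℝ) * (n - 1 / 2))) = T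
  have hsq : ((√(2 * K ^ 2 / Real.pi) : ℝ) : ℂ) ≠ 0 := by
    have : 0 < √(2 * (K : ℝ) ^ 2 / Real.pi) := Real.sqrt_pos.mpr (by positivity)
    exact_mod_cast this.ne'
  generalize hE1 : Complex.exp ((Real.pi ^ 2 / (8 * K ^ 2)) * t⁻¹) = E1 at *
  generalize hE2 : Complex.exp (-(Real.pi ^ 2 / (8 * K ^ 2)) * t⁻¹) = E2 at *
  field_simp
  linear_combination (-(cR h K r * T)) * e2

end M2R

namespace M2R
open Filter Topology Set
open Complex (I)

lemma SF_cB {K : ℕ} (hK : 0 < K) : ∀ᶠ t in SF, 1 ≤ Real.pi * cB t K := by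
  have hK0 : (0 : ℝ) < K := by exact_mod_cast hK
  have hpi := Real.pi_pos
  have : Tendsto (fun t => Real.pi ^ 2 / (4 * K ^ 2) * (t⁻¹).re) SF atTop := SF_inv.const_mul_atTop (by positivity)
  filter_upwards [this.eventually_ge_atTop 1] with t ht
  refine ht.trans (le_of_eq ?_)
  unfold cB
  ring

lemma err_tendsto {E : ℂ → ℂ} {C κ : ℝ} (w : ℂ → ℂ) (hw : ∀ᶠ t in SF, ‖w t‖ ≤ Real.exp (κ * (t⁻¹).re))
    (h : ∀ᶠ t in SF, ‖E t‖ ≤ C / √t.re * Real.exp (-(κ * (t⁻¹).re))) : Tendsto (fun t => t * w t * E t) SF (𝓝 0) := by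
  have hlim : Tendsto (fun t : ℂ => 6 * |C| * √t.re) SF (𝓝 0) := by
    have h1 : Tendsto (fun t : ℂ => √t.re) SF (𝓝 (√0)) := (Real.continuous_sqrt.tendsto 0).comp (SF_re.mono_right nhdsWithin_le_nhds)
    have := h1.const_mul (6 * |C|)
    simpa using this
  refine squeeze_zero_norm' ?_ hlim
  filter_upwards [h, SF_mem, hw] with t h1 h2 hw
  rw [norm_mul, norm_mul]
  have h3 := sec_norm h2
  have h4 : 0 < √t.re := Real.sqrt_pos.mpr h2.1
  have h5 : √t.re * √t.re = t.re := Real.mul_self_sqrt h2.1.le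
  calc ‖t‖ * ‖w t‖ * ‖E t‖ ≤ (6 * t.re) * Real.exp (κ * (t⁻¹).re) * (|C| / √t.re * Real.exp (-(κ * (t⁻¹).re))) := by
        have h0 := h2.1.le
        have h6 : ‖E t‖ ≤ |C| / √t.re * Real.exp (-(κ * (t⁻¹).re)) := by
          refine h1.trans ?_
          gcongr
          exact le_abs_self C
        gcongr
    _ = 6 * |C| * (t.re / √t.re) * (Real.exp (κ * (t⁻¹).re) * Real.exp (-(κ * (t⁻¹).re))) := by ring
    _ = 6 * |C| * √t.re := by
        rw [← Real.exp_add, add_neg_cancel, Real.exp_zero, mul_one]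
        congr 1
        rw [div_eq_iff h4.ne', h5]

lemma norm_exp_real_inv (κ : ℝ) (t : ℂ) : ‖Complex.exp (κ * t⁻¹)‖ = Real.exp (κ * (t⁻¹).re) := by
  rw [Complex.norm_exp, Complex.re_ofReal_mul]

theorem f_lim0 : Tendsto (fun t : ℂ => t * Complex.exp ((3 * Real.pi ^ 2 / 25 : ℝ) * t⁻¹) * fq (qf 0 1 t) zt) SF
    (𝓝 (-(Real.pi / (Complex.exp (Real.pi * I * (1 / 5 : ℝ)) * I)))) := by
  have hpi := Real.pi_pos
  have hg : Good 0 1 1 := ⟨one_pos, Or.inl ⟨rfl, odd_one⟩⟩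
  obtain ⟨C, hC, hf⟩ := f_near hg
  have hu : uR 0 1 0 = 1 / 5 := by
    unfold uR vR
    have : round (1 / 5 + 2 * ((0 : ℕ) : ℝ) * ((0 : ℤ) : ℝ) / ((1 : ℕ) : ℝ)) = 0 := by
      rw [round_eq_zero_iff]
      norm_num
    rw [this]
    norm_num
  have hc : cR 0 1 0 = 1 := by unfold cR; simp
  have hR : ∀ t : ℂ, RB' t 1 0 (1 / 5) = RB t 1 0 (1 / 5) := by
    intro t
    unfold RB'
    rw [if_pos]
    rw [abs_of_pos (by norm_num)]
    norm_num
  have hf' : ∀ᶠ t in SF, ‖fq (qf 0 1 t) zt + RB t 1 0 (1 / 5)‖ ≤ C / √t.re * Real.exp (-(Real.pi ^ 2 / 8 * (t⁻¹).re)) := by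
    filter_upwards [SF_mem, SF_cB one_pos] with t h1 h2
    have := hf t h1.1 h1.2 h2
    simp only [Finset.range_one, Finset.sum_singleton, Nat.cast_zero, hu, hc, one_mul, hR, Nat.cast_one, one_pow, mul_one] at this
    exact this
  have herr := err_tendsto (E := fun t => fq (qf 0 1 t) zt + RB t 1 0 (1 / 5)) (fun t => Complex.exp ((3 * Real.pi ^ 2 / 25 : ℝ) * t⁻¹))
    (by filter_upwards [SF_mem] with t ht
        rw [norm_exp_real_inv]
        apply Real.exp_le_exp.mpr
        apply mul_le_mul_of_nonneg_right _ (inv_re_pos ht.1).le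
        nlinarith [sq_nonneg Real.pi]) hf'
  have hmain : Tendsto (fun t : ℂ => Real.pi / (Complex.exp (Real.pi * I * (1 / 5 : ℝ)) * (I * (1 - Complex.exp ((-(2 * Real.pi ^ 2 / 5) : ℝ) * t⁻¹))))) SF
      (𝓝 (Real.pi / (Complex.exp (Real.pi * I * (1 / 5 : ℝ)) * (I * (1 - 0))))) := by
    apply Tendsto.div tendsto_const_nhds
    · apply Tendsto.const_mul
      apply Tendsto.const_mul
      apply Tendsto.const_sub
      rw [tendsto_zero_iff_norm_tendsto_zero]
      simp_rw [norm_exp_real_inv]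
      refine (Real.tendsto_exp_neg_atTop_nhds_zero.comp (SF_inv.const_mul_atTop (by positivity : 0 < 2 * Real.pi ^ 2 / 5))).congr (fun t => ?_)
      simp only [Function.comp]
      congr 1
      ring
    · simp [Complex.exp_ne_zero]
  have := herr.sub hmain
  rw [sub_zero, mul_one, zero_sub] at this
  refine this.congr' ?_
  filter_upwards [SF_mem] with t ht
  have ht0 : t ≠ 0 := fun h => by rw [h] at ht; simp at ht
  have key : Real.pi / (Complex.exp (Real.pi * I * (1 / 5 : ℝ)) * (I * (1 - Complex.exp ((-(2 * Real.pi ^ 2 / 5) : ℝ) * t⁻¹)))) =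
      t * Complex.exp ((3 * Real.pi ^ 2 / 25 : ℝ) * t⁻¹) * RB t 1 0 (1 / 5) := by
    unfold RB xB
    have e1 : Complex.sin (Real.pi * ((Real.pi * I * (1 / 5 : ℝ) / t - (0 : ℤ)) / (1 : ℕ))) =
        Complex.exp ((Real.pi ^ 2 / 5 : ℝ) * t⁻¹) * (I * (1 - Complex.exp ((-(2 * Real.pi ^ 2 / 5) : ℝ) * t⁻¹)) / 2) := by
      rw [show (Real.pi * ((Real.pi * I * (1 / 5 : ℝ) / t - (0 : ℤ)) / (1 : ℕ)) : ℂ) = (((Real.pi ^ 2 / 5 : ℝ) : ℂ) * t⁻¹) * I by push_cast; ring]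
      rw [Complex.sin_mul_I, Complex.sinh]
      have : Complex.exp (-(((Real.pi ^ 2 / 5 : ℝ) : ℂ) * t⁻¹)) = Complex.exp (((Real.pi ^ 2 / 5 : ℝ) : ℂ) * t⁻¹) * Complex.exp ((-(2 * Real.pi ^ 2 / 5) : ℝ) * t⁻¹) := by
        rw [← Complex.exp_add]; congr 1; push_cast; ring
      rw [this]
      ring
    rw [e1]
    have e2 : Complex.exp ((3 * Real.pi ^ 2 / 25 : ℝ) * t⁻¹) * Complex.exp (2 * Real.pi ^ 2 * (1 / 5 : ℝ) ^ 2 / t) = Complex.exp ((Real.pi ^ 2 / 5 : ℝ) * t⁻¹) := by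
      rw [← Complex.exp_add]; congr 1; push_cast; ring
    have e3 := Complex.exp_ne_zero ((Real.pi ^ 2 / 5 : ℝ) * t⁻¹)
    have e4 := Complex.exp_ne_zero (Real.pi * I * (1 / 5 : ℝ))
    have e5 : (1 - Complex.exp ((-(2 * Real.pi ^ 2 / 5) : ℝ) * t⁻¹)) ≠ 0 := by
      intro h
      have h1 : ‖Complex.exp ((-(2 * Real.pi ^ 2 / 5) : ℝ) * t⁻¹)‖ = 1 := by rw [← sub_eq_zero.mp h]; simp
      rw [norm_exp_real_inv, Real.exp_eq_one_iff] at h1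
      have := inv_re_pos ht.1
      have h2 : 0 < 2 * Real.pi ^ 2 / 5 * (t⁻¹).re := by positivity
      linarith
    rw [← e2] at e3 ⊢
    obtain ⟨e6, e7⟩ := mul_ne_zero_iff.mp e3
    generalize Complex.exp ((3 * Real.pi ^ 2 / 25 : ℝ) * t⁻¹) = E1 at *
    generalize Complex.exp (2 * Real.pi ^ 2 * (1 / 5 : ℝ) ^ 2 / t) = E2 at *
    generalize (1 - Complex.exp ((-(2 * Real.pi ^ 2 / 5) : ℝ) * t⁻¹)) = E3 at *
    generalize Complex.exp (Real.pi * I * (1 / 5 : ℝ)) = E4 at *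
    have hI := Complex.I_ne_zero
    push_cast
    field_simp
  rw [key]
  ring

theorem f_lim5 {h r0 : ℕ} (hh : h < 5) (hr0 : r0 < 5) (h5 : h * r0 % 5 = 2) : Tendsto (fun t : ℂ => t * fq (qf h 5 t) zt) SF
    (𝓝 (cR h 5 r0 * (Real.pi / (10 * Real.sin (Real.pi * r0 / 5) : ℝ)))) := by
  have hpi := Real.pi_pos
  have hg : Good h 5 5 := ⟨by norm_num, Or.inl ⟨rfl, by decide⟩⟩
  obtain ⟨C, hC, hf⟩ := f_near hg
  have hcomb : ∀ h < 5, ∀ r0 < 5, ∀ r < 5, h * r0 % 5 = 2 → (1 + 2 * h * r) % 5 = 0 → r = r0 := by decide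
  have hcomb2 : ∀ h < 5, ∀ r0 < 5, h * r0 % 5 = 2 → (1 + 2 * h * r0) % 5 = 0 := by decide
  have hRne : ∀ t : ℂ, ∀ r ∈ Finset.range 5, r ≠ r0 → cR h 5 r * RB' t 5 r (uR h 5 r) = 0 := by
    intro t r hr hne
    rw [Finset.mem_range] at hr
    unfold RB'
    rw [if_neg, mul_zero]
    intro hlt
    apply hne
    apply hcomb h hh r0 hr0 r hr h5
    obtain ⟨j, hj⟩ := uR_int (h := h) (k := 5) (by norm_num) r
    have h1 : |(1 + 2 * h * r - 5 * j : ℝ)| < 1 := by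
      have e : uR h 5 r * 5 = 1 + 2 * h * r - 5 * j := by push_cast at hj ⊢; linarith
      rw [← e, abs_mul, abs_of_pos (by norm_num : (0 : ℝ) < 5)]
      norm_num at hlt ⊢
      linarith
    have h2 : |(1 + 2 * h * r - 5 * j : ℤ)| < 1 := by exact_mod_cast h1
    have h3 := Int.abs_lt_one_iff.mp h2
    have h4 : ((1 + 2 * h * r : ℕ) : ℤ) = 5 * j := by push_cast; linarith
    omega
  have hu0 : uR h 5 r0 = 0 := by
    obtain ⟨j, hj⟩ := Nat.dvd_of_mod_eq_zero (hcomb2 h hh r0 hr0 h5)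
    have e : vR h 5 r0 = (j : ℤ) := by
      have : (1 + 2 * h * r0 : ℝ) = 5 * j := by exact_mod_cast hj
      unfold vR
      push_cast
      linarith
    unfold uR
    rw [e, round_intCast, sub_self]
  have hRB : ∀ t : ℂ, t ≠ 0 → t * (cR h 5 r0 * RB' t 5 r0 (uR h 5 r0)) = -(cR h 5 r0 * (Real.pi / (10 * Real.sin (Real.pi * r0 / 5) : ℝ))) := by
    intro t ht
    unfold RB'
    rw [hu0, if_pos (by norm_num)]
    unfold RB xB
    rw [show (Real.pi * ((Real.pi * I * (0 : ℝ) / t - (r0 : ℤ)) / (5 : ℕ)) : ℂ) = -((Real.pi * r0 / 5 : ℝ) : ℂ) by push_cast; ring, Complex.sin_neg, ← Complex.ofReal_sin]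
    push_cast
    simp only [mul_zero, ne_eq, OfNat.ofNat_ne_zero, not_false_eq_true, zero_pow, zero_div, Complex.exp_zero, mul_one]
    by_cases hs : Complex.sin (Real.pi * r0 / 5) = 0
    · rw [hs]; simp
    · field_simp
      ring
  have hf' : ∀ᶠ t in SF, ‖fq (qf h 5 t) zt + cR h 5 r0 * RB' t 5 r0 (uR h 5 r0)‖ ≤ C / √t.re * Real.exp (-(Real.pi ^ 2 / (8 * (5 : ℕ) ^ 2) * (t⁻¹).re)) := by
    filter_upwards [SF_mem, SF_cB (K := 5) (by norm_num)] with t h1 h2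
    have := hf t h1.1 h1.2 h2
    rw [Finset.sum_eq_single_of_mem r0 (Finset.mem_range.mpr hr0) (hRne t)] at this
    exact this
  have herr := err_tendsto (E := fun t => fq (qf h 5 t) zt + cR h 5 r0 * RB' t 5 r0 (uR h 5 r0)) (fun t => 1)
    (by filter_upwards [SF_mem] with t ht
        rw [norm_one]
        apply Real.one_le_exp
        have := (inv_re_pos ht.1).le
        positivity) hf'
  have := herr.add_const (cR h 5 r0 * (Real.pi / (10 * Real.sin (Real.pi * r0 / 5) : ℝ)))
  rw [zero_add] at this
  refine this.congr' ?_
  filter_upwards [SF_mem] with t ht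
  have ht0 : t ≠ 0 := fun h => by rw [h] at ht; simp at ht
  have := hRB t ht0
  linear_combination this

theorem f_near_bound {h k K : ℕ} (hg : Good h k K) (hK2 : 2 ≤ K) (h5 : ¬ 5 ∣ K) : ∃ C : ℝ, 0 < C ∧ ∀ t : ℂ, 0 < t.re → t.re ≤ 1 → |t.im| ≤ 5 * t.re →
    1 ≤ Real.pi ^ 2 / (5 * K ^ 2) * (t⁻¹).re → ‖fq (qf h k t) zt‖ ≤ C / t.re * Real.exp (Real.pi ^ 2 * (t⁻¹).re * (-1 / (8 * K ^ 2) + 1 / 800)) := by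
  have hpi := Real.pi_pos
  have hK := hg.1
  have hK0 : (0 : ℝ) < K := by exact_mod_cast hK
  have hK2' : (2 : ℝ) ≤ K := by exact_mod_cast hK2
  obtain ⟨C, hC, hf⟩ := f_near hg
  refine ⟨C + ∑ r ∈ Finset.range K, ‖cR h k r‖ * (2 * Real.pi), ?_, fun t ht ht1 hsec hρ1 => ?_⟩
  · have : 0 ≤ ∑ r ∈ Finset.range K, ‖cR h k r‖ * (2 * Real.pi) := Finset.sum_nonneg (fun r _ => by positivity)
    linarith
  have hρ := inv_re_pos ht
  have ht0 : t ≠ 0 := fun h => by rw [h] at ht; simp at ht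
  set ρ := (t⁻¹).re with hρd
  set E := Real.exp (Real.pi ^ 2 * ρ * (-1 / (8 * K ^ 2) + 1 / 800)) with hE
  have hc : 1 ≤ Real.pi * cB t K := by
    refine hρ1.trans ?_
    unfold cB
    rw [← hρd, show Real.pi * (Real.pi * ρ / (4 * K ^ 2)) = Real.pi ^ 2 / (4 * K ^ 2) * ρ by ring]
    gcongr
    norm_num
  have hR : ∀ r : ℤ, ‖RB' t K r (uR h k r)‖ ≤ 2 * Real.pi / t.re * E := by
    intro r
    unfold RB'
    split_ifs with hlt
    swap
    · rw [norm_zero]; positivity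
    set u := uR h k r with hu
    have hu5 : 1 / (5 * K) ≤ |u| := by
      have hk : 0 < k := by obtain ⟨_, hg⟩ := hg; rcases hg with ⟨rfl, _⟩ | ⟨rfl, _⟩ <;> omega
      obtain ⟨j, hj⟩ := uR_int (h := h) hk r
      have hz : ∃ i : ℤ, u * (5 * K) = i ∧ i ≠ 0 := by
        obtain ⟨_, hg⟩ := hg
        rcases hg with ⟨rfl, _⟩ | ⟨rfl, _⟩
        · refine ⟨k + 10 * h * r - 5 * k * j, ?_, ?_⟩
          · rw [hu]; push_cast; exact hj
          · intro h0
            apply h5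
            have : (5 : ℤ) ∣ k := ⟨k * j - 2 * h * r, by linarith⟩
            exact_mod_cast this
        · refine ⟨K + 5 * h * r - 5 * K * j, ?_, ?_⟩
          · rw [hu]; push_cast at hj ⊢; linarith
          · intro h0
            apply h5
            have : (5 : ℤ) ∣ K := ⟨K * j - h * r, by linarith⟩
            exact_mod_cast this
      obtain ⟨i, hi, hi0⟩ := hz
      have h1 : (1 : ℝ) ≤ |(i : ℝ)| := by exact_mod_cast Int.one_le_abs hi0
      rw [← hi, abs_mul, abs_of_pos (by positivity : (0 : ℝ) < 5 * K)] at h1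
      rw [div_le_iff₀ (by positivity)]
      exact h1
    have hsin : Real.exp (Real.pi ^ 2 * |u| * ρ / K) / 4 ≤ ‖Complex.sin (Real.pi * xB t K r u)‖ := by
      have e : (Real.pi * xB t K r u : ℂ) = ((Real.pi * (xB t K r u).re : ℝ) : ℂ) + ((Real.pi * (xB t K r u).im : ℝ) : ℂ) * I := by
        push_cast
        rw [mul_assoc, ← mul_add, Complex.re_add_im]
      rw [e]
      refine le_trans ?_ (sin_lower _ _)
      have e2 : |Real.pi * (xB t K r u).im| = Real.pi ^ 2 * |u| * ρ / K := by
        rw [xB_im, abs_mul, abs_div, abs_mul, abs_mul, abs_of_pos hpi, abs_of_pos hρ, abs_of_pos hK0]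
        ring
      rw [e2]
      apply sinh_ge
      refine hρ1.trans ?_
      rw [show Real.pi ^ 2 / (5 * K ^ 2) * ρ = Real.pi ^ 2 * (1 / (5 * K)) * ρ / K by field_simp]
      gcongr
    unfold RB
    have n1 : ‖Complex.exp (2 * Real.pi ^ 2 * u ^ 2 / t)‖ = Real.exp (2 * Real.pi ^ 2 * u ^ 2 * ρ) := by
      rw [show (2 * Real.pi ^ 2 * u ^ 2 / t : ℂ) = ((2 * Real.pi ^ 2 * u ^ 2 : ℝ) : ℂ) * t⁻¹ by push_cast; ring, norm_exp_real_inv]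
    have n2 : ‖Complex.exp (Real.pi * I * u)‖ = 1 := by
      rw [show (Real.pi * I * u : ℂ) = ((Real.pi * u : ℝ) : ℂ) * I by push_cast; ring, Complex.norm_exp_ofReal_mul_I]
    rw [norm_div, norm_mul, norm_mul, norm_mul, norm_mul, norm_mul, n1, n2, Complex.norm_of_nonneg hpi.le, Complex.norm_natCast, mul_one]
    have n3 : t.re ≤ ‖t‖ := Complex.re_le_norm t
    have n4 : ‖(2 : ℂ)‖ = 2 := by simp
    rw [n4]
    have h2 : Real.exp (2 * Real.pi ^ 2 * u ^ 2 * ρ) ≤ E * Real.exp (Real.pi ^ 2 * |u| * ρ / K) := by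
      rw [hE, ← Real.exp_add]
      apply Real.exp_le_exp.mpr
      rw [show Real.pi ^ 2 * ρ * (-1 / (8 * K ^ 2) + 1 / 800) + Real.pi ^ 2 * |u| * ρ / K = Real.pi ^ 2 * ρ * (-1 / (8 * K ^ 2) + 1 / 800 + |u| / K) by ring,
        show 2 * Real.pi ^ 2 * u ^ 2 * ρ = Real.pi ^ 2 * ρ * (2 * u ^ 2) by ring]
      apply mul_le_mul_of_nonneg_left _ (by positivity)
      rw [← sq_abs]
      set v := |u|
      set z : ℝ := 1 / K with hz
      have hz2 : z ≤ 1 / 2 := by rw [hz]; apply one_div_le_one_div_of_le <;> linarith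
      have e1 : (1 / (5 * K) : ℝ) = z / 5 := by rw [hz]; field_simp
      have e2 : (1 / (4 * K) : ℝ) = z / 4 := by rw [hz]; field_simp
      have e3 : (-1 / (8 * K ^ 2) : ℝ) = -z ^ 2 / 8 := by rw [hz]; field_simp
      have e4 : v / K = v * z := by rw [hz]; ring
      rw [e3, e4]
      rw [e1] at hu5
      rw [e2] at hlt
      have hz0 : 0 < z := by rw [hz]; positivity
      nlinarith
    calc _ ≤ Real.pi * (E * Real.exp (Real.pi ^ 2 * |u| * ρ / K)) / (2 * t.re * 1 * (Real.exp (Real.pi ^ 2 * |u| * ρ / K) / 4)) := by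
          gcongr
          linarith
      _ = 2 * Real.pi / t.re * E := by
          have := (Real.exp_pos (Real.pi ^ 2 * |u| * ρ / K)).ne'
          field_simp
          norm_num
  have h1 := hf t ht hsec hc
  have h2 : ‖∑ r ∈ Finset.range K, cR h k r * RB' t K r (uR h k r)‖ ≤ (∑ r ∈ Finset.range K, ‖cR h k r‖ * (2 * Real.pi)) / t.re * E := by
    refine (norm_sum_le _ _).trans ?_
    rw [Finset.sum_div, Finset.sum_mul]
    apply Finset.sum_le_sum
    intro r _
    rw [norm_mul]
    refine (mul_le_mul_of_nonneg_left (hR r) (norm_nonneg _)).trans (le_of_eq ?_)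
    ring
  have h3 : C / √t.re * Real.exp (-(Real.pi ^ 2 / (8 * K ^ 2) * ρ)) ≤ C / t.re * E := by
    have : t.re ≤ √t.re := by
      rw [Real.le_sqrt ht.le ht.le]
      nlinarith
    have : Real.exp (-(Real.pi ^ 2 / (8 * K ^ 2) * ρ)) ≤ E := by
      rw [hE]
      apply Real.exp_le_exp.mpr
      have e : Real.pi ^ 2 * ρ * (-1 / (8 * K ^ 2) + 1 / 800) = -(Real.pi ^ 2 / (8 * K ^ 2) * ρ) + Real.pi ^ 2 * ρ / 800 := by ring
      rw [e]
      have : 0 ≤ Real.pi ^ 2 * ρ / 800 := by positivity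
      linarith
    gcongr
  have h4 := norm_sub_le (fq (qf h k t) zt + ∑ r ∈ Finset.range K, cR h k r * RB' t K r (uR h k r)) (∑ r ∈ Finset.range K, cR h k r * RB' t K r (uR h k r))
  rw [add_sub_cancel_right] at h4
  refine h4.trans ((add_le_add (h1.trans h3) h2).trans (le_of_eq ?_))
  ring

end M2R

namespace M2R
open Filter Topology Set
open Complex (I)

/-- generating function -/
noncomputable def GG (q : ℂ) : ℂ := (1 - zt) * fq q zt / theta q

noncomputable def PD (h : ℕ) : ℂ :=
  if h = 0 then 2 else if h = 1 then 2 / 5 * (1 - zt) else if h = 2 then 2 / 5 * (zt ^ 3 - zt)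
  else if h = 3 then 2 / 5 * (zt ^ 2 - zt ^ 4) else 2 / 5 * (1 - zt ^ 4)

noncomputable def Dh (h : ℕ) : ℂ := (√Real.pi : ℝ) * (Real.sin (Real.pi / 5) : ℝ) * PD h

lemma zt_sum : 1 + zt + zt ^ 2 + zt ^ 3 + zt ^ 4 = 0 := by
  have h : (zt - 1) * (1 + zt + zt ^ 2 + zt ^ 3 + zt ^ 4) = 0 := by
    linear_combination zt_pow
  exact (mul_eq_zero.mp h).resolve_left (sub_ne_zero.mpr zt_ne_one)

lemma zt_cs : zt = (Real.cos (2 * Real.pi / 5) : ℝ) + (Real.sin (2 * Real.pi / 5) : ℝ) * I := by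
  unfold zt
  rw [show (2 * Real.pi * Complex.I / 5 : ℂ) = ((2 * Real.pi / 5 : ℝ) : ℂ) * I by push_cast; ring, Complex.exp_mul_I]
  push_cast; rfl

lemma cos_2pi5 : Real.cos (2 * Real.pi / 5) = (√5 - 1) / 4 := by
  have h := Real.cos_pi_div_five
  have h5 : √5 ^ 2 = (5 : ℝ) := Real.sq_sqrt (by norm_num)
  rw [show 2 * Real.pi / 5 = 2 * (Real.pi / 5) by ring, Real.cos_two_mul, h]
  linear_combination (1 / 8) * h5

lemma zt_inv4 : zt ^ 4 = (Real.cos (2 * Real.pi / 5) : ℝ) - (Real.sin (2 * Real.pi / 5) : ℝ) * I := by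
  have h1 : zt ^ 4 = zt⁻¹ := by
    exact eq_inv_of_mul_eq_one_left (by linear_combination zt_pow)
  rw [h1]
  have : zt⁻¹ = (starRingEnd ℂ) zt := Complex.inv_eq_conj zt_norm
  rw [this]
  nth_rewrite 1 [zt_cs]
  simp only [map_add, map_mul, Complex.conj_ofReal, Complex.conj_I]
  ring

lemma sqrt5_eq : ((√5 : ℝ) : ℂ) = 1 + 2 * zt + 2 * zt ^ 4 := by
  rw [zt_inv4]
  nth_rewrite 1 [zt_cs]
  rw [cos_2pi5]
  push_cast
  ring

lemma sin_sq5 : (Real.sin (Real.pi / 5)) ^ 2 = (5 - √5) / 8 := by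
  have h := Real.cos_pi_div_five
  have h5 : √5 ^ 2 = (5 : ℝ) := Real.sq_sqrt (by norm_num)
  rw [Real.sin_sq, h]
  linear_combination (-1 / 16) * h5

lemma sin_mul5 : Real.sin (2 * Real.pi / 5) * Real.sin (Real.pi / 5) = √5 / 4 := by
  have h := Real.cos_pi_div_five
  have h5 : √5 ^ 2 = (5 : ℝ) := Real.sq_sqrt (by norm_num)
  rw [show 2 * Real.pi / 5 = 2 * (Real.pi / 5) by ring, Real.sin_two_mul, h]
  linear_combination ((1 + √5) / 2) * sin_sq5 - (1 / 16) * h5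

lemma sin5_pos : 0 < Real.sin (Real.pi / 5) :=
  Real.sin_pos_of_pos_of_lt_pi (by have := Real.pi_pos; positivity) (by linarith [Real.pi_pos])

lemma Gm_one : Gm 0 1 = (√Real.pi : ℝ) := by
  unfold Gm cR
  have h2 : √2 * √2 = (2 : ℝ) := Real.mul_self_sqrt (by norm_num)
  simp only [Finset.range_one, Finset.sum_singleton]
  have e : Real.cos (Real.pi * ((4 * ((0 : ℕ) : ℝ) + 1) / (4 * ((1 : ℕ) : ℝ)))) = √2 / 2 := by
    rw [← Real.cos_pi_div_four]; congr 1; push_cast; ring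
  rw [e]
  have e2 : 1 / √(2 * ((1 : ℕ) : ℝ) ^ 2 / Real.pi) * (2 * (√2 / 2)) = √Real.pi := by
    have hp : 0 < √Real.pi := Real.sqrt_pos.mpr Real.pi_pos
    rw [Nat.cast_one, one_pow, mul_one, Real.sqrt_div (by norm_num)]
    field_simp
  rw [← e2]
  push_cast
  simp

lemma zt_exp (n : ℕ) : Complex.exp (2 * Real.pi * I * n / 5) = zt ^ n := by
  unfold zt
  rw [← Complex.exp_nat_mul]
  congr 1
  ring

lemma cR5 (h r : ℕ) : cR h 5 r = (-1) ^ r * zt ^ (h * (2 * r ^ 2 + r)) := by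
  unfold cR
  rw [← zt_exp, zpow_natCast]
  push_cast
  rfl

lemma Gm_five (h : ℕ) : Gm h 5 = (√Real.pi / 5 : ℝ) * (-(zt ^ 2 + zt ^ 3) - (zt + zt ^ 4) * zt ^ h - zt ^ (3 * h)) := by
  have h2 : √2 * √2 = (2 : ℝ) := Real.mul_self_sqrt (by norm_num)
  have c1 : Real.cos (Real.pi * ((4 * ((0 : ℕ) : ℝ) + 1) / (4 * ((5 : ℕ) : ℝ)))) + Real.cos (Real.pi * ((4 * ((2 : ℕ) : ℝ) + 1) / (4 * ((5 : ℕ) : ℝ)))) = √2 * ((1 + √5) / 4) := by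
    rw [Real.cos_add_cos, ← Real.cos_pi_div_five, ← Real.cos_neg (Real.pi / 5)]
    rw [show (Real.pi * ((4 * ((0 : ℕ) : ℝ) + 1) / (4 * ((5 : ℕ) : ℝ))) + Real.pi * ((4 * ((2 : ℕ) : ℝ) + 1) / (4 * ((5 : ℕ) : ℝ)))) / 2 = Real.pi / 4 by push_cast; ring,
      show (Real.pi * ((4 * ((0 : ℕ) : ℝ) + 1) / (4 * ((5 : ℕ) : ℝ))) - Real.pi * ((4 * ((2 : ℕ) : ℝ) + 1) / (4 * ((5 : ℕ) : ℝ)))) / 2 = -(Real.pi / 5) by push_cast; ring, Real.cos_pi_div_four]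
    ring
  have c2 : Real.cos (Real.pi * ((4 * ((4 : ℕ) : ℝ) + 1) / (4 * ((5 : ℕ) : ℝ)))) - Real.cos (Real.pi * ((4 * ((3 : ℕ) : ℝ) + 1) / (4 * ((5 : ℕ) : ℝ)))) = -√2 * ((√5 - 1) / 4) := by
    rw [Real.cos_sub_cos, ← cos_2pi5, ← Real.sin_pi_div_two_sub]
    rw [show (Real.pi * ((4 * ((4 : ℕ) : ℝ) + 1) / (4 * ((5 : ℕ) : ℝ))) + Real.pi * ((4 * ((3 : ℕ) : ℝ) + 1) / (4 * ((5 : ℕ) : ℝ)))) / 2 = Real.pi - Real.pi / 4 by push_cast; ring,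
      show (Real.pi * ((4 * ((4 : ℕ) : ℝ) + 1) / (4 * ((5 : ℕ) : ℝ))) - Real.pi * ((4 * ((3 : ℕ) : ℝ) + 1) / (4 * ((5 : ℕ) : ℝ)))) / 2 = Real.pi / 2 - 2 * Real.pi / 5 by push_cast; ring, Real.sin_pi_sub, Real.sin_pi_div_four]
    ring
  have c3 : Real.cos (Real.pi * ((4 * ((1 : ℕ) : ℝ) + 1) / (4 * ((5 : ℕ) : ℝ)))) = √2 / 2 := by
    rw [← Real.cos_pi_div_four]; congr 1; push_cast; ring
  have e2 : 1 / √(2 * ((5 : ℕ) : ℝ) ^ 2 / Real.pi) = √Real.pi / (5 * √2) := by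
    have hp : 0 < √Real.pi := Real.sqrt_pos.mpr Real.pi_pos
    push_cast
    rw [Real.sqrt_div (by norm_num), Real.sqrt_mul (by norm_num), Real.sqrt_sq (by norm_num)]
    field_simp
  have e2' : (1 : ℂ) / ((√(2 * ((5 : ℕ) : ℝ) ^ 2 / Real.pi) : ℝ) : ℂ) = ((√Real.pi / (5 * √2) : ℝ) : ℂ) := by rw [← e2]; push_cast; rfl
  have p5 : ∀ a b : ℕ, zt ^ (5 * a + b) = zt ^ b := by
    intro a b
    rw [pow_add, pow_mul, zt_pow, one_pow, one_mul]
  unfold Gm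
  rw [Finset.sum_range_succ, Finset.sum_range_succ, Finset.sum_range_succ, Finset.sum_range_succ, Finset.sum_range_one]
  rw [e2', c3, cR5, cR5, cR5, cR5, cR5]
  have q3 : zt ^ (h * (2 * 3 ^ 2 + 3)) = zt ^ h := by rw [show h * (2 * 3 ^ 2 + 3) = 5 * (4 * h) + h by ring, p5]
  have q4 : zt ^ (h * (2 * 4 ^ 2 + 4)) = zt ^ h := by rw [show h * (2 * 4 ^ 2 + 4) = 5 * (7 * h) + h by ring, p5]
  have q2 : zt ^ (h * (2 * 2 ^ 2 + 2)) = 1 := by rw [show h * (2 * 2 ^ 2 + 2) = 5 * (2 * h) + 0 by ring, p5, pow_zero]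
  have q1 : zt ^ (h * (2 * 1 ^ 2 + 1)) = zt ^ (3 * h) := by rw [show h * (2 * 1 ^ 2 + 1) = 3 * h by ring]
  rw [q1, q2, q3, q4]
  generalize hx0 : Real.cos (Real.pi * ((4 * ((0 : ℕ) : ℝ) + 1) / (4 * ((5 : ℕ) : ℝ)))) = x0 at *
  generalize hx2 : Real.cos (Real.pi * ((4 * ((2 : ℕ) : ℝ) + 1) / (4 * ((5 : ℕ) : ℝ)))) = x2 at *
  generalize hx3 : Real.cos (Real.pi * ((4 * ((3 : ℕ) : ℝ) + 1) / (4 * ((5 : ℕ) : ℝ)))) = x3 at *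
  generalize hx4 : Real.cos (Real.pi * ((4 * ((4 : ℕ) : ℝ) + 1) / (4 * ((5 : ℕ) : ℝ)))) = x4 at *
  have c1' : (x0 : ℂ) + x2 = (√2 : ℝ) * ((1 + (√5 : ℝ)) / 4) := by exact_mod_cast c1
  have c2' : (x4 : ℂ) - x3 = -(√2 : ℝ) * (((√5 : ℝ) - 1) / 4) := by exact_mod_cast c2
  rw [sqrt5_eq] at c1' c2'
  have hs2 : ((√2 : ℝ) : ℂ) ≠ 0 := by
    have : 0 < √(2 : ℝ) := by positivity
    exact_mod_cast this.ne'
  push_cast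
  rw [pow_zero, one_mul, mul_zero, pow_zero]
  field_simp
  linear_combination 2 * c1' + 2 * zt ^ h * c2' + (√2 : ℝ) * zt_sum

end M2R

namespace M2R
open Filter Topology Set
open Complex (I)

lemma half_sq {t : ℂ} (ht : t ≠ 0) : t ^ (1 / 2 : ℂ) * t ^ (1 / 2 : ℂ) = t := by
  rw [← Complex.cpow_add _ _ ht]; norm_num

lemma half_ne {t : ℂ} (ht : t ≠ 0) : t ^ (1 / 2 : ℂ) ≠ 0 := by
  rw [Ne, Complex.cpow_eq_zero_iff]; tauto

lemma Gm_five' (h : ℕ) (h1 : 1 ≤ h) (h4 : h ≤ 4) : Gm h 5 = (√Real.pi / 5 : ℝ) * (√5 : ℝ) *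
    (if h = 2 then -zt ^ 2 else if h = 3 then -zt ^ 3 else 1) := by
  have s := zt_sum
  have p := zt_pow
  rw [Gm_five, sqrt5_eq, mul_assoc]
  congr 1
  interval_cases h
  · norm_num
    linear_combination -2 * s - p
  · norm_num
    ring
  · norm_num
    linear_combination p * (zt ^ 2 - zt ^ 4)
  · norm_num
    linear_combination -2 * s - p * (1 + zt ^ 3 + zt ^ 2 * (zt ^ 5 + 1))

lemma Gm_ne (h : ℕ) (h1 : 1 ≤ h) (h4 : h ≤ 4) : Gm h 5 ≠ 0 := by
  rw [Gm_five' h h1 h4]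
  have hp : 0 < √Real.pi / 5 := by have := Real.sqrt_pos.mpr Real.pi_pos; positivity
  have h5 : 0 < √(5 : ℝ) := by positivity
  refine mul_ne_zero (mul_ne_zero (by exact_mod_cast hp.ne') (by exact_mod_cast h5.ne')) ?_
  have := zt_ne_zero
  split_ifs <;> simp [this]


lemma Dh_aux (h r0 : ℕ) (hr : (h = 1 ∧ r0 = 2) ∨ (h = 2 ∧ r0 = 1) ∨ (h = 3 ∧ r0 = 4) ∨ (h = 4 ∧ r0 = 3)) :
    (1 - zt) * (cR h 5 r0 * (Real.pi / (10 * Real.sin (Real.pi * r0 / 5) : ℝ))) = Dh h * Gm h 5 := by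
  have s := zt_sum
  have p := zt_pow
  have hpi : (Real.pi : ℂ) = (√Real.pi : ℝ) * (√Real.pi : ℝ) := by
    rw [← Complex.ofReal_mul, Real.mul_self_sqrt Real.pi_pos.le]
  have h1p := sin5_pos
  have e1 : Real.sin (Real.pi * ((3 : ℕ) : ℝ) / 5) = Real.sin (2 * Real.pi / 5) := by
    rw [← Real.sin_pi_sub]; congr 1; push_cast; ring
  have e2 : Real.sin (Real.pi * ((4 : ℕ) : ℝ) / 5) = Real.sin (Real.pi / 5) := by
    rw [← Real.sin_pi_sub]; congr 1; push_cast; ring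
  have e3 : Real.sin (Real.pi * ((2 : ℕ) : ℝ) / 5) = Real.sin (2 * Real.pi / 5) := by
    congr 1; push_cast; ring
  have e4 : Real.sin (Real.pi * ((1 : ℕ) : ℝ) / 5) = Real.sin (Real.pi / 5) := by
    congr 1; push_cast; ring
  have h2p : 0 < Real.sin (2 * Real.pi / 5) :=
    Real.sin_pos_of_pos_of_lt_pi (by have := Real.pi_pos; positivity) (by linarith [Real.pi_pos])
  have m1 : ((Real.sin (2 * Real.pi / 5) : ℝ) : ℂ) * (Real.sin (Real.pi / 5) : ℝ) = (√5 : ℝ) / 4 := by exact_mod_cast sin_mul5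
  have m2 : ((Real.sin (Real.pi / 5) : ℝ) : ℂ) ^ 2 = (5 - (√5 : ℝ)) / 8 := by exact_mod_cast sin_sq5
  have m3 : ((√5 : ℝ) : ℂ) ^ 2 = 5 := by
    have : √5 ^ 2 = (5 : ℝ) := Real.sq_sqrt (by norm_num)
    exact_mod_cast this
  have h5 := sqrt5_eq
  have hs1 : ((Real.sin (Real.pi / 5) : ℝ) : ℂ) ≠ 0 := by exact_mod_cast h1p.ne'
  have hs2 : ((Real.sin (2 * Real.pi / 5) : ℝ) : ℂ) ≠ 0 := by exact_mod_cast h2p.ne'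
  have i2 : (Real.pi : ℂ) / (10 * Real.sin (2 * Real.pi / 5) : ℝ) = (√Real.pi : ℝ) * (√Real.pi : ℝ) * ((Real.sin (Real.pi / 5) : ℝ) * (2 * (√5 : ℝ) / 25)) := by
    rw [hpi, Complex.ofReal_mul, div_eq_iff (mul_ne_zero (by norm_num) hs2)]
    push_cast at m1 m3 ⊢
    linear_combination (-20 * ((√5 : ℝ) : ℂ) / 25 * ((√Real.pi : ℝ) : ℂ) ^ 2) * m1 - (√Real.pi : ℝ) ^ 2 / 5 * m3
  have i1 : (Real.pi : ℂ) / (10 * Real.sin (Real.pi / 5) : ℝ) = (√Real.pi : ℝ) * (√Real.pi : ℝ) * ((Real.sin (Real.pi / 5) : ℝ) * ((5 + (√5 : ℝ)) / 25)) := by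
    rw [hpi, Complex.ofReal_mul, div_eq_iff (mul_ne_zero (by norm_num) hs1)]
    push_cast at m2 m3 ⊢
    linear_combination (-10 * (5 + ((√5 : ℝ) : ℂ)) / 25 * ((√Real.pi : ℝ) : ℂ) ^ 2) * m2 + (√Real.pi : ℝ) ^ 2 / 20 * m3
  have key : ∀ (sp s1 c y P r5 g : ℂ), (1 - zt) * (c * y) = P * r5 * g / 5 →
      (1 - zt) * (c * (sp * sp * (s1 * y))) = sp * s1 * P * (sp / 5 * r5 * g) := by
    intro sp s1 c y P r5 g hh
    linear_combination sp ^ 2 * s1 * hh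
  rw [cR5, Gm_five' h (by omega) (by omega)]
  unfold Dh PD
  rw [Complex.ofReal_div, show ((5 : ℝ) : ℂ) = 5 by norm_num]
  rcases hr with ⟨rfl, rfl⟩ | ⟨rfl, rfl⟩ | ⟨rfl, rfl⟩ | ⟨rfl, rfl⟩
  · rw [e3, i2]
    apply key
    rw [h5]
    norm_num
    linear_combination p * (1 + zt ^ 5) * (1 - zt) * (2 * (1 + 2 * zt + 2 * zt ^ 4) / 25)
  · rw [e4, i1]
    apply key
    rw [h5, show zt ^ (2 * (2 * 1 ^ 2 + 1)) = zt ^ 1 by rw [show 2 * (2 * 1 ^ 2 + 1) = 5 * 1 + 1 by norm_num, pow_add, pow_mul, zt_pow, one_pow, one_mul]]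
    norm_num
    linear_combination (((-6/25) * zt ^ 1) + ((2/5) * zt ^ 2) + ((-4/25) * zt ^ 3) + ((-4/25) * zt ^ 4) + ((4/25) * zt ^ 5)) * s
  · rw [e2, i1]
    apply key
    rw [h5, show zt ^ (3 * (2 * 4 ^ 2 + 4)) = zt ^ 3 by rw [show 3 * (2 * 4 ^ 2 + 4) = 5 * 21 + 3 by norm_num, pow_add, pow_mul, zt_pow, one_pow, one_mul]]
    norm_num
    linear_combination (((6/25) * zt ^ 3) + ((-2/5) * zt ^ 4) + ((4/25) * zt ^ 5) + ((4/25) * zt ^ 6) + ((-4/25) * zt ^ 7)) * s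
  · rw [e1, i2]
    apply key
    rw [h5, show zt ^ (4 * (2 * 3 ^ 2 + 3)) = zt ^ 4 by rw [show 4 * (2 * 3 ^ 2 + 3) = 5 * 16 + 4 by norm_num, pow_add, pow_mul, zt_pow, one_pow, one_mul]]
    norm_num
    linear_combination (((-2/25) * zt ^ 0) + ((-2/25) * zt ^ 1) + ((4/25) * zt ^ 2) + ((-4/25) * zt ^ 4) + ((4/25) * zt ^ 5)) * s

lemma Dh_zero : (1 - zt) * (-(Real.pi / (Complex.exp (Real.pi * I * (1 / 5 : ℝ)) * I))) = Dh 0 * (√Real.pi : ℝ) := by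
  have hpi : (Real.pi : ℂ) = (√Real.pi : ℝ) * (√Real.pi : ℝ) := by
    rw [← Complex.ofReal_mul, Real.mul_self_sqrt Real.pi_pos.le]
  set e := Complex.exp (Real.pi * I * (1 / 5 : ℝ)) with he
  have he0 : e ≠ 0 := Complex.exp_ne_zero _
  have hz : zt = e * e := by
    rw [he, ← Complex.exp_add]; unfold zt; congr 1; push_cast; ring
  have hs : ((Real.sin (Real.pi / 5) : ℝ) : ℂ) = (e⁻¹ - e) * I / 2 := by
    rw [Complex.ofReal_sin, Complex.sin, he, ← Complex.exp_neg]
    push_cast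
    rw [show -((Real.pi : ℂ) / 5) * I = -(Real.pi * I * (1 / 5)) by ring, show ((Real.pi : ℂ) / 5) * I = (Real.pi * I * (1 / 5)) by ring]
  unfold Dh PD
  rw [hs, hz, if_pos rfl]
  have e1 : (1 - e * e) * -(↑Real.pi / (e * I)) = (e⁻¹ - e) * I * Real.pi := by
    field_simp
    rw [Complex.I_sq]; ring
  rw [e1]
  nth_rewrite 1 [hpi]
  ring

theorem G_lim {h : ℕ} (hh : h < 5) : Tendsto (fun t : ℂ => t ^ (1 / 2 : ℂ) * Complex.exp (-(Real.pi ^ 2 / 200) * t⁻¹) * GG (qf h 5 t)) SF (𝓝 (Dh h)) := by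
  have hsp : ((√Real.pi : ℝ) : ℂ) ≠ 0 := by exact_mod_cast (Real.sqrt_pos.mpr Real.pi_pos).ne'
  rcases Nat.eq_zero_or_pos h with rfl | hpos
  · have h1 := f_lim0.const_mul (1 - zt)
    have h2 := theta_lim (h := 0) (K := 1) odd_one
    rw [Gm_one] at h2
    have h3 := h1.div h2 hsp
    rw [Dh_zero, mul_div_cancel_right₀ _ hsp] at h3
    refine h3.congr' ?_
    filter_upwards [SF_mem] with t ht
    have ht0 : t ≠ 0 := fun h => by rw [h] at ht; simp at ht
    have e0 : qf 0 5 t = qf 0 1 t := by unfold qf; simp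
    have hth := theta_ne (qf_lt (h := 0) (k := 1) ht.1)
    simp only [Pi.div_apply]
    rw [e0, GG]
    have e1 : Complex.exp ((3 * Real.pi ^ 2 / 25 : ℝ) * t⁻¹) = Complex.exp (-(Real.pi ^ 2 / 200) * t⁻¹) * Complex.exp (Real.pi ^ 2 / (8 * ((1 : ℕ) : ℂ) ^ 2) * t⁻¹) := by
      rw [← Complex.exp_add]; congr 1; push_cast; ring
    rw [e1]
    have ha := Complex.exp_ne_zero (Real.pi ^ 2 / (8 * ((1 : ℕ) : ℂ) ^ 2) * t⁻¹)
    have hb := half_ne ht0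
    generalize Complex.exp (Real.pi ^ 2 / (8 * ((1 : ℕ) : ℂ) ^ 2) * t⁻¹) = a at *
    generalize Complex.exp (-(Real.pi ^ 2 / 200) * t⁻¹) = b at *
    have hc := half_sq ht0
    generalize t ^ (1 / 2 : ℂ) = c at *
    rw [← hc]
    rw [← hc] at hth
    field_simp
  · obtain ⟨r0, hr⟩ : ∃ r0, (h = 1 ∧ r0 = 2) ∨ (h = 2 ∧ r0 = 1) ∨ (h = 3 ∧ r0 = 4) ∨ (h = 4 ∧ r0 = 3) := by
      interval_cases h
      · exact ⟨2, by simp⟩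
      · exact ⟨1, by simp⟩
      · exact ⟨4, by simp⟩
      · exact ⟨3, by simp⟩
    have hr5 : h * r0 % 5 = 2 := by rcases hr with ⟨rfl, rfl⟩ | ⟨rfl, rfl⟩ | ⟨rfl, rfl⟩ | ⟨rfl, rfl⟩ <;> rfl
    have h1 := (f_lim5 hh (by omega) hr5).const_mul (1 - zt)
    have h2 := theta_lim (h := h) (K := 5) (by decide)
    have hne := Gm_ne h hpos (by omega)
    have h3 := h1.div h2 hne
    rw [Dh_aux h r0 hr, mul_div_cancel_right₀ _ hne] at h3
    refine h3.congr' ?_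
    filter_upwards [SF_mem] with t ht
    have ht0 : t ≠ 0 := fun h => by rw [h] at ht; simp at ht
    have hth := theta_ne (qf_lt (h := h) (k := 5) ht.1)
    simp only [Pi.div_apply]
    rw [GG]
    have e1 : Complex.exp (-(Real.pi ^ 2 / 200) * t⁻¹) * Complex.exp (Real.pi ^ 2 / (8 * ((5 : ℕ) : ℂ) ^ 2) * t⁻¹) = 1 := by
      rw [← Complex.exp_add, ← Complex.exp_zero]; congr 1; push_cast; ring
    have ha := Complex.exp_ne_zero (Real.pi ^ 2 / (8 * ((5 : ℕ) : ℂ) ^ 2) * t⁻¹)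
    have hb := half_ne ht0
    generalize Complex.exp (Real.pi ^ 2 / (8 * ((5 : ℕ) : ℂ) ^ 2) * t⁻¹) = a at *
    generalize Complex.exp (-(Real.pi ^ 2 / 200) * t⁻¹) = b at *
    have hc := half_sq ht0
    generalize t ^ (1 / 2 : ℂ) = c at *
    generalize fq (qf h 5 t) zt = Fv at *
    generalize theta (qf h 5 t) = Tv at *
    rw [← hc]
    field_simp
    linear_combination -(1 - zt) * Fv * e1

/-- the ε-factor -/
noncomputable def ep (n : ℕ) : ℝ := if n % 5 = 0 then 6 * Real.sqrt 2 * (5 - Real.sqrt 5)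
             else if n % 5 = 1 then 2 * Real.sqrt 2 * (5 + Real.sqrt 5)
             else if n % 5 = 2 then 20 * Real.sqrt 2
             else if n % 5 = 3 then 2 * Real.sqrt 2 * (5 - Real.sqrt 5)
             else 6 * Real.sqrt 2 * (5 + Real.sqrt 5)

lemma ep_sum (n : ℕ) : ∑ h ∈ Finset.range 5, PD h * zt ^ (4 * n * h) = (ep n / (10 * √2) : ℝ) := by
  have s := zt_sum
  have p := zt_pow
  have hs2 : √(2 : ℝ) ≠ 0 := by positivity
  have p5 : ∀ a b : ℕ, zt ^ (5 * a + b) = zt ^ b := by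
    intro a b
    rw [pow_add, pow_mul, zt_pow, one_pow, one_mul]
  have red : ∀ h : ℕ, zt ^ (4 * n * h) = zt ^ (4 * (n % 5) * h % 5) := by
    intro h
    conv_lhs => rw [← Nat.div_add_mod (4 * n * h) 5, p5]
    congr 1
    simp [Nat.mul_mod]
  simp only [red]
  have hlt : n % 5 < 5 := Nat.mod_lt _ (by norm_num)
  unfold ep
  generalize n % 5 = m at *
  have P0 : PD 0 = 2 := by simp [PD]
  have P1 : PD 1 = 2 / 5 * (1 - zt) := by simp [PD]
  have P2 : PD 2 = 2 / 5 * (zt ^ 3 - zt) := by simp [PD]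
  have P3 : PD 3 = 2 / 5 * (zt ^ 2 - zt ^ 4) := by simp [PD]
  have P4 : PD 4 = 2 / 5 * (1 - zt ^ 4) := by simp [PD]
  rw [Finset.sum_range_succ, Finset.sum_range_succ, Finset.sum_range_succ, Finset.sum_range_succ, Finset.sum_range_one, P0, P1, P2, P3, P4]
  interval_cases m
  · rw [if_pos rfl, show 6 * √2 * (5 - √5) / (10 * √2) = 3 / 5 * (5 - √5) by field_simp; ring]
    push_cast
    rw [sqrt5_eq]
    norm_num
    linear_combination (((2/5) * zt ^ 0)) * s
  · rw [if_neg (by norm_num), if_pos rfl, show 2 * √2 * (5 + √5) / (10 * √2) = 1 / 5 * (5 + √5) by field_simp; ring]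
    push_cast
    rw [sqrt5_eq]
    norm_num
    linear_combination (((4/5) * zt ^ 0) + ((-4/5) * zt ^ 1)) * s
  · rw [if_neg (by norm_num), if_neg (by norm_num), if_pos rfl, show 20 * √2 / (10 * √2) = 2 by field_simp; ring]
    push_cast
    norm_num
    linear_combination (((2/5) * zt ^ 3) + ((-2/5) * zt ^ 4)) * s
  · rw [if_neg (by norm_num), if_neg (by norm_num), if_neg (by norm_num), if_pos rfl, show 2 * √2 * (5 - √5) / (10 * √2) = 1 / 5 * (5 - √5) by field_simp; ring]
    push_cast
    rw [sqrt5_eq]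
    norm_num
    linear_combination (((6/5) * zt ^ 0) + ((-4/5) * zt ^ 1)) * s
  · rw [if_neg (by norm_num), if_neg (by norm_num), if_neg (by norm_num), if_neg (by norm_num), show 6 * √2 * (5 + √5) / (10 * √2) = 3 / 5 * (5 + √5) by field_simp; ring]
    push_cast
    rw [sqrt5_eq]
    norm_num
    linear_combination (((-8/5) * zt ^ 0) + ((4/5) * zt ^ 1) + ((2/5) * zt ^ 2) + ((-2/5) * zt ^ 4)) * s

lemma ep_pos (n : ℕ) : 0 < ep n := by
  have h5 : √(5 : ℝ) < 5 := by rw [Real.sqrt_lt' (by norm_num)]; norm_num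
  have h50 : 0 ≤ √(5 : ℝ) := by positivity
  have h2 : 0 < √(2 : ℝ) := by positivity
  have : 0 < 5 - √(5 : ℝ) := by linarith
  unfold ep
  split_ifs <;> positivity

end M2R

namespace M2R
open Filter Topology Set
open Complex (I)
open UpperHalfPlane (denom)
open scoped MatrixGroups UpperHalfPlane

lemma Del_norm (τ : ℍ) : ‖ModularForm.discriminant τ‖ = Real.exp (-2 * Real.pi * τ.im) *
    ‖Eul (Complex.exp (2 * Real.pi * I * τ))‖ ^ 24 := by
  rw [ModularForm.discriminant, ModularForm.eta, mul_pow, norm_mul, norm_pow, norm_pow]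
  congr 1
  · simp only [Function.Periodic.qParam, Complex.norm_exp]
    rw [← Real.exp_nat_mul]
    congr 1
    have : (2 * Real.pi * I * (τ : ℂ) / (24 : ℝ)).re = -2 * Real.pi * τ.im / 24 := by
      rw [Complex.div_ofReal_re]
      simp
    rw [this]; push_cast; ring
  · congr 2
    unfold Eul
    simp only [ModularForm.eta_q, Function.Periodic.qParam]
    simp

lemma Del_bd : ∃ c C : ℝ, 0 < c ∧ 0 < C ∧ ∀ τ : ℍ, 1 / 2 ≤ τ.im →
    c * Real.exp (-2 * Real.pi * τ.im) ≤ ‖ModularForm.discriminant τ‖ ∧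
    ‖ModularForm.discriminant τ‖ ≤ C * Real.exp (-2 * Real.pi * τ.im) := by
  have hpi := Real.pi_pos
  set r := Real.exp (-Real.pi) with hr
  have hr1 : r < 1 := by rw [hr, Real.exp_lt_one_iff]; linarith
  have hcomp : IsCompact (Metric.closedBall (0 : ℂ) r) := isCompact_closedBall 0 r
  have hcont : ContinuousOn (fun q => ‖Eul q‖ ^ 24) (Metric.closedBall (0 : ℂ) r) := by
    apply ContinuousOn.pow
    apply ContinuousOn.norm
    have := ModularForm.differentiableOn_tprod_one_sub_pow.continuousOn
    exact this.mono (Metric.closedBall_subset_ball hr1)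
  have hne : (Metric.closedBall (0 : ℂ) r).Nonempty := ⟨0, by simp [hr]; positivity⟩
  obtain ⟨a, ha, hmin⟩ := hcomp.exists_isMinOn hne hcont
  obtain ⟨b, hb, hmax⟩ := hcomp.exists_isMaxOn hne hcont
  have ha1 : ‖a‖ < 1 := by
    have : ‖a‖ ≤ r := by simpa using ha
    linarith
  have hb1 : ‖b‖ < 1 := by
    have : ‖b‖ ≤ r := by simpa using hb
    linarith
  refine ⟨‖Eul a‖ ^ 24, ‖Eul b‖ ^ 24, pow_pos (norm_pos_iff.mpr (Eul_ne ha1)) _, pow_pos (norm_pos_iff.mpr (Eul_ne hb1)) _, fun τ hτ => ?_⟩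
  have hq : Complex.exp (2 * Real.pi * I * τ) ∈ Metric.closedBall (0 : ℂ) r := by
    rw [mem_closedBall_zero_iff, Complex.norm_exp]
    apply Real.exp_le_exp.mpr
    have : (2 * Real.pi * I * (τ : ℂ)).re = -2 * Real.pi * τ.im := by
      simp
    rw [this]; nlinarith
  rw [Del_norm]
  have e := Real.exp_pos (-2 * Real.pi * τ.im)
  have h1 := hmin hq
  have h2 := hmax hq
  simp only [mem_setOf_eq] at h1 h2
  constructor
  · rw [mul_comm]; exact mul_le_mul_of_nonneg_left h1 e.le
  · rw [mul_comm (‖Eul b‖ ^ 24)]; exact mul_le_mul_of_nonneg_left h2 e.le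

lemma Del_inv (g : SL(2, ℤ)) (τ : ℍ) : ‖ModularForm.discriminant (g • τ)‖ * (g • τ).im ^ 6 = ‖ModularForm.discriminant τ‖ * τ.im ^ 6 := by
  have h := SlashInvariantForm.slash_action_eqn'' CuspForm.discriminant (γ := Matrix.SpecialLinearGroup.mapGL ℝ g) (MonoidHom.mem_range.mpr ⟨g, rfl⟩) τ
  have h' : ModularForm.discriminant (g • τ) = denom (Matrix.SpecialLinearGroup.toGL ((Matrix.SpecialLinearGroup.map (Int.castRingHom ℝ)) g)) ↑τ ^ (12 : ℤ) * ModularForm.discriminant τ := h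
  rw [h', ModularGroup.im_smul_eq_div_normSq, norm_mul, norm_zpow]
  have hn := UpperHalfPlane.normSq_denom_pos (Matrix.SpecialLinearGroup.toGL ((Matrix.SpecialLinearGroup.map (Int.castRingHom ℝ)) g)) (z := (τ : ℂ)) τ.im_ne_zero
  rw [Complex.normSq_eq_norm_sq] at hn ⊢
  set D := ‖denom (Matrix.SpecialLinearGroup.toGL ((Matrix.SpecialLinearGroup.map (Int.castRingHom ℝ)) g)) ↑τ‖
  have hD : D ≠ 0 := by intro h0; rw [h0] at hn; simp at hn
  rw [show (12 : ℤ) = ((12 : ℕ) : ℤ) by norm_num, zpow_natCast]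
  field_simp

lemma Del_lower : ∃ c : ℝ, 0 < c ∧ ∀ (τ : ℍ) (g : SL(2, ℤ)), 1 / 2 ≤ (g • τ).im →
    c * Real.exp (-2 * Real.pi * (g • τ).im) ≤ ‖ModularForm.discriminant τ‖ * τ.im ^ 6 := by
  obtain ⟨c, C, hc, hC, hb⟩ := Del_bd
  refine ⟨c * (1 / 2) ^ 6, by positivity, fun τ g hg => ?_⟩
  rw [← Del_inv g τ]
  have h1 := (hb _ hg).1
  have h2 : (1 / 2 : ℝ) ^ 6 ≤ (g • τ).im ^ 6 := pow_le_pow_left₀ (by norm_num) hg 6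
  calc c * (1 / 2) ^ 6 * Real.exp (-2 * Real.pi * (g • τ).im) = (c * Real.exp (-2 * Real.pi * (g • τ).im)) * (1 / 2) ^ 6 := by ring
    _ ≤ _ := mul_le_mul h1 h2 (by norm_num) (norm_nonneg _)

lemma Del_upper : ∃ C : ℝ, 0 < C ∧ ∀ (τ : ℍ) (g : SL(2, ℤ)),
    ‖ModularForm.discriminant τ‖ * τ.im ^ 6 ≤ C * (1 + (g • τ).im) ^ 6 * Real.exp (-2 * Real.pi * (g • τ).im) := by
  obtain ⟨c, C, hc, hC, hb⟩ := Del_bd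
  have hpi := Real.pi_pos
  refine ⟨C + C * 720 * Real.exp Real.pi, by positivity, fun τ g => ?_⟩
  have hY := (g • τ).im_pos
  set Y := (g • τ).im with hYd
  have one : (1 : ℝ) ≤ (1 + Y) ^ 6 := one_le_pow₀ (by linarith)
  by_cases h : 1 / 2 ≤ Y
  · rw [← Del_inv g τ, ← hYd]
    have h1 := (hb _ h).2
    rw [← hYd] at h1
    have h2 : Y ^ 6 ≤ (1 + Y) ^ 6 := pow_le_pow_left₀ hY.le (by linarith) 6
    calc ‖ModularForm.discriminant (g • τ)‖ * Y ^ 6 ≤ (C * Real.exp (-2 * Real.pi * Y)) * (1 + Y) ^ 6 := mul_le_mul h1 h2 (by positivity) (by positivity)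
      _ = C * (1 + Y) ^ 6 * Real.exp (-2 * Real.pi * Y) := by ring
      _ ≤ _ := by
        gcongr
        have : 0 < C * 720 * Real.exp Real.pi := by positivity
        linarith
  · push Not at h
    obtain ⟨g', hg'⟩ := ModularGroup.exists_one_half_le_im_smul τ
    rw [← Del_inv g' τ]
    have h1 := (hb _ hg').2
    set Z := (g' • τ).im with hZ
    have hZ0 : 0 < Z := by linarith
    have h2 : Z ^ 6 * Real.exp (-2 * Real.pi * Z) ≤ 720 := by
      have h3 := Real.pow_div_factorial_le_exp Z hZ0.le 6
      have h4 : Real.exp Z * Real.exp (-2 * Real.pi * Z) ≤ 1 := by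
        rw [← Real.exp_add, Real.exp_le_one_iff]
        nlinarith [Real.pi_gt_three]
      have h5 : (Nat.factorial 6 : ℝ) = 720 := by norm_num [Nat.factorial]
      rw [h5, div_le_iff₀ (by norm_num)] at h3
      have := Real.exp_pos (-2 * Real.pi * Z)
      calc Z ^ 6 * Real.exp (-2 * Real.pi * Z) ≤ (Real.exp Z * 720) * Real.exp (-2 * Real.pi * Z) := by gcongr
        _ = 720 * (Real.exp Z * Real.exp (-2 * Real.pi * Z)) := by ring
        _ ≤ 720 * 1 := by gcongr
        _ = 720 := by ring
    have h6 : 1 ≤ Real.exp Real.pi * Real.exp (-2 * Real.pi * Y) := by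
      rw [← Real.exp_add, ← Real.exp_zero]
      apply Real.exp_le_exp.mpr
      nlinarith
    calc ‖ModularForm.discriminant (g' • τ)‖ * Z ^ 6 ≤ (C * Real.exp (-2 * Real.pi * Z)) * Z ^ 6 := by gcongr
      _ = C * (Z ^ 6 * Real.exp (-2 * Real.pi * Z)) := by ring
      _ ≤ C * 720 := by gcongr
      _ ≤ C * 720 * ((Real.exp Real.pi * Real.exp (-2 * Real.pi * Y)) * (1 + Y) ^ 6) := by
        apply le_mul_of_one_le_right (by positivity)
        exact one_le_mul_of_one_le_of_one_le h6 one
      _ = (C * 720 * Real.exp Real.pi) * (1 + Y) ^ 6 * Real.exp (-2 * Real.pi * Y) := by ring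
      _ ≤ _ := by
        gcongr
        linarith

/-- quadratic form -/
noncomputable def NN (x y : ℝ) (c d : ℤ) : ℝ := c ^ 2 + ((c * x + d) / y) ^ 2

lemma im_NN {x y : ℝ} (m : ℕ) (hm : 0 < m) (hy : 0 < y) (τ : ℍ) (hτ : (τ : ℂ) = m * (x + y * I)) (g : SL(2, ℤ)) :
    (g • τ).im = m / (y * NN x y (m * g 1 0) (g 1 1)) := by
  rw [ModularGroup.im_smul_eq_div_normSq, ModularGroup.denom_apply]
  have hm' : (0 : ℝ) < m := by exact_mod_cast hm
  have him : τ.im = m * y := by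
    rw [← UpperHalfPlane.coe_im, hτ]; simp
  rw [him, hτ, Complex.normSq_apply]
  simp only [Complex.add_re, Complex.add_im, Complex.mul_re, Complex.mul_im, Complex.intCast_re, Complex.intCast_im, Complex.natCast_re, Complex.natCast_im, Complex.ofReal_re, Complex.ofReal_im, Complex.I_re, Complex.I_im]
  unfold NN
  push_cast
  rw [show y * (((m : ℝ) * (g 1 0 : ℝ)) ^ 2 + ((m * (g 1 0 : ℝ) * x + (g 1 1 : ℝ)) / y) ^ 2) =
    (((m : ℝ) * (g 1 0 : ℝ)) ^ 2 * y ^ 2 + ((m * (g 1 0 : ℝ) * x + (g 1 1 : ℝ))) ^ 2) / y by field_simp]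
  rw [div_div_eq_mul_div]
  congr 1
  ring

theorem P_bound : ∃ K : ℝ, 0 < K ∧ ∀ x y : ℝ, 0 < y → y ≤ 1 → ∃ c1 d1 c4 d4 : ℤ, IsCoprime c1 d1 ∧ IsCoprime c4 d4 ∧
    ∀ c d : ℤ, IsCoprime c d → 1 ≤ NN x y (2 * c) d →
      ‖(theta (Complex.exp (2 * Real.pi * I * (x + y * I))))⁻¹‖ ^ 24 ≤ K * Real.exp (2 * Real.pi / y * (1 / NN x y c1 d1 + 4 / NN x y (4 * c4) d4 - 2 / NN x y (2 * c) d)) := by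
  obtain ⟨a, ha, hl⟩ := Del_lower
  obtain ⟨A, hA, hu⟩ := Del_upper
  have hpi := Real.pi_pos
  refine ⟨A * 6 ^ 6 / a ^ 2, by positivity, fun x y hy hy1 => ?_⟩
  have him : ∀ m : ℕ, 0 < m → 0 < ((m : ℂ) * (x + y * I)).im := by
    intro m hm
    have hm' : (0 : ℝ) < m := by exact_mod_cast hm
    simp; positivity
  set τ1 : ℍ := ⟨((1 : ℕ) : ℂ) * (x + y * I), him 1 (by norm_num)⟩ with hτ1
  set τ2 : ℍ := ⟨((2 : ℕ) : ℂ) * (x + y * I), him 2 (by norm_num)⟩ with hτ2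
  set τ4 : ℍ := ⟨((4 : ℕ) : ℂ) * (x + y * I), him 4 (by norm_num)⟩ with hτ4
  have i1 : τ1.im = y := by rw [← UpperHalfPlane.coe_im]; simp [hτ1]
  have i2 : τ2.im = 2 * y := by rw [← UpperHalfPlane.coe_im]; simp [hτ2]
  have i4 : τ4.im = 4 * y := by rw [← UpperHalfPlane.coe_im]; simp [hτ4]
  obtain ⟨g1, hg1⟩ := ModularGroup.exists_one_half_le_im_smul τ1
  obtain ⟨g4, hg4⟩ := ModularGroup.exists_one_half_le_im_smul τ4
  refine ⟨g1 1 0, g1 1 1, g4 1 0, g4 1 1, ModularGroup.bottom_row_coprime g1, ModularGroup.bottom_row_coprime g4, fun c d hcd hN => ?_⟩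
  obtain ⟨g2, -, hg2⟩ := ModularGroup.bottom_row_surj (R := ℤ) (a := ![c, d]) (by simpa using hcd)
  have g20 : g2 1 0 = c := by
    have := congrFun hg2 0; simpa using this
  have g21 : g2 1 1 = d := by
    have := congrFun hg2 1; simpa using this
  have y1 := im_NN 1 (by norm_num) hy τ1 rfl g1
  have y2 := im_NN 2 (by norm_num) hy τ2 rfl g2
  have y4 := im_NN 4 (by norm_num) hy τ4 rfl g4
  rw [g20, g21] at y2
  have L1 := hl τ1 g1 hg1
  have L4 := hl τ4 g4 hg4
  have U := hu τ2 g2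
  set q := Complex.exp (2 * Real.pi * I * (x + y * I)) with hq
  have hqn : ‖q‖ < 1 := by
    rw [hq, Complex.norm_exp, Real.exp_lt_one_iff]
    simp; positivity
  have n1 : ‖ModularForm.discriminant τ1‖ = Real.exp (-2 * Real.pi * y) * ‖Eul q‖ ^ 24 := by
    rw [Del_norm, i1]; congr 4; simp [hτ1, hq]
  have n2 : ‖ModularForm.discriminant τ2‖ = Real.exp (-2 * Real.pi * (2 * y)) * ‖Eul (q ^ 2)‖ ^ 24 := by
    rw [Del_norm, i2]; congr 4
    rw [hq, ← Complex.exp_nat_mul]; congr 1; simp [hτ2]; ring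
  have n4 : ‖ModularForm.discriminant τ4‖ = Real.exp (-2 * Real.pi * (4 * y)) * ‖Eul (q ^ 4)‖ ^ 24 := by
    rw [Del_norm, i4]; congr 4
    rw [hq, ← Complex.exp_nat_mul]; congr 1; simp [hτ4]; ring
  have hth := theta_eq hqn
  have hq2 : ‖q ^ 2‖ < 1 := by rw [norm_pow]; exact pow_lt_one₀ (norm_nonneg _) hqn (by norm_num)
  have hq4 : ‖q ^ 4‖ < 1 := by rw [norm_pow]; exact pow_lt_one₀ (norm_nonneg _) hqn (by norm_num)
  have e1 := norm_pos_iff.mpr (Eul_ne hqn)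
  have e2 := norm_pos_iff.mpr (Eul_ne hq2)
  have e4 := norm_pos_iff.mpr (Eul_ne hq4)
  have hP : ‖(theta q)⁻¹‖ = ‖Eul (q ^ 2)‖ / (‖Eul q‖ * ‖Eul (q ^ 4)‖) := by
    rw [norm_inv, eq_div_iff (by positivity), ← norm_mul, ← hth, norm_mul]
    have := norm_pos_iff.mpr (theta_ne hqn)
    field_simp
  rw [hP]
  rw [i1, n1] at L1
  rw [i2, n2] at U
  rw [i4, n4] at L4
  generalize ‖Eul q‖ = E1 at *
  generalize ‖Eul (q ^ 2)‖ = E2 at *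
  generalize ‖Eul (q ^ 4)‖ = E4 at *
  have hyY : y * (1 + (g2 • τ2).im) ≤ 3 := by
    rw [y2]
    have : y * (((2 : ℕ) : ℝ) / (y * NN x y (((2 : ℕ) : ℤ) * c) d)) = 2 / NN x y (2 * c) d := by
      push_cast; field_simp
    rw [mul_add, this]
    have : 2 / NN x y (2 * c) d ≤ 2 := by rw [div_le_iff₀ (by linarith)]; linarith
    linarith
  have hY2 := (g2 • τ2).im_pos
  have hE : Real.exp (2 * Real.pi / y * (1 / NN x y (g1 1 0) (g1 1 1) + 4 / NN x y (4 * g4 1 0) (g4 1 1) - 2 / NN x y (2 * c) d)) =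
      Real.exp (-2 * Real.pi * (g2 • τ2).im) / (Real.exp (-2 * Real.pi * (g1 • τ1).im) * Real.exp (-2 * Real.pi * (g4 • τ4).im)) := by
    rw [← Real.exp_add, ← Real.exp_sub]
    congr 1
    rw [y1, y2, y4]
    push_cast
    rw [one_mul, ← div_div, ← div_div, ← div_div]
    ring
  rw [hE]
  generalize (g1 • τ1).im = Y1 at *
  generalize (g2 • τ2).im = Y2 at *
  generalize (g4 • τ4).im = Y4 at *
  have p1 := Real.exp_pos (-2 * Real.pi * Y1)
  have p2 := Real.exp_pos (-2 * Real.pi * Y2)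
  have p4 := Real.exp_pos (-2 * Real.pi * Y4)
  generalize Real.exp (-2 * Real.pi * Y1) = X1 at *
  generalize Real.exp (-2 * Real.pi * Y2) = X2 at *
  generalize Real.exp (-2 * Real.pi * Y4) = X4 at *
  have r1 : Real.exp (-2 * Real.pi * y) = Real.exp (-2 * Real.pi * y) ^ 1 := by ring
  have r2 : Real.exp (-2 * Real.pi * (2 * y)) = Real.exp (-2 * Real.pi * y) ^ 2 := by rw [← Real.exp_nat_mul]; congr 1; push_cast; ring
  have r4 : Real.exp (-2 * Real.pi * (4 * y)) = Real.exp (-2 * Real.pi * y) ^ 4 := by rw [← Real.exp_nat_mul]; congr 1; push_cast; ring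
  rw [r2] at U
  rw [r4] at L4
  have hR : Real.exp (-2 * Real.pi * y) ≤ 1 := by rw [Real.exp_le_one_iff]; nlinarith
  have hR0 := Real.exp_pos (-2 * Real.pi * y)
  generalize Real.exp (-2 * Real.pi * y) = R at *
  rw [div_pow, mul_pow, div_le_iff₀ (by positivity)]
  -- combine
  have LL : (a * X1) * (a * X4) ≤ (R * E1 ^ 24 * y ^ 6) * (R ^ 4 * E4 ^ 24 * (4 * y) ^ 6) := mul_le_mul L1 L4 (by positivity) (by positivity)
  have h36 : (y * (1 + Y2)) ^ 6 ≤ 3 ^ 6 := pow_le_pow_left₀ (by positivity) hyY 6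
  -- E2^24 ≤ A (1+Y2)^6 X2 / (R^2 (2y)^6)
  have k1 : E2 ^ 24 * (R ^ 2 * (2 * y) ^ 6) * (a ^ 2 * X1 * X4) ≤ (A * (1 + Y2) ^ 6 * X2) * ((R * E1 ^ 24 * y ^ 6) * (R ^ 4 * E4 ^ 24 * (4 * y) ^ 6)) := by
    apply mul_le_mul _ _ (by positivity) (by positivity)
    · linarith
    · linarith
  have k2 : (A * (1 + Y2) ^ 6 * X2) * ((R * E1 ^ 24 * y ^ 6) * (R ^ 4 * E4 ^ 24 * (4 * y) ^ 6)) =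
      (R ^ 2 * (2 * y) ^ 6) * ((y * (1 + Y2)) ^ 6 * R ^ 3 * (A * X2 * (E1 ^ 24 * E4 ^ 24) * 2 ^ 6)) := by ring
  rw [k2] at k1
  have k3 : E2 ^ 24 * (a ^ 2 * X1 * X4) ≤ (y * (1 + Y2)) ^ 6 * R ^ 3 * (A * X2 * (E1 ^ 24 * E4 ^ 24) * 2 ^ 6) := by
    have hp : 0 < R ^ 2 * (2 * y) ^ 6 := by positivity
    refine le_of_mul_le_mul_left ?_ hp
    linarith
  have k4 : (y * (1 + Y2)) ^ 6 * R ^ 3 * (A * X2 * (E1 ^ 24 * E4 ^ 24) * 2 ^ 6) ≤ 3 ^ 6 * 1 * (A * X2 * (E1 ^ 24 * E4 ^ 24) * 2 ^ 6) := by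
    have hR3 : R ^ 3 ≤ 1 := pow_le_one₀ hR0.le hR
    gcongr
  have k5 := k3.trans k4
  rw [← le_div_iff₀ (by positivity)] at k5
  refine k5.trans (le_of_eq ?_)
  field_simp
  norm_num

end M2R

namespace M2R
open Filter Topology Set
open Complex (I)

lemma NN_neg (x y : ℝ) (c d : ℤ) : NN x y (-c) (-d) = NN x y c d := by
  unfold NN; push_cast; ring

lemma NN_smul (x y : ℝ) (m c d : ℤ) : NN x y (m * c) (m * d) = m ^ 2 * NN x y c d := by
  unfold NN; push_cast; ring

lemma NN_nonneg (x y : ℝ) (c d : ℤ) : 0 ≤ NN x y c d := by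
  unfold NN; positivity

lemma NN_ge (x y : ℝ) (c d : ℤ) : (c : ℝ) ^ 2 ≤ NN x y c d := by
  unfold NN
  have : 0 ≤ (((c : ℝ) * x + d) / y) ^ 2 := by positivity
  linarith

lemma NN_det {x y : ℝ} (hy : 0 < y) {c d c' d' : ℤ} (h : c * d' - c' * d ≠ 0) :
    1 ≤ y ^ 2 * NN x y c d * NN x y c' d' := by
  have h1 : (1 : ℝ) ≤ ((c : ℝ) * d' - c' * d) ^ 2 := by
    have : (1 : ℤ) ≤ (c * d' - c' * d) ^ 2 := by
      have : 0 < (c * d' - c' * d) ^ 2 := by positivity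
      omega
    exact_mod_cast this
  refine h1.trans ?_
  unfold NN
  have e : y ^ 2 * ((c : ℝ) ^ 2 + ((c * x + d) / y) ^ 2) * ((c' : ℝ) ^ 2 + ((c' * x + d') / y) ^ 2) =
      ((c : ℝ) * d' - c' * d) ^ 2 + (c * c' * y + (c * x + d) * (c' * x + d') / y) ^ 2 := by
    field_simp
    ring
  rw [e]
  nlinarith [sq_nonneg ((c : ℝ) * c' * y + (c * x + d) * (c' * x + d') / y)]

lemma parallel {c0 d0 c d : ℤ} (h0 : IsCoprime c0 d0) (hc : 0 < c0) (h : c * d0 = d * c0) :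
    ∃ m : ℤ, c = m * c0 ∧ d = m * d0 := by
  have h1 : c0 ∣ c * d0 := ⟨d, by rw [h]; ring⟩
  obtain ⟨m, hm⟩ := h0.dvd_of_dvd_mul_right h1
  refine ⟨m, by rw [hm]; ring, ?_⟩
  have : c0 * (d - m * d0) = 0 := by rw [hm] at h; linear_combination -h
  rcases mul_eq_zero.mp this with h2 | h2
  · omega
  · linarith

lemma coprime_ne {c d : ℤ} (h : IsCoprime c d) : c ≠ 0 ∨ d ≠ 0 := by
  by_contra hh
  push Not at hh
  rw [hh.1, hh.2] at h
  exact absurd h (by simp [IsCoprime])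

/-- bound on the contribution of a vector in terms of a minimal vector -/
lemma vec_bound {x y N : ℝ} (hy : 0 < y) {c0 d0 : ℤ} (h0 : IsCoprime c0 d0) (hc : 0 < c0) (hN : NN x y c0 d0 < N)
    {c d : ℤ} (hcd : c ≠ 0 ∨ d ≠ 0) (s : ℤ) (hs : ∀ m : ℤ, c = m * c0 → d = m * d0 → s ^ 2 ≤ m ^ 2) (hs0 : 0 < s) :
    1 / NN x y c d ≤ 1 / (s ^ 2 * NN x y c0 d0) + N * y ^ 2 := by
  have hN0 : 0 < NN x y c0 d0 := by
    have h1 := NN_ge x y c0 d0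
    have : (0 : ℝ) < (c0 : ℝ) ^ 2 := by positivity
    linarith
  have hs' : (0 : ℝ) < s := by exact_mod_cast hs0
  by_cases hp : c * d0 = d * c0
  · obtain ⟨m, h1, h2⟩ := parallel h0 hc hp
    have h3 := hs m h1 h2
    have h3' : (s : ℝ) ^ 2 ≤ (m : ℝ) ^ 2 := by exact_mod_cast h3
    rw [h1, h2, NN_smul]
    have : 1 / ((m : ℝ) ^ 2 * NN x y c0 d0) ≤ 1 / (s ^ 2 * NN x y c0 d0) := by
      apply one_div_le_one_div_of_le (by positivity)
      gcongr
    have : 0 ≤ N * y ^ 2 := by have : 0 < N := by linarith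
                               positivity
    linarith
  · have hdet : c * d0 - c0 * d ≠ 0 := by
      intro h; apply hp; linarith
    have h1 := NN_det (x := x) hy hdet
    have hNp : 0 < NN x y c d := by
      rcases (NN_nonneg x y c d).lt_or_eq with h | h
      · exact h
      · rw [← h] at h1; norm_num at h1
    have : 1 / NN x y c d ≤ N * y ^ 2 := by
      rw [div_le_iff₀ hNp]
      refine h1.trans ?_
      have : y ^ 2 * NN x y c d * NN x y c0 d0 ≤ y ^ 2 * NN x y c d * N := by gcongr
      linarith
    have : 0 ≤ 1 / ((s : ℝ) ^ 2 * NN x y c0 d0) := by positivity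
    linarith

theorem P_cases : ∃ K : ℝ, 0 < K ∧ ∀ x y : ℝ, 0 < y → y ≤ 1 / 2500 →
    (‖(theta (Complex.exp (2 * Real.pi * I * (x + y * I))))⁻¹‖ ^ 24 ≤ K * Real.exp (2 * Real.pi / y * 0.0295)) ∨
    (∃ c0 d0 : ℤ, IsCoprime c0 d0 ∧ (c0 = 1 ∨ c0 = 3 ∨ c0 = 5) ∧ NN x y c0 d0 < 26 ∧
      ‖(theta (Complex.exp (2 * Real.pi * I * (x + y * I))))⁻¹‖ ^ 24 ≤ K * Real.exp (2 * Real.pi / y * (3 / (4 * NN x y c0 d0) + 1400 * y ^ 2))) ∨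
    (∃ c0 d0 : ℤ, IsCoprime c0 d0 ∧ (c0 = 4 ∨ c0 = 8) ∧ NN x y c0 d0 < 104 ∧
      ‖(theta (Complex.exp (2 * Real.pi * I * (x + y * I))))⁻¹‖ ^ 24 ≤ K * Real.exp (2 * Real.pi / y * (3 / NN x y c0 d0 + 1400 * y ^ 2))) := by
  obtain ⟨K, hK, hP⟩ := P_bound
  have hpi := Real.pi_pos
  refine ⟨K, hK, fun x y hy hy1 => ?_⟩
  obtain ⟨c1, d1, c4, d4, hv1, hv4, hb⟩ := hP x y hy (by linarith)
  have hy2 : y ^ 2 ≤ 1 / 6250000 := by nlinarith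
  set P := ‖(theta (Complex.exp (2 * Real.pi * I * (x + y * I))))⁻¹‖ ^ 24
  have mono : ∀ {A B : ℝ}, A ≤ B → K * Real.exp (2 * Real.pi / y * A) ≤ K * Real.exp (2 * Real.pi / y * B) := by
    intro A B h; gcongr
  have hv4' : 4 * c4 ≠ 0 ∨ d4 ≠ 0 := by
    rcases coprime_ne hv4 with h | h
    · left; omega
    · right; exact h
  by_cases hex : ∃ c0 d0 : ℤ, IsCoprime c0 d0 ∧ NN x y c0 d0 < 280
  swap
  · left
    push Not at hex
    have hN1 : 1 ≤ NN x y (2 * 0) 1 := by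
      have := hex 0 1 (by simp [isCoprime_zero_left])
      simp only [mul_zero]; linarith
    refine (hb 0 1 (by simp [isCoprime_zero_left]) hN1).trans (mono ?_)
    have a1 : 1 / NN x y c1 d1 ≤ 1 / 280 := one_div_le_one_div_of_le (by norm_num) (hex _ _ hv1)
    have a2 : 4 / NN x y (4 * c4) d4 ≤ 4 / 280 := by
      have hg : (0 : ℤ) < Int.gcd (4 * c4) d4 := by
        have : Int.gcd (4 * c4) d4 ≠ 0 := by
          rw [Ne, Int.gcd_eq_zero_iff]; tauto
        positivity
      obtain ⟨m, a, b, hm, hab, ha, hb'⟩ : ∃ m a b : ℤ, 0 < m ∧ IsCoprime a b ∧ 4 * c4 = m * a ∧ d4 = m * b := by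
        obtain ⟨a, b, h1, h2, h3⟩ := Int.exists_gcd_one (m := 4 * c4) (n := d4) (by exact_mod_cast hg)
        exact ⟨_, a, b, hg, Int.isCoprime_iff_gcd_eq_one.mpr h1, by linarith, by linarith⟩
      have h280 : 280 ≤ NN x y (4 * c4) d4 := by
        rw [ha, hb', NN_smul]
        have h1 := hex a b hab
        have h2 : (1 : ℝ) ≤ m := by exact_mod_cast hm
        have h3 : (1 : ℝ) ≤ (m : ℝ) ^ 2 := one_le_pow₀ h2
        nlinarith
      exact div_le_div_of_nonneg_left (by norm_num) (by norm_num) h280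
    have a3 : 0 ≤ 2 / NN x y (2 * 0) 1 := by positivity
    norm_num at a1 a2 a3 ⊢
    linarith
  · obtain ⟨c0, d0, h0, hN, hc⟩ : ∃ c0 d0 : ℤ, IsCoprime c0 d0 ∧ NN x y c0 d0 < 280 ∧ 0 < c0 := by
      obtain ⟨c, d, h, hN⟩ := hex
      rcases lt_trichotomy c 0 with hc | hc | hc
      · exact ⟨-c, -d, h.neg_neg, by rwa [NN_neg], by omega⟩
      · exfalso
        rw [hc, isCoprime_zero_left, Int.isUnit_iff] at h
        have hd : ((d : ℝ)) ^ 2 = 1 := by rcases h with h | h <;> simp [h]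
        have : NN x y c d = 1 / y ^ 2 := by
          unfold NN; rw [hc]; push_cast
          rw [show ((0 : ℝ) * x + d) = d by ring, div_pow, hd]; ring
        rw [this, div_lt_iff₀ (by positivity)] at hN
        nlinarith
      · exact ⟨c, d, h, hN, hc⟩
    have hN0 : (c0 : ℝ) ^ 2 ≤ NN x y c0 d0 := NN_ge _ _ _ _
    have hc0 : (1 : ℝ) ≤ c0 := by exact_mod_cast hc
    have hNp : 1 ≤ NN x y c0 d0 := by nlinarith
    have b1 := vec_bound hy h0 hc hN (coprime_ne hv1) 1 (by
      intro m h1 h2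
      have : m ≠ 0 := by
        rintro rfl
        simp at h1 h2
        rcases coprime_ne hv1 with h | h <;> contradiction
      have : 0 < m ^ 2 := by positivity
      omega) (by norm_num)
    have mne : ∀ m : ℤ, 4 * c4 = m * c0 → d4 = m * d0 → m ≠ 0 := by
      rintro m h1 h2 rfl
      simp at h1 h2
      rcases hv4' with h | h <;> omega
    rcases Int.even_or_odd c0 with hev | hod
    · obtain ⟨e, he⟩ := hev
      have hcop : IsCoprime e d0 := by
        rw [he, ← two_mul] at h0
        exact h0.of_mul_left_right
      have hee : 2 * e = c0 := by omega
      have P2 := hb e d0 hcop (by rw [hee]; exact hNp)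
      rw [hee] at P2
      rcases Int.even_or_odd e with hev2 | hod2
      · have b4 := vec_bound hy h0 hc hN hv4' 1 (by
          intro m h1 h2
          have := mne m h1 h2
          have : 0 < m ^ 2 := by positivity
          omega) (by norm_num)
        have E : 1 / NN x y c1 d1 + 4 / NN x y (4 * c4) d4 - 2 / NN x y c0 d0 ≤ 3 / NN x y c0 d0 + 1400 * y ^ 2 := by
          push_cast at b1 b4
          rw [one_pow, one_mul] at b1 b4
          have r1 : 4 / NN x y (4 * c4) d4 = 4 * (1 / NN x y (4 * c4) d4) := by ring
          have r2 : 2 / NN x y c0 d0 = 2 * (1 / NN x y c0 d0) := by ring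
          have r3 : 3 / NN x y c0 d0 = 3 * (1 / NN x y c0 d0) := by ring
          rw [r1, r2, r3]; linarith
        by_cases h104 : NN x y c0 d0 < 104
        · right; right
          refine ⟨c0, d0, h0, ?_, h104, P2.trans (mono E)⟩
          have : (c0 : ℝ) ^ 2 < 11 ^ 2 := by linarith
          have : (c0 : ℝ) < 11 := lt_of_pow_lt_pow_left₀ 2 (by norm_num) this
          have : c0 < 11 := by exact_mod_cast this
          obtain ⟨f, hf⟩ := hev2
          omega
        · left
          push Not at h104
          refine P2.trans (mono (E.trans ?_))
          have : 3 / NN x y c0 d0 ≤ 3 / 104 := div_le_div_of_nonneg_left (by norm_num) (by norm_num) h104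
          norm_num at this ⊢
          linarith
      · left
        have b4 := vec_bound hy h0 hc hN hv4' 2 (by
          intro m h1 h2
          have := mne m h1 h2
          have hme : Even m := by
            have : 2 * c4 = m * e := by rw [he] at h1; linarith
            have h3 : Even (m * e) := ⟨c4, by linarith⟩
            rcases Int.even_mul.mp h3 with h | h
            · exact h
            · exact absurd h (by simpa using hod2)
          obtain ⟨k, rfl⟩ := hme
          have : k ≠ 0 := by omega
          have : 0 < k ^ 2 := by positivity
          nlinarith) (by norm_num)
        refine P2.trans (mono ?_)
        have r1 : 4 / NN x y (4 * c4) d4 = 4 * (1 / NN x y (4 * c4) d4) := by ring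
        have r2 : 2 / NN x y c0 d0 = 2 * (1 / NN x y c0 d0) := by ring
        push_cast at b1 b4
        rw [one_pow, one_mul] at b1
        have r3 : 1 / (2 ^ 2 * NN x y c0 d0) = 1 / 4 * (1 / NN x y c0 d0) := by field_simp; norm_num
        rw [r3] at b4
        rw [r1, r2]
        norm_num at *
        linarith
    · have hcop : IsCoprime c0 (2 * d0) := by
        refine IsCoprime.mul_right ?_ h0
        exact (Int.isCoprime_iff_gcd_eq_one.mpr (by
          have := Int.odd_iff.mp hod
          rw [Int.gcd_comm]
          exact Int.isCoprime_iff_gcd_eq_one.mp ⟨-(c0 / 2), 1, by omega⟩))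
      have P2 := hb c0 (2 * d0) hcop (by rw [NN_smul]; push_cast; linarith)
      rw [NN_smul] at P2
      have b4 := vec_bound hy h0 hc hN hv4' 4 (by
          intro m h1 h2
          have hm0 := mne m h1 h2
          have hdvd : (4 : ℤ) ∣ m := by
            have h4 : (4 : ℤ) ∣ m * c0 := ⟨c4, h1.symm⟩
            have hc4 : IsCoprime (4 : ℤ) c0 := by
              have : IsCoprime (2 : ℤ) c0 := by
                have := Int.odd_iff.mp hod
                exact ⟨-(c0 / 2), 1, by omega⟩
              rw [show (4 : ℤ) = 2 * 2 by norm_num]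
              exact this.mul_left this
            exact hc4.dvd_of_dvd_mul_right h4
          obtain ⟨k, rfl⟩ := hdvd
          have : k ≠ 0 := by omega
          have : 0 < k ^ 2 := by positivity
          nlinarith) (by norm_num)
      have E : 1 / NN x y c1 d1 + 4 / NN x y (4 * c4) d4 - 2 / (((2 : ℤ) : ℝ) ^ 2 * NN x y c0 d0) ≤ 3 / (4 * NN x y c0 d0) + 1400 * y ^ 2 := by
        push_cast at b1 b4 ⊢
        rw [one_pow, one_mul] at b1
        have r0 : 1 / (4 ^ 2 * NN x y c0 d0) = 1 / 16 * (1 / NN x y c0 d0) := by field_simp; norm_num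
        have r1 : 4 / NN x y (4 * c4) d4 = 4 * (1 / NN x y (4 * c4) d4) := by ring
        have r2 : 2 / (2 ^ 2 * NN x y c0 d0) = 1 / 2 * (1 / NN x y c0 d0) := by field_simp
        have r3 : 3 / (4 * NN x y c0 d0) = 3 / 4 * (1 / NN x y c0 d0) := by field_simp
        rw [r0] at b4
        rw [r1, r2, r3]; linarith
      by_cases h26 : NN x y c0 d0 < 26
      · right; left
        refine ⟨c0, d0, h0, ?_, h26, P2.trans (mono E)⟩
        have : (c0 : ℝ) ^ 2 < 6 ^ 2 := by linarith
        have : (c0 : ℝ) < 6 := lt_of_pow_lt_pow_left₀ 2 (by norm_num) this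
        have : c0 < 6 := by exact_mod_cast this
        have := Int.odd_iff.mp hod
        omega
      · left
        push Not at h26
        refine P2.trans (mono (E.trans ?_))
        have : 3 / (4 * NN x y c0 d0) ≤ 3 / (4 * 26) := div_le_div_of_nonneg_left (by norm_num) (by norm_num) (by linarith)
        norm_num at this ⊢
        linarith

end M2R

namespace M2R
open Filter Topology Set
open Complex (I)

lemma tsum_natAbs_le {r : ℝ} (h0 : 0 ≤ r) (h1 : r < 1) : ∑' n : ℤ, r ^ n.natAbs ≤ 2 / (1 - r) := by
  have hs := summable_geometric_of_lt_one h0 h1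
  have ha : HasSum (fun n : ℤ => r ^ n.natAbs) ((1 - r)⁻¹ + (1 - r)⁻¹ - 1) := by
    have := HasSum.of_nat_of_neg (f := fun n : ℤ => r ^ n.natAbs) (by simpa using hasSum_geometric_of_lt_one h0 h1) (by simpa using hasSum_geometric_of_lt_one h0 h1)
    simpa using this
  rw [ha.tsum_eq, div_eq_mul_inv]
  linarith

lemma one_sub_exp {u : ℝ} (h0 : 0 < u) (h1 : u ≤ 1) : u / 2 ≤ 1 - Real.exp (-u) := by
  have h2 := Real.add_one_le_exp u
  rw [Real.exp_neg]
  have : (Real.exp u)⁻¹ ≤ (u + 1)⁻¹ := inv_anti₀ (by linarith) h2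
  have h3 : (u + 1)⁻¹ ≤ 1 - u / 2 := by
    rw [inv_le_iff_one_le_mul₀ (by linarith)]
    nlinarith
  linarith

theorem f_triv : ∃ C : ℝ, 0 < C ∧ ∀ x y : ℝ, 0 < y → y ≤ 1 / 2500 →
    ‖fq (Complex.exp (2 * Real.pi * I * (x + y * I))) zt‖ ≤ C / y ^ 2 := by
  refine ⟨‖(1 - zt)⁻¹‖ + 8, by positivity, fun x y hy hy1 => ?_⟩
  have hpi := Real.pi_gt_three
  have hpi4 := Real.pi_lt_four
  set q := Complex.exp (2 * Real.pi * I * (x + y * I)) with hq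
  have hqn : ‖q‖ = Real.exp (-(2 * Real.pi * y)) := by
    rw [hq, Complex.norm_exp]; congr 1; simp
  set u := 2 * Real.pi * y with hu
  have hu0 : 0 < u := by positivity
  have hu1 : u ≤ 1 := by rw [hu]; nlinarith
  have hr := one_sub_exp hu0 hu1
  rw [← hqn] at hr
  have hq1 : ‖q‖ < 1 := by linarith
  have hq0 : q ≠ 0 := Complex.exp_ne_zero _
  rw [fq_eq hq1 hq0 (zt_annul hq1)]
  have hq2 : 1 * ‖q‖ ^ 2 < 1 := by
    rw [one_mul]; exact pow_lt_one₀ (norm_nonneg _) hq1 (by norm_num)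
  have hb := fun n => fterm_bound hq1 hq0 zt_ne_zero (ρ := 1) (R := 1) (by rw [norm_inv, zt_norm, inv_one]) hq2 (by rw [zt_norm]) hq2 n
  have hm : u / 2 ≤ min (1 - 1 * ‖q‖ ^ 2) (1 - 1 * ‖q‖ ^ 2) := by
    rw [min_self]
    have : ‖q‖ ^ 2 ≤ ‖q‖ := by nlinarith [norm_nonneg q]
    linarith
  have hs := summable_natAbs (norm_nonneg q) hq1
  have h0 : ‖fq0 q zt‖ ≤ (u / 2)⁻¹ * (2 / (1 - ‖q‖)) := by
    unfold fq0
    refine (tsum_of_norm_bounded ((hs.mul_left (u / 2)⁻¹).hasSum) (fun n => (hb n).trans ?_)).trans ?_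
    · apply mul_le_mul _ (norm_th_le hq1 n) (norm_nonneg _) (by positivity)
      exact inv_anti₀ (by positivity) hm
    · rw [tsum_mul_left]
      have := tsum_natAbs_le (norm_nonneg q) hq1
      gcongr
  have h1 : (u / 2)⁻¹ * (2 / (1 - ‖q‖)) ≤ (u / 2)⁻¹ * (2 / (u / 2)) := by
    gcongr
  have h2 : (u / 2)⁻¹ * (2 / (u / 2)) ≤ 8 / y ^ 2 := by
    have : (u / 2)⁻¹ * (2 / (u / 2)) = 8 / u ^ 2 := by field_simp; norm_num
    rw [this]
    have : y ≤ u := by rw [hu]; nlinarith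
    gcongr
  have h3 : ‖(1 - zt)⁻¹‖ ≤ ‖(1 - zt)⁻¹‖ / y ^ 2 := by
    rw [le_div_iff₀ (by positivity)]
    have : y ^ 2 ≤ 1 := by nlinarith
    nlinarith [norm_nonneg ((1 - zt)⁻¹)]
  refine (norm_add_le _ _).trans ?_
  rw [add_div]
  linarith

lemma root24 {P K Z : ℝ} (hK : 0 < K) (h : P ^ 24 ≤ K * Real.exp (24 * Z)) : P ≤ (1 + K) * Real.exp Z := by
  have h1 : K * Real.exp (24 * Z) ≤ ((1 + K) * Real.exp Z) ^ 24 := by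
    rw [mul_pow, ← Real.exp_nat_mul]
    push_cast
    gcongr
    have : 1 + K ≤ (1 + K) ^ 24 := le_self_pow₀ (by linarith) (by norm_num)
    linarith
  exact le_of_pow_le_pow_left₀ (n := 24) (by norm_num) (by positivity) (h.trans h1)

theorem f_arc (k K : ℕ) (hK2 : 2 ≤ K) (h5 : ¬ 5 ∣ K) (hkK : (k = K ∧ Odd K) ∨ (k = 2 * K ∧ Even K)) :
    ∃ C : ℝ, 0 < C ∧ ∀ (x y : ℝ) (d : ℤ), 0 < y → y ≤ 1 / 2500 → (k = 2 * K → Odd d) → NN x y k d < 104 → ((k * x + d) / y) ^ 2 ≤ (5 * k) ^ 2 →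
      ‖fq (Complex.exp (2 * Real.pi * I * (x + y * I))) zt‖ ≤ C / y ^ 2 * Real.exp (Real.pi / (12 * y) * (-(3 * k ^ 2 / (4 * K ^ 2)) / NN x y k d + 3 / 400)) := by
  have hpi := Real.pi_gt_three
  have hpi4 := Real.pi_lt_four
  have H : ∀ h : ℕ, ∃ C : ℝ, 0 < C ∧ (Good h k K → ∀ t : ℂ, 0 < t.re → t.re ≤ 1 → |t.im| ≤ 5 * t.re →
    1 ≤ Real.pi ^ 2 / (5 * K ^ 2) * (t⁻¹).re → ‖fq (qf h k t) zt‖ ≤ C / t.re * Real.exp (Real.pi ^ 2 * (t⁻¹).re * (-1 / (8 * K ^ 2) + 1 / 800))) := by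
    intro h
    by_cases hg : Good h k K
    · obtain ⟨C, hC, hb⟩ := f_near_bound hg hK2 h5
      exact ⟨C, hC, fun _ => hb⟩
    · exact ⟨1, one_pos, fun hh => absurd hh hg⟩
  choose C hC hb using H
  have hk0 : 0 < k := by rcases hkK with h | h <;> omega
  have hkK' : K ≤ k := by rcases hkK with h | h <;> omega
  have hS : ∀ h ∈ Finset.range k, C h ≤ ∑ h ∈ Finset.range k, C h := fun h hh =>
    Finset.single_le_sum (fun i _ => (hC i).le) hh
  have hK0 : (0 : ℝ) < K := by exact_mod_cast (by omega : 0 < K)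
  have hk0' : (0 : ℝ) < k := by exact_mod_cast hk0
  have hSp : 0 < ∑ h ∈ Finset.range k, C h := Finset.sum_pos (fun i _ => hC i) ⟨0, by simpa using hk0⟩
  refine ⟨∑ h ∈ Finset.range k, C h, hSp, fun x y d hy hy1 hd hN hsec => ?_⟩
  obtain ⟨h, j, hhk, hj⟩ : ∃ (h : ℕ) (j : ℤ), h < k ∧ -d = h + k * j := by
    refine ⟨((-d) % k).toNat, (-d) / k, ?_, ?_⟩
    · have := Int.emod_lt_of_pos (-d) (by exact_mod_cast hk0 : (0 : ℤ) < k)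
      have := Int.emod_nonneg (-d) (by exact_mod_cast hk0.ne' : (k : ℤ) ≠ 0)
      omega
    · rw [Int.toNat_of_nonneg (Int.emod_nonneg (-d) (by exact_mod_cast hk0.ne' : (k : ℤ) ≠ 0))]
      exact (Int.emod_add_mul_ediv _ _).symm
  set t : ℂ := ⟨2 * Real.pi * y, -(2 * Real.pi * (x + d / k))⟩ with ht
  have htre : t.re = 2 * Real.pi * y := rfl
  have htim : t.im = -(2 * Real.pi * (x + d / k)) := rfl
  have hgood : Good h k K := by
    refine ⟨by omega, ?_⟩
    rcases hkK with h1 | h1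
    · exact Or.inl h1
    · right
      refine ⟨h1.1, h1.2, ?_⟩
      obtain ⟨a, ha⟩ := hd h1.1
      rw [← Int.odd_coe_nat]
      refine ⟨-a - 1 - K * j, ?_⟩
      have : (k : ℤ) = 2 * K := by exact_mod_cast h1.1
      rw [this] at hj
      linarith
  have hq : Complex.exp (2 * Real.pi * I * (x + y * I)) = qf h k t := by
    unfold qf
    have hjC : (-(d : ℂ)) = h + k * j := by exact_mod_cast hj
    have e : 2 * Real.pi * I * h / k - t = 2 * Real.pi * I * (x + y * I) + (-j : ℤ) * (2 * Real.pi * I) := by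
      have hkC : (k : ℂ) ≠ 0 := by exact_mod_cast hk0.ne'
      have htt : t = 2 * Real.pi * y - 2 * Real.pi * (x + d / k) * I := by
        apply Complex.ext
        · simp [htre, Complex.div_natCast_re, Complex.div_natCast_im]
        · simp [htim, Complex.div_natCast_re, Complex.div_natCast_im]
      rw [htt]
      have hd' : (d : ℂ) = -h - k * j := by linear_combination -hjC
      rw [hd']
      push_cast
      field_simp
      linear_combination (-(y : ℂ) * k) * Complex.I_sq
    rw [e, Complex.exp_add, Complex.exp_int_mul_two_pi_mul_I, mul_one]
  have hN0 : 0 < NN x y k d := by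
    have := NN_ge x y k d
    have : (0 : ℝ) < ((k : ℤ) : ℝ) ^ 2 := by positivity
    linarith
  have hR : (t⁻¹).re = k ^ 2 / (2 * Real.pi * y * NN x y k d) := by
    rw [Complex.inv_re, Complex.normSq_apply, htre, htim]
    have hN' : NN x y k d = ((k * y) ^ 2 + (k * x + d) ^ 2) / y ^ 2 := by
      unfold NN; push_cast; field_simp
    have hne : 0 < (k * y) ^ 2 + (k * x + d) ^ 2 := by positivity
    rw [hN']
    have e2 : 2 * Real.pi * y * (2 * Real.pi * y) + -(2 * Real.pi * (x + d / k)) * -(2 * Real.pi * (x + d / k)) = (2 * Real.pi) ^ 2 * ((k * y) ^ 2 + (k * x + d) ^ 2) / k ^ 2 := by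
      field_simp
    rw [e2]
    field_simp
  have him : |t.im| ≤ 5 * t.re := by
    rw [htim, htre, abs_neg, abs_mul, abs_of_pos (by positivity : 0 < 2 * Real.pi)]
    have h1 := abs_le_of_sq_le_sq hsec (by positivity)
    rw [abs_div, abs_of_pos hy, div_le_iff₀ hy] at h1
    have h2 : x + d / k = (k * x + d) / k := by field_simp
    rw [h2, abs_div, abs_of_pos hk0']
    have h3 : |k * x + d| / k ≤ 5 * y := by
      rw [div_le_iff₀ hk0']; linarith
    nlinarith
  have hcond : 1 ≤ Real.pi ^ 2 / (5 * K ^ 2) * (t⁻¹).re := by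
    rw [hR]
    have hkK'' : (K : ℝ) ≤ k := by exact_mod_cast hkK'
    have e3 : Real.pi ^ 2 / (5 * K ^ 2) * (k ^ 2 / (2 * Real.pi * y * NN x y k d)) = (k / K) ^ 2 * (Real.pi / (10 * y * NN x y k d)) := by
      field_simp
      norm_num
    rw [e3]
    have h1 : 1 ≤ (k / K : ℝ) := by rw [le_div_iff₀ hK0]; linarith
    have h2 : 1 ≤ Real.pi / (10 * y * NN x y k d) := by
      rw [le_div_iff₀ (by positivity)]
      nlinarith
    exact one_le_mul_of_one_le_of_one_le (one_le_pow₀ h1) h2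
  have F := hb h hgood t (by rw [htre]; positivity) (by rw [htre]; nlinarith) him hcond
  rw [hq]
  refine F.trans ?_
  rw [htre]
  have hCS := hS h (by simpa using hhk)
  apply mul_le_mul _ _ (Real.exp_pos _).le (by positivity)
  · have : y ^ 2 ≤ 2 * Real.pi * y := by nlinarith
    have := (hC h).le
    gcongr
  · apply Real.exp_le_exp.mpr
    rw [hR]
    have hNk := NN_ge x y k d
    push_cast at hNk
    have e4 : Real.pi ^ 2 * (k ^ 2 / (2 * Real.pi * y * NN x y k d)) * (-1 / (8 * K ^ 2) + 1 / 800) =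
        Real.pi / (12 * y) * (-(3 * k ^ 2 / (4 * K ^ 2)) / NN x y k d + 3 / 400 * (k ^ 2 / NN x y k d)) := by
      field_simp
      ring
    rw [e4]
    have : (k : ℝ) ^ 2 / NN x y k d ≤ 1 := by rw [div_le_one hN0]; exact hNk
    gcongr
    linarith

theorem GG_minor : ∃ C : ℝ, 0 < C ∧ ∀ x y : ℝ, 0 < y → y ≤ 1 / 2500 → (∃ j : ℤ, |x - j / 5| < 5 * y) ∨
    ‖GG (Complex.exp (2 * Real.pi * I * (x + y * I)))‖ ≤ C / y ^ 2 * Real.exp (Real.pi / (12 * y) * 0.0295) := by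
  obtain ⟨K, hK, hP⟩ := P_cases
  obtain ⟨C0, hC0, hf0⟩ := f_triv
  obtain ⟨C3, hC3, hf3⟩ := f_arc 3 3 (by norm_num) (by norm_num) (Or.inl ⟨rfl, by decide⟩)
  obtain ⟨C4, hC4, hf4⟩ := f_arc 4 2 (by norm_num) (by norm_num) (Or.inr ⟨rfl, by decide⟩)
  obtain ⟨C8, hC8, hf8⟩ := f_arc 8 4 (by norm_num) (by norm_num) (Or.inr ⟨rfl, by decide⟩)
  have hpi := Real.pi_pos
  have hz : ‖1 - zt‖ ≤ 2 := by
    refine (norm_sub_le _ _).trans ?_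
    rw [zt_norm, norm_one]; norm_num
  refine ⟨2 * (C0 + C3 + C4 + C8) * (1 + K), by positivity, fun x y hy hy1 => ?_⟩
  set q := Complex.exp (2 * Real.pi * I * (x + y * I)) with hq
  have hy2 : y ^ 2 ≤ 1 / 6250000 := by nlinarith
  -- combination
  have comb : ∀ (C A B : ℝ), 0 < C → C ≤ C0 + C3 + C4 + C8 → A + B ≤ 0.0295 → ‖fq q zt‖ ≤ C / y ^ 2 * Real.exp (Real.pi / (12 * y) * A) →
      ‖(theta q)⁻¹‖ ^ 24 ≤ K * Real.exp (2 * Real.pi / y * B) →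
      ‖GG q‖ ≤ 2 * (C0 + C3 + C4 + C8) * (1 + K) / y ^ 2 * Real.exp (Real.pi / (12 * y) * 0.0295) := by
    intro C A B hC hCle hAB hf hth
    have hth' := root24 (Z := Real.pi / (12 * y) * B) hK (by
      rw [show 24 * (Real.pi / (12 * y) * B) = 2 * Real.pi / y * B by field_simp; ring]
      exact hth)
    unfold GG
    rw [div_eq_mul_inv, norm_mul, norm_mul]
    calc ‖1 - zt‖ * ‖fq q zt‖ * ‖(theta q)⁻¹‖ ≤ 2 * (C / y ^ 2 * Real.exp (Real.pi / (12 * y) * A)) * ((1 + K) * Real.exp (Real.pi / (12 * y) * B)) := by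
          gcongr
      _ = 2 * C * (1 + K) / y ^ 2 * Real.exp (Real.pi / (12 * y) * (A + B)) := by
          rw [mul_add (Real.pi / (12 * y)), Real.exp_add]; ring
      _ ≤ _ := by gcongr
  rcases hP x y hy hy1 with h | ⟨c0, d0, hcop, hc, hN, hth⟩ | ⟨c0, d0, hcop, hc, hN, hth⟩
  · right
    refine comb C0 0 0.0295 hC0 (by linarith) (by norm_num) ?_ h
    simpa using hf0 x y hy hy1
  · rcases hc with rfl | rfl | rfl
    · left
      refine ⟨-5 * d0, ?_⟩
      unfold NN at hN
      push_cast at hN ⊢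
      have h1 : ((1 * x + d0) / y) ^ 2 < 5 ^ 2 := by linarith
      have h2 := abs_lt_of_sq_lt_sq h1 (by norm_num)
      rw [abs_div, abs_of_pos hy, div_lt_iff₀ hy] at h2
      rw [show x - -5 * (d0 : ℝ) / 5 = 1 * x + d0 by ring]
      exact h2
    · right
      have hs := hf3 x y d0 hy hy1 (by norm_num) (by
        have : NN x y ((3 : ℕ) : ℤ) d0 < 26 := by exact_mod_cast hN
        linarith) (by
        unfold NN at hN
        push_cast at hN ⊢
        linarith)
      refine comb C3 _ _ hC3 (by linarith) ?_ hs hth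
      push_cast
      have hNp : 0 < NN x y 3 d0 := by
        have := NN_ge x y 3 d0
        push_cast at this
        linarith
      have : -(3 * 3 ^ 2 / (4 * 3 ^ 2)) / NN x y 3 d0 = - (3 / (4 * NN x y 3 d0)) := by field_simp
      rw [this]
      norm_num
      linarith
    · left
      refine ⟨-d0, ?_⟩
      unfold NN at hN
      push_cast at hN ⊢
      have h1 : ((5 * x + d0) / y) ^ 2 ≤ 1 ^ 2 := by linarith
      have h2 := abs_le_of_sq_le_sq h1 (by norm_num)
      rw [abs_div, abs_of_pos hy, div_le_iff₀ hy] at h2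
      rw [show x - -(d0 : ℝ) / 5 = (5 * x + d0) / 5 by ring, abs_div, abs_of_pos (by norm_num : (0 : ℝ) < 5)]
      linarith
  · right
    rcases hc with rfl | rfl
    · have hodd : Odd d0 := by
        obtain ⟨a, b, h⟩ := hcop
        rcases Int.even_or_odd d0 with ⟨e, he⟩ | h1
        · exfalso; rw [he] at h
          have : 2 * (2 * a + b * e) = 1 := by linarith
          omega
        · exact h1
      have hs := hf4 x y d0 hy hy1 (fun _ => hodd) (by exact_mod_cast hN) (by
        unfold NN at hN
        push_cast at hN ⊢
        linarith)
      refine comb C4 _ _ hC4 (by linarith) ?_ hs hth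
      push_cast
      have hNp : 0 < NN x y 4 d0 := by
        have := NN_ge x y 4 d0
        push_cast at this
        linarith
      have : -(3 * 4 ^ 2 / (4 * 2 ^ 2)) / NN x y 4 d0 = - (3 / NN x y 4 d0) := by field_simp; norm_num
      rw [this]
      norm_num
      linarith
    · have hodd : Odd d0 := by
        obtain ⟨a, b, h⟩ := hcop
        rcases Int.even_or_odd d0 with ⟨e, he⟩ | h1
        · exfalso; rw [he] at h
          have : 2 * (4 * a + b * e) = 1 := by linarith
          omega
        · exact h1
      have hs := hf8 x y d0 hy hy1 (fun _ => hodd) (by exact_mod_cast hN) (by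
        unfold NN at hN
        push_cast at hN ⊢
        linarith)
      refine comb C8 _ _ hC8 (by linarith) ?_ hs hth
      push_cast
      have hNp : 0 < NN x y 8 d0 := by
        have := NN_ge x y 8 d0
        push_cast at this
        linarith
      have : -(3 * 8 ^ 2 / (4 * 4 ^ 2)) / NN x y 8 d0 = - (3 / NN x y 8 d0) := by field_simp; norm_num
      rw [this]
      norm_num
      linarith

end M2R

namespace M2R
open Filter Topology Set
open Complex (I)
open MeasureTheory

noncomputable def qe (x y : ℝ) : ℂ := Complex.exp (2 * Real.pi * I * (x + y * I))

lemma qe_norm (x y : ℝ) : ‖qe x y‖ = Real.exp (-(2 * Real.pi * y)) := by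
  rw [qe, Complex.norm_exp]; congr 1; simp

lemma qe_lt (x : ℝ) {y : ℝ} (hy : 0 < y) : ‖qe x y‖ < 1 := by
  rw [qe_norm, Real.exp_lt_one_iff]
  have := Real.pi_pos
  have : 0 < 2 * Real.pi * y := by positivity
  linarith

lemma qe_ne (x y : ℝ) : qe x y ≠ 0 := Complex.exp_ne_zero _

lemma qe_cont (y : ℝ) : Continuous fun x => qe x y := by
  unfold qe; fun_prop

lemma Acoef_summable {y : ℝ} (hy : 0 < y) : Summable fun n : ℕ => ‖Acoef 1 5 n‖ * Real.exp (-(2 * Real.pi * y)) ^ n := by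
  have h := (Acoef_gen (qe_lt 0 hy) (qe_ne 0 y)).summable.norm
  refine h.congr (fun n => ?_)
  rw [norm_mul, norm_pow, qe_norm]

lemma GG_cont {y : ℝ} (hy : 0 < y) : Continuous fun x : ℝ => GG (qe x y) := by
  have e : (fun x : ℝ => GG (qe x y)) = fun x => ∑' n : ℕ, Acoef 1 5 n * (qe x y) ^ n := by
    funext x
    exact (Acoef_gen (qe_lt x hy) (qe_ne x y)).tsum_eq.symm
  rw [e]
  refine continuous_tsum (fun n => ?_) (Acoef_summable hy) (fun n x => ?_)
  · exact continuous_const.mul ((qe_cont y).pow n)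
  · rw [norm_mul, norm_pow, qe_norm]

lemma int_exp (k n : ℕ) : ∫ x in (-1 / 10 : ℝ)..(9 / 10), Complex.exp (2 * Real.pi * I * (k - n) * x) = if k = n then 1 else 0 := by
  split_ifs with h
  · rw [h]; simp; norm_num
  · have hc : (2 * Real.pi * I * ((k : ℂ) - n)) ≠ 0 := by
      have h1 : ((k : ℂ) - n) ≠ 0 := by
        rw [sub_ne_zero]; exact_mod_cast h
      have := Complex.two_pi_I_ne_zero
      exact mul_ne_zero this h1
    rw [integral_exp_mul_complex hc]
    have : Complex.exp (2 * Real.pi * I * (k - n) * ((9 / 10 : ℝ) : ℂ)) = Complex.exp (2 * Real.pi * I * (k - n) * ((-1 / 10 : ℝ) : ℂ)) := by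
      rw [Complex.exp_eq_exp_iff_exists_int]
      refine ⟨k - n, ?_⟩
      push_cast; ring
    rw [this, sub_self, zero_div]

theorem Acoef_int (n : ℕ) {y : ℝ} (hy : 0 < y) :
    Acoef 1 5 n = ∫ x in (-1 / 10 : ℝ)..(9 / 10), GG (qe x y) * Complex.exp (-(2 * Real.pi * I * n * (x + y * I))) := by
  have hpi := Real.pi_pos
  have H := intervalIntegral.hasSum_integral_of_dominated_convergence (a := (-1 / 10 : ℝ)) (b := 9 / 10) (μ := volume)
    (F := fun (k : ℕ) (x : ℝ) => Acoef 1 5 k * (qe x y) ^ k * Complex.exp (-(2 * Real.pi * I * n * (x + y * I))))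
    (f := fun x : ℝ => GG (qe x y) * Complex.exp (-(2 * Real.pi * I * n * (x + y * I))))
    (fun k _ => ‖Acoef 1 5 k‖ * Real.exp (-(2 * Real.pi * y)) ^ k * Real.exp (2 * Real.pi * n * y))
    (fun k => by
      apply Continuous.aestronglyMeasurable
      have := qe_cont y
      fun_prop)
    (fun k => Eventually.of_forall (fun x _ => by
      rw [norm_mul, norm_mul, norm_pow, qe_norm, Complex.norm_exp]
      apply le_of_eq
      congr 2
      simp))
    (Eventually.of_forall (fun x _ => (Acoef_summable hy).mul_right _))
    (by simp)
    (Eventually.of_forall (fun x _ => (Acoef_gen (qe_lt x hy) (qe_ne x y)).mul_right _))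
  have e : ∀ k : ℕ, ∫ x in (-1 / 10 : ℝ)..(9 / 10), Acoef 1 5 k * (qe x y) ^ k * Complex.exp (-(2 * Real.pi * I * n * (x + y * I))) =
      if k = n then Acoef 1 5 n else 0 := by
    intro k
    have : ∀ x : ℝ, Acoef 1 5 k * (qe x y) ^ k * Complex.exp (-(2 * Real.pi * I * n * (x + y * I))) =
      Acoef 1 5 k * Complex.exp (2 * Real.pi * I * (k - n) * (y * I)) * Complex.exp (2 * Real.pi * I * (k - n) * x) := by
      intro x
      rw [qe, ← Complex.exp_nat_mul, mul_assoc (Acoef 1 5 k), mul_assoc (Acoef 1 5 k), ← Complex.exp_add, ← Complex.exp_add]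
      congr 2
      ring
    simp only [this]
    rw [intervalIntegral.integral_const_mul, int_exp]
    split_ifs with h
    · rw [h]; simp
    · simp
  simp only [e] at H
  have H2 := hasSum_ite_eq (β := ℕ) n (Acoef 1 5 n)
  exact H2.unique H

/-- local variable -/
noncomputable def tt (L v : ℝ) : ℂ := ((Real.pi ^ 2 / (200 * L ^ 2) : ℝ) : ℂ) * (1 - (v / L : ℝ) * I)

lemma tt_re (L v : ℝ) : (tt L v).re = Real.pi ^ 2 / (200 * L ^ 2) := by
  unfold tt; rw [Complex.re_ofReal_mul]; simp

lemma tt_im (L v : ℝ) : (tt L v).im = -(Real.pi ^ 2 / (200 * L ^ 2) * (v / L)) := by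
  unfold tt; rw [Complex.im_ofReal_mul]; simp

lemma qf_tt (h : ℕ) {L : ℝ} (hL : 0 < L) (v : ℝ) : qf h 5 (tt L v) = qe (h / 5 + Real.pi / (400 * L ^ 3) * v) (Real.pi / (400 * L ^ 2)) := by
  unfold qf qe tt
  congr 1
  have : (L : ℂ) ≠ 0 := by exact_mod_cast hL.ne'
  push_cast
  field_simp
  linear_combination (-2000 * (Real.pi : ℂ) * L) * Complex.I_sq

lemma tt_sec {L v : ℝ} (hL : 0 < L) (hv : |v| ≤ 5 * L) : 0 < (tt L v).re ∧ |(tt L v).im| ≤ 5 * (tt L v).re := by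
  have hpi := Real.pi_pos
  rw [tt_re, tt_im, abs_neg, abs_mul, abs_div v, abs_of_pos hL, abs_of_pos (by positivity : 0 < Real.pi ^ 2 / (200 * L ^ 2))]
  refine ⟨by positivity, ?_⟩
  rw [mul_comm 5]
  gcongr
  rw [div_le_iff₀ hL]; exact hv

lemma near_id (h : ℕ) {L : ℝ} (hL : 0 < L) (v : ℝ) :
    ((√(Real.pi ^ 2 / (200 * L ^ 2)) : ℝ) : ℂ) * GG (qf h 5 (tt L v)) * Complex.exp ((200 * L ^ 4 / Real.pi ^ 2 : ℝ) * tt L v - (2 * L ^ 2 : ℝ)) =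
    ((tt L v) ^ (1 / 2 : ℂ) * Complex.exp (-(Real.pi ^ 2 / 200) * (tt L v)⁻¹) * GG (qf h 5 (tt L v))) *
      ((1 - (v / L : ℝ) * I) ^ (1 / 2 : ℂ))⁻¹ * Complex.exp (-(v ^ 2 : ℝ) / (1 - (v / L : ℝ) * I)) := by
  have hpi := Real.pi_pos
  have hw : (1 - (v / L : ℝ) * I : ℂ) ≠ 0 := by
    intro h0
    have := congrArg Complex.re h0
    simp at this
  set w : ℂ := 1 - (v / L : ℝ) * I with hwd
  have h1 : (tt L v) ^ (1 / 2 : ℂ) = (√(Real.pi ^ 2 / (200 * L ^ 2)) : ℝ) * w ^ (1 / 2 : ℂ) := by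
    unfold tt; exact cpow_half_mul (by positivity) w hw
  have hw2 := half_ne hw
  rw [h1]
  have h2 : Complex.exp ((200 * L ^ 4 / Real.pi ^ 2 : ℝ) * tt L v - (2 * L ^ 2 : ℝ)) =
      Complex.exp (-(Real.pi ^ 2 / 200) * (tt L v)⁻¹) * Complex.exp (-(v ^ 2 : ℝ) / w) := by
    rw [← Complex.exp_add]
    congr 1
    have ht : tt L v = ((Real.pi ^ 2 / (200 * L ^ 2) : ℝ) : ℂ) * w := rfl
    have hLc : (L : ℂ) ≠ 0 := by exact_mod_cast hL.ne'
    have hpc : (Real.pi : ℂ) ≠ 0 := by exact_mod_cast hpi.ne'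
    have hv : ((v : ℂ)) ^ 2 = - L ^ 2 * (1 - w) ^ 2 := by
      rw [hwd]; push_cast; field_simp
      linear_combination (v : ℂ) ^ 2 * Complex.I_sq
    rw [ht]
    push_cast
    rw [hv]
    field_simp
    ring
  rw [h2]
  field_simp

theorem near_lim {h : ℕ} (hh : h < 5) : Tendsto (fun L : ℝ => ∫ v in (-(5 * L))..(5 * L),
    ((√(Real.pi ^ 2 / (200 * L ^ 2)) : ℝ) : ℂ) * GG (qf h 5 (tt L v)) * Complex.exp ((200 * L ^ 4 / Real.pi ^ 2 : ℝ) * tt L v - (2 * L ^ 2 : ℝ)))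
    atTop (𝓝 (Dh h * (√Real.pi : ℝ))) := by
  have hpi := Real.pi_pos
  set W : ℝ → ℝ → ℂ := fun L v => ((√(Real.pi ^ 2 / (200 * L ^ 2)) : ℝ) : ℂ) * GG (qf h 5 (tt L v)) * Complex.exp ((200 * L ^ 4 / Real.pi ^ 2 : ℝ) * tt L v - (2 * L ^ 2 : ℝ)) with hW
  have hgl : ∫ v : ℝ, Dh h * Complex.exp (-(v ^ 2 : ℝ)) = Dh h * (√Real.pi : ℝ) := by
    rw [integral_const_mul]
    congr 1
    have := integral_gaussian 1
    rw [div_one] at this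
    rw [← this, ← integral_complex_ofReal]
    congr 1
    funext v
    push_cast
    congr 1
    ring
  have hcongr : ∀ᶠ L : ℝ in atTop, ∫ v : ℝ, (Ioc (-(5 * L)) (5 * L)).indicator (W L) v = ∫ v in (-(5 * L))..(5 * L), W L v := by
    filter_upwards [eventually_gt_atTop 0] with L hL
    rw [intervalIntegral.integral_of_le (by linarith), integral_indicator measurableSet_Ioc]
  rw [← hgl]
  refine Tendsto.congr' hcongr ?_
  have hG := G_lim hh
  -- boundedness
  obtain ⟨C, hC⟩ := hG.norm.isBoundedUnder_le.eventually_le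
  rw [SF, eventually_nhdsWithin_iff, Metric.eventually_nhds_iff] at hC
  obtain ⟨δ, hδ, hC⟩ := hC
  have ttn : Tendsto (fun L : ℝ => 6 * (Real.pi ^ 2 / (200 * L ^ 2))) atTop (𝓝 0) := by
    have h1 : Tendsto (fun L : ℝ => (L ^ 2)⁻¹) atTop (𝓝 0) := tendsto_inv_atTop_zero.comp (tendsto_pow_atTop (by norm_num))
    have h2 := h1.const_mul (6 * Real.pi ^ 2 / 200)
    rw [mul_zero] at h2
    refine h2.congr (fun L => ?_)
    rw [mul_div_assoc', div_mul_eq_div_div]; ring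
  have hb : ∀ᶠ L : ℝ in atTop, ∀ v : ℝ, |v| ≤ 5 * L → ‖W L v‖ ≤ |C| * Real.exp (-(1 / 26) * v ^ 2) := by
    filter_upwards [eventually_gt_atTop 0, ttn.eventually_lt_const hδ] with L hL hLδ v hv
    rw [hW]
    simp only
    rw [near_id h hL]
    have hs := tt_sec hL hv
    have hn := sec_norm hs
    rw [tt_re] at hn
    have hc := hC (y := tt L v) (by rw [dist_zero_right]; linarith) hs
    rw [norm_mul, norm_mul]
    have h1 : ‖((1 - (v / L : ℝ) * I : ℂ) ^ (1 / 2 : ℂ))⁻¹‖ ≤ 1 := by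
      rw [norm_inv]
      have h2 : (1 - (v / L : ℝ) * I : ℂ) ≠ 0 := by
        intro h0
        have := congrArg Complex.re h0
        simp at this
      have h3 : ‖(1 - (v / L : ℝ) * I : ℂ) ^ (1 / 2 : ℂ)‖ = ‖(1 - (v / L : ℝ) * I : ℂ)‖ ^ (1 / 2 : ℝ) := by
        have := Complex.norm_cpow_real (1 - (v / L : ℝ) * I : ℂ) (1 / 2)
        rw [← this]; norm_num
      rw [h3]
      apply inv_le_one_of_one_le₀
      apply Real.one_le_rpow _ (by norm_num)
      have := Complex.abs_re_le_norm (1 - (v / L : ℝ) * I : ℂ)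
      simpa using this
    have h2 : ‖Complex.exp (-(v ^ 2 : ℝ) / (1 - (v / L : ℝ) * I))‖ ≤ Real.exp (-(1 / 26) * v ^ 2) := by
      rw [Complex.norm_exp]
      apply Real.exp_le_exp.mpr
      have e : (-((v ^ 2 : ℝ) : ℂ) / (1 - (v / L : ℝ) * I)).re = -(v ^ 2 / (1 + (v / L) ^ 2)) := by
        rw [div_eq_mul_inv, ← Complex.ofReal_neg, Complex.re_ofReal_mul, Complex.inv_re, Complex.normSq_apply]
        simp
        ring
      rw [e]
      have h5 : (v / L) ^ 2 ≤ 25 := by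
        have : |v / L| ≤ 5 := by rw [abs_div, abs_of_pos hL, div_le_iff₀ hL]; exact hv
        rw [← sq_abs]; nlinarith [abs_nonneg (v / L)]
      have h6 : v ^ 2 / 26 ≤ v ^ 2 / (1 + (v / L) ^ 2) := by
        apply div_le_div_of_nonneg_left (by positivity) (by positivity) (by linarith)
      linarith
    have h3 := hc.trans (le_abs_self C)
    calc _ ≤ |C| * 1 * Real.exp (-(1 / 26) * v ^ 2) := by
          apply mul_le_mul _ h2 (norm_nonneg _) (by positivity)
          exact mul_le_mul h3 h1 (norm_nonneg _) (by positivity)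
      _ = _ := by ring
  refine tendsto_integral_filter_of_dominated_convergence (fun v => |C| * Real.exp (-(1 / 26) * v ^ 2)) ?_ ?_ ?_ ?_
  · filter_upwards [eventually_gt_atTop 0] with L hL
    apply AEStronglyMeasurable.indicator _ measurableSet_Ioc
    apply Continuous.aestronglyMeasurable
    rw [hW]
    simp only [qf_tt h hL]
    have h1 : Continuous fun v : ℝ => GG (qe (h / 5 + Real.pi / (400 * L ^ 3) * v) (Real.pi / (400 * L ^ 2))) :=
      (GG_cont (y := Real.pi / (400 * L ^ 2)) (by positivity)).comp (by fun_prop)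
    have h2 : Continuous fun v : ℝ => tt L v := by unfold tt; fun_prop
    fun_prop
  · filter_upwards [hb] with L hL
    refine Eventually.of_forall (fun v => ?_)
    by_cases hv : v ∈ Ioc (-(5 * L)) (5 * L)
    · rw [indicator_of_mem hv]
      exact hL v (abs_le.mpr ⟨hv.1.le, hv.2⟩)
    · rw [indicator_of_notMem hv, norm_zero]; positivity
  · exact (integrable_exp_neg_mul_sq (by norm_num)).const_mul _
  · refine Eventually.of_forall (fun v => ?_)
    have hvL : ∀ᶠ L : ℝ in atTop, 0 < L ∧ |v| < 5 * L := by
      filter_upwards [eventually_gt_atTop 0, eventually_gt_atTop (|v| / 5)] with L h1 h2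
      exact ⟨h1, by linarith⟩
    have hcg : ∀ᶠ L : ℝ in atTop, ((tt L v) ^ (1 / 2 : ℂ) * Complex.exp (-(Real.pi ^ 2 / 200) * (tt L v)⁻¹) * GG (qf h 5 (tt L v))) *
      ((1 - (v / L : ℝ) * I) ^ (1 / 2 : ℂ))⁻¹ * Complex.exp (-(v ^ 2 : ℝ) / (1 - (v / L : ℝ) * I)) = (Ioc (-(5 * L)) (5 * L)).indicator (W L) v := by
      filter_upwards [hvL] with L hL
      have := abs_lt.mp hL.2
      have hmem : v ∈ Ioc (-(5 * L)) (5 * L) := ⟨this.1, this.2.le⟩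
      rw [indicator_of_mem hmem, ← near_id h hL.1]
    refine Tendsto.congr' hcg ?_
    have hsf : Tendsto (fun L : ℝ => tt L v) atTop SF := by
      rw [SF, tendsto_nhdsWithin_iff]
      refine ⟨?_, ?_⟩
      · rw [tendsto_zero_iff_norm_tendsto_zero]
        refine tendsto_of_tendsto_of_tendsto_of_le_of_le' tendsto_const_nhds ttn (Eventually.of_forall (fun _ => norm_nonneg _)) ?_
        filter_upwards [hvL] with L hL
        have := sec_norm (tt_sec hL.1 hL.2.le)
        rwa [tt_re] at this
      · filter_upwards [hvL] with L hL
        exact tt_sec hL.1 hL.2.le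
    have hw : Tendsto (fun L : ℝ => (1 - (v / L : ℝ) * I : ℂ)) atTop (𝓝 1) := by
      have h1 : Tendsto (fun L : ℝ => v / L) atTop (𝓝 0) := tendsto_const_nhds.div_atTop tendsto_id
      have h2 : Tendsto (fun L : ℝ => ((v / L : ℝ) : ℂ)) atTop (𝓝 ((0 : ℝ) : ℂ)) := (Complex.continuous_ofReal.tendsto 0).comp h1
      have h3 := (h2.mul_const I).const_sub 1
      simpa using h3
    have hw1 : Tendsto (fun L : ℝ => ((1 - (v / L : ℝ) * I : ℂ) ^ (1 / 2 : ℂ))⁻¹) atTop (𝓝 1) := by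
      have h1 := (continuousAt_cpow_const (a := (1 : ℂ)) (b := (1 / 2 : ℂ)) (by simp)).tendsto.comp hw
      rw [Complex.one_cpow] at h1
      simpa using h1.inv₀ one_ne_zero
    have hw2 : Tendsto (fun L : ℝ => Complex.exp (-(v ^ 2 : ℝ) / (1 - (v / L : ℝ) * I))) atTop (𝓝 (Complex.exp (-(v ^ 2 : ℝ)))) := by
      have h1 := (tendsto_const_nhds (x := (-(v ^ 2 : ℝ) : ℂ))).div hw one_ne_zero
      rw [div_one] at h1
      exact (Complex.continuous_exp.tendsto _).comp h1
    have := ((hG.comp hsf).mul hw1).mul hw2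
    rw [mul_one] at this
    exact this

end M2R

namespace M2R
open Filter Topology Set
open Complex (I)
open MeasureTheory

noncomputable def fI (n : ℕ) (y x : ℝ) : ℂ := GG (qe x y) * Complex.exp (-(2 * Real.pi * I * n * (x + y * I)))

lemma fI_cont (n : ℕ) {y : ℝ} (hy : 0 < y) : Continuous (fI n y) := by
  unfold fI
  have := GG_cont hy
  fun_prop

lemma fI_norm (n : ℕ) (y x : ℝ) : ‖fI n y x‖ = ‖GG (qe x y)‖ * Real.exp (2 * Real.pi * n * y) := by
  unfold fI
  rw [norm_mul, Complex.norm_exp]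
  congr 2
  simp

noncomputable def NL (h : ℕ) (L : ℝ) : ℂ := ∫ v in (-(5 * L))..(5 * L),
    ((√(Real.pi ^ 2 / (200 * L ^ 2)) : ℝ) : ℂ) * GG (qf h 5 (tt L v)) * Complex.exp ((200 * L ^ 4 / Real.pi ^ 2 : ℝ) * tt L v - (2 * L ^ 2 : ℝ))

noncomputable def kap (L : ℝ) : ℝ := Real.exp (-(2 * L ^ 2)) * (40 * L ^ 2 / √2)

lemma zt_neg (n h : ℕ) : Complex.exp (-(2 * Real.pi * I * n * h / 5)) = zt ^ (4 * n * h) := by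
  have h1 := zt_exp (4 * n * h)
  rw [← h1, Complex.exp_eq_exp_iff_exists_int]
  refine ⟨-(n * h : ℕ), ?_⟩
  push_cast
  ring

lemma near_piece (n h : ℕ) {L : ℝ} (hL : 0 < L) (hn : (n : ℝ) = 200 * L ^ 4 / Real.pi ^ 2) :
    (∫ x in (h / 5 - 5 * (Real.pi / (400 * L ^ 2)))..(h / 5 + 5 * (Real.pi / (400 * L ^ 2))), fI n (Real.pi / (400 * L ^ 2)) x) * (kap L : ℝ) =
    zt ^ (4 * n * h) * NL h L := by
  have hpi := Real.pi_pos
  have h1 := intervalIntegral.smul_integral_comp_add_mul (a := -(5 * L)) (b := 5 * L) (f := fI n (Real.pi / (400 * L ^ 2))) (Real.pi / (400 * L ^ 3)) (h / 5)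
  have e1 : (h / 5 + Real.pi / (400 * L ^ 3) * -(5 * L) : ℝ) = h / 5 - 5 * (Real.pi / (400 * L ^ 2)) := by field_simp; ring
  have e2 : (h / 5 + Real.pi / (400 * L ^ 3) * (5 * L) : ℝ) = h / 5 + 5 * (Real.pi / (400 * L ^ 2)) := by field_simp
  rw [e1, e2] at h1
  rw [← h1, NL]
  set c := √(Real.pi ^ 2 / (200 * L ^ 2)) with hc
  have hcv : c * (10 * √2 * L) = Real.pi := by
    have : (10 * √2 * L) = √(200 * L ^ 2) := by
      rw [Real.sqrt_mul (by norm_num), Real.sqrt_sq hL.le]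
      congr 1
      rw [show (200 : ℝ) = 10 ^ 2 * 2 by norm_num, Real.sqrt_mul (by norm_num), Real.sqrt_sq (by norm_num)]
    rw [this, hc, Real.sqrt_div (by positivity), Real.sqrt_sq hpi.le]
    field_simp
  have e3 : ∀ v : ℝ, fI n (Real.pi / (400 * L ^ 2)) (h / 5 + Real.pi / (400 * L ^ 3) * v) =
      zt ^ (4 * n * h) * (GG (qf h 5 (tt L v)) * Complex.exp ((200 * L ^ 4 / Real.pi ^ 2 : ℝ) * tt L v)) := by
    intro v
    unfold fI
    rw [qf_tt h hL, ← zt_neg, ← hn]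
    have : Complex.exp (-(2 * Real.pi * I * n * (((h / 5 + Real.pi / (400 * L ^ 3) * v : ℝ) : ℂ) + ((Real.pi / (400 * L ^ 2) : ℝ) : ℂ) * I))) =
        Complex.exp (-(2 * Real.pi * I * n * h / 5)) * Complex.exp ((n : ℝ) * tt L v) := by
      rw [← Complex.exp_add]
      congr 1
      unfold tt
      have : (L : ℂ) ≠ 0 := by exact_mod_cast hL.ne'
      push_cast
      field_simp
      linear_combination (-2000 * (n : ℂ) * (Real.pi : ℂ) * L) * Complex.I_sq
    rw [this]; ring
  have e4 : ∀ v : ℝ, (c : ℂ) * GG (qf h 5 (tt L v)) * Complex.exp ((200 * L ^ 4 / Real.pi ^ 2 : ℝ) * tt L v - (2 * L ^ 2 : ℝ)) =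
      ((c : ℂ) * Complex.exp (-(2 * L ^ 2 : ℝ))) * (GG (qf h 5 (tt L v)) * Complex.exp ((200 * L ^ 4 / Real.pi ^ 2 : ℝ) * tt L v)) := by
    intro v
    rw [sub_eq_add_neg, Complex.exp_add]; ring
  simp only [e3, e4]
  rw [intervalIntegral.integral_const_mul, intervalIntegral.integral_const_mul]
  have e5 : Real.pi / (400 * L ^ 3) * kap L = c * Real.exp (-(2 * L ^ 2)) := by
    unfold kap
    rw [← hcv]
    have h2 : √2 * √2 = (2 : ℝ) := Real.mul_self_sqrt (by norm_num)
    field_simp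
    ring
  have e6 : ((Real.pi / (400 * L ^ 3) : ℝ) : ℂ) * (kap L : ℝ) = (c : ℂ) * Complex.exp (-(2 * L ^ 2 : ℝ)) := by
    rw [← Complex.ofReal_mul, e5]; push_cast; rfl
  rw [Complex.real_smul, ← e6]
  ring

theorem minor_piece : ∃ C : ℝ, 0 < C ∧ ∀ (n h : ℕ) (L : ℝ), 5 ≤ L → (n : ℝ) = 200 * L ^ 4 / Real.pi ^ 2 → ∀ x : ℝ,
    5 * (Real.pi / (400 * L ^ 2)) ≤ |x - h / 5| → |x - h / 5| ≤ 1 / 10 →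
    ‖fI n (Real.pi / (400 * L ^ 2)) x‖ ≤ C * L ^ 4 * Real.exp (119 / 60 * L ^ 2) := by
  obtain ⟨C, hC, hG⟩ := GG_minor
  have hpi := Real.pi_gt_three
  have hpi4 := Real.pi_lt_four
  refine ⟨C * 160000, by positivity, fun n h L hL hn x hx1 hx2 => ?_⟩
  set y := Real.pi / (400 * L ^ 2) with hy
  have hL2 : 25 ≤ L ^ 2 := by nlinarith
  have hy0 : 0 < y := by positivity
  have hy1 : y ≤ 1 / 2500 := by
    rw [hy, div_le_iff₀ (by positivity)]; linarith
  rcases hG x y hy0 hy1 with ⟨j, hj⟩ | hb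
  · exfalso
    by_cases hjh : j = h
    · rw [hjh] at hj
      push_cast at hj
      linarith
    · have h1 : (1 : ℝ) ≤ |(j : ℝ) - h| := by
        have : (1 : ℤ) ≤ |j - h| := Int.one_le_abs (sub_ne_zero.mpr hjh)
        exact_mod_cast this
      have h2 : |(j : ℝ) - h| / 5 ≤ |x - h / 5| + |x - j / 5| := by
        rw [show |(j : ℝ) - h| / 5 = |(x - h / 5) - (x - j / 5)| by
          rw [show (x - h / 5) - (x - j / 5) = ((j : ℝ) - h) / 5 by ring, abs_div, abs_of_pos (by norm_num : (0 : ℝ) < 5)]]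
        exact abs_sub _ _
      linarith
  · rw [fI_norm]
    have hb' : ‖GG (qe x y)‖ ≤ C / y ^ 2 * Real.exp (Real.pi / (12 * y) * 0.0295) := hb
    have e1 : Real.pi / (12 * y) * 0.0295 = 59 / 60 * L ^ 2 := by
      rw [hy]; field_simp; norm_num
    have e2 : 2 * Real.pi * n * y = L ^ 2 := by
      rw [hn, hy]; field_simp; norm_num
    have e3 : C / y ^ 2 ≤ C * 160000 * L ^ 4 := by
      rw [hy, div_pow, div_div_eq_mul_div, div_le_iff₀ (by positivity)]
      have : (1 : ℝ) ≤ Real.pi ^ 2 := by nlinarith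
      calc C * (400 * L ^ 2) ^ 2 = C * 160000 * L ^ 4 * 1 := by ring
        _ ≤ C * 160000 * L ^ 4 * Real.pi ^ 2 := by gcongr
    rw [e1] at hb'
    rw [e2]
    calc ‖GG (qe x y)‖ * Real.exp (L ^ 2) ≤ (C * 160000 * L ^ 4 * Real.exp (59 / 60 * L ^ 2)) * Real.exp (L ^ 2) := by
          gcongr
          refine hb'.trans ?_
          gcongr
      _ = C * 160000 * L ^ 4 * Real.exp (119 / 60 * L ^ 2) := by
          rw [mul_assoc, ← Real.exp_add]; congr 2; ring

theorem piece : ∃ C : ℝ, 0 < C ∧ ∀ (n h : ℕ) (L : ℝ), 5 ≤ L → (n : ℝ) = 200 * L ^ 4 / Real.pi ^ 2 →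
    ‖(∫ x in ((h : ℝ) / 5 - 1 / 10)..((h + 1 : ℕ) / 5 - 1 / 10), fI n (Real.pi / (400 * L ^ 2)) x) * (kap L : ℝ) - zt ^ (4 * n * h) * NL h L‖ ≤
      C * (L ^ 6 * Real.exp (-(1 / 60 * L ^ 2))) := by
  obtain ⟨C, hC, hm⟩ := minor_piece
  have hpi := Real.pi_gt_three
  have hpi4 := Real.pi_lt_four
  refine ⟨80 * C, by positivity, fun n h L hL hn => ?_⟩
  rw [← near_piece n h (by linarith) hn]
  have hm' := hm n h L hL hn
  set y := Real.pi / (400 * L ^ 2) with hy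
  have hL2 : 25 ≤ L ^ 2 := by nlinarith
  have hy0 : 0 < y := by positivity
  have hy1 : y ≤ 1 / 2500 := by
    rw [hy, div_le_iff₀ (by positivity)]; linarith
  have hintg : ∀ a b : ℝ, IntervalIntegrable (fI n y) volume a b := fun a b => (fI_cont n hy0).intervalIntegrable a b
  have s1 := intervalIntegral.integral_add_adjacent_intervals (hintg ((h : ℝ) / 5 - 1 / 10) (h / 5 - 5 * y)) (hintg (h / 5 - 5 * y) (h / 5 + 5 * y))
  have s2 := intervalIntegral.integral_add_adjacent_intervals (hintg ((h : ℝ) / 5 - 1 / 10) (h / 5 + 5 * y)) (hintg (h / 5 + 5 * y) ((h + 1 : ℕ) / 5 - 1 / 10))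
  rw [← s2, ← s1, ← sub_mul, norm_mul]
  have hsimp : ∀ a b c : ℂ, a + b + c - b = a + c := by intros; ring
  rw [hsimp]
  have n1 : ‖∫ x in ((h : ℝ) / 5 - 1 / 10)..(h / 5 - 5 * y), fI n y x‖ ≤ (C * L ^ 4 * Real.exp (119 / 60 * L ^ 2)) * |(h / 5 - 5 * y) - ((h : ℝ) / 5 - 1 / 10)| := by
    apply intervalIntegral.norm_integral_le_of_norm_le_const
    intro x hx
    rw [uIoc_of_le (by linarith)] at hx
    obtain ⟨x1, x2⟩ := hx
    apply hm' x
    · rw [abs_of_nonpos (by linarith)]; linarith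
    · rw [abs_of_nonpos (by linarith)]; linarith
  have n2 : ‖∫ x in (h / 5 + 5 * y)..((h + 1 : ℕ) / 5 - 1 / 10), fI n y x‖ ≤ (C * L ^ 4 * Real.exp (119 / 60 * L ^ 2)) * |(((h + 1 : ℕ) / 5 - 1 / 10) : ℝ) - (h / 5 + 5 * y)| := by
    apply intervalIntegral.norm_integral_le_of_norm_le_const
    intro x hx
    push_cast at hx
    rw [uIoc_of_le (by linarith)] at hx
    obtain ⟨x1, x2⟩ := hx
    apply hm' x
    · rw [abs_of_nonneg (by linarith)]; linarith
    · rw [abs_of_nonneg (by linarith)]; linarith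
  have l1 : |(h / 5 - 5 * y) - ((h : ℝ) / 5 - 1 / 10)| ≤ 1 := by
    rw [abs_le]; constructor <;> linarith
  have l2 : |(((h + 1 : ℕ) / 5 - 1 / 10) : ℝ) - (h / 5 + 5 * y)| ≤ 1 := by
    push_cast
    rw [abs_le]; constructor <;> linarith
  have hB : 0 ≤ C * L ^ 4 * Real.exp (119 / 60 * L ^ 2) := by positivity
  have m1 := n1.trans (mul_le_of_le_one_right hB l1)
  have m2 := n2.trans (mul_le_of_le_one_right hB l2)
  have hk : ‖((kap L : ℝ) : ℂ)‖ ≤ Real.exp (-(2 * L ^ 2)) * (40 * L ^ 2) := by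
    rw [Complex.norm_real, Real.norm_eq_abs, abs_of_nonneg (by unfold kap; positivity)]
    unfold kap
    gcongr
    apply div_le_self (by positivity)
    rw [Real.one_le_sqrt]; norm_num
  calc _ ≤ (2 * (C * L ^ 4 * Real.exp (119 / 60 * L ^ 2))) * (Real.exp (-(2 * L ^ 2)) * (40 * L ^ 2)) := by
        gcongr
        refine (norm_add_le _ _).trans ?_
        linarith
    _ = 80 * C * (L ^ 6 * (Real.exp (119 / 60 * L ^ 2) * Real.exp (-(2 * L ^ 2)))) := by ring
    _ = _ := by
        rw [← Real.exp_add]; congr 3; ring_nf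

end M2R

namespace M2R
open Filter Topology Set
open Complex (I)
open MeasureTheory

noncomputable def Ln (n : ℕ) : ℝ := √(Real.pi * √(2 * n) / 20)

lemma Ln_sq (n : ℕ) : Ln n ^ 2 = Real.pi * √(2 * n) / 20 := by
  unfold Ln
  have := Real.pi_pos
  rw [Real.sq_sqrt (by positivity)]

lemma Ln_four (n : ℕ) : (n : ℝ) = 200 * Ln n ^ 4 / Real.pi ^ 2 := by
  have hp := Real.pi_pos
  have h2 : √(2 * (n : ℝ)) ^ 2 = 2 * n := Real.sq_sqrt (by positivity)
  rw [show Ln n ^ 4 = (Ln n ^ 2) ^ 2 by ring, Ln_sq, div_pow, mul_pow, h2]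
  field_simp
  ring

lemma Ln_tendsto : Tendsto Ln atTop atTop := by
  have hp := Real.pi_pos
  unfold Ln
  refine Real.tendsto_sqrt_atTop.comp ?_
  refine Tendsto.atTop_div_const (by norm_num) ?_
  refine Tendsto.const_mul_atTop hp ?_
  refine Real.tendsto_sqrt_atTop.comp ?_
  exact Tendsto.const_mul_atTop (by norm_num) tendsto_natCast_atTop_atTop

lemma err_lim6 : Tendsto (fun L : ℝ => L ^ 6 * Real.exp (-(1 / 60 * L ^ 2))) atTop (𝓝 0) := by
  have h1 : Tendsto (fun x : ℝ => x ^ 3 * Real.exp (-(1 / 60) * x)) atTop (𝓝 0) := by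
    have := tendsto_rpow_mul_exp_neg_mul_atTop_nhds_zero 3 (1 / 60) (by norm_num)
    refine this.congr fun x => ?_
    norm_cast
  have h2 : Tendsto (fun L : ℝ => L ^ 2) atTop atTop := tendsto_pow_atTop (by norm_num)
  refine (h1.comp h2).congr fun L => ?_
  simp only [Function.comp]
  rw [show -(1 / 60) * L ^ 2 = -(1 / 60 * L ^ 2) by ring]
  ring

lemma Acoef_pieces (n : ℕ) {y : ℝ} (hy : 0 < y) : Acoef 1 5 n =
    ∑ h ∈ Finset.range 5, ∫ x in ((h : ℝ) / 5 - 1 / 10)..(((h + 1 : ℕ) : ℝ) / 5 - 1 / 10), fI n y x := by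
  have := intervalIntegral.sum_integral_adjacent_intervals (f := fI n y) (μ := volume) (a := fun k : ℕ => (k : ℝ) / 5 - 1 / 10) (n := 5)
    (fun k _ => (fI_cont n hy).intervalIntegrable _ _)
  rw [this, Acoef_int n hy]
  unfold fI
  norm_num

noncomputable def TT (n : ℕ) : ℝ := Real.pi * Real.sin (Real.pi / 5) * ep n / (10 * √2)

lemma TT_sum (n : ℕ) : ∑ h ∈ Finset.range 5, zt ^ (4 * n * h) * (Dh h * (√Real.pi : ℝ)) = (TT n : ℝ) := by
  have h1 := ep_sum n
  have hp : ((√Real.pi : ℝ) : ℂ) * (√Real.pi : ℝ) = (Real.pi : ℝ) := by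
    rw [← Complex.ofReal_mul, Real.mul_self_sqrt Real.pi_pos.le]
  have : ((TT n : ℝ) : ℂ) = (Real.pi : ℝ) * (Real.sin (Real.pi / 5) : ℝ) * (ep n / (10 * √2) : ℝ) := by
    unfold TT; push_cast; ring
  rw [this, ← h1, ← hp, Finset.mul_sum]
  refine Finset.sum_congr rfl fun h _ => ?_
  unfold Dh
  ring

lemma ep_ge (n : ℕ) : 1 ≤ ep n := by
  have h5 : √(5 : ℝ) < 3 := by rw [Real.sqrt_lt' (by norm_num)]; norm_num
  have h50 : 0 ≤ √(5 : ℝ) := by positivity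
  have h2 : 1 ≤ √(2 : ℝ) := by rw [Real.one_le_sqrt]; norm_num
  unfold ep
  split_ifs <;> nlinarith

theorem main_diff : Tendsto (fun n : ℕ => Acoef 1 5 n * (kap (Ln n) : ℝ) - (TT n : ℝ)) atTop (𝓝 0) := by
  obtain ⟨C, hC, hp⟩ := piece
  have hN : ∀ h ∈ Finset.range 5, Tendsto (fun n : ℕ => ‖NL h (Ln n) - Dh h * (√Real.pi : ℝ)‖) atTop (𝓝 0) := by
    intro h hh
    have h1 : Tendsto (NL h) atTop (𝓝 (Dh h * (√Real.pi : ℝ))) := near_lim (Finset.mem_range.mp hh)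
    exact tendsto_iff_norm_sub_tendsto_zero.mp (h1.comp Ln_tendsto)
  have hS : Tendsto (fun n : ℕ => ∑ h ∈ Finset.range 5, (C * (Ln n ^ 6 * Real.exp (-(1 / 60 * Ln n ^ 2))) + ‖NL h (Ln n) - Dh h * (√Real.pi : ℝ)‖)) atTop (𝓝 0) := by
    have : (0 : ℝ) = ∑ h ∈ Finset.range 5, (C * 0 + 0) := by simp
    rw [this]
    refine tendsto_finsetSum _ fun h hh => ?_
    exact ((err_lim6.comp Ln_tendsto).const_mul C).add (hN h hh)
  refine squeeze_zero_norm' ?_ hS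
  filter_upwards [Ln_tendsto.eventually_ge_atTop 5] with n hn
  have hpi := Real.pi_pos
  have hy : 0 < Real.pi / (400 * Ln n ^ 2) := by positivity
  rw [Acoef_pieces n hy, ← TT_sum, Finset.sum_mul, ← Finset.sum_sub_distrib]
  refine (norm_sum_le _ _).trans (Finset.sum_le_sum fun h _ => ?_)
  have h1 := hp n h (Ln n) hn (Ln_four n)
  have h2 : ‖zt ^ (4 * n * h) * NL h (Ln n) - zt ^ (4 * n * h) * (Dh h * (√Real.pi : ℝ))‖ = ‖NL h (Ln n) - Dh h * (√Real.pi : ℝ)‖ := by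
    rw [← mul_sub, norm_mul, norm_pow, zt_norm, one_pow, one_mul]
  refine (norm_sub_le_norm_sub_add_norm_sub _ (zt ^ (4 * n * h) * NL h (Ln n)) _).trans ?_
  rw [h2]
  gcongr

lemma TT_ge : ∃ c : ℝ, 0 < c ∧ ∀ n, c ≤ TT n := by
  have hpi := Real.pi_pos
  have hs : 0 < Real.sin (Real.pi / 5) := Real.sin_pos_of_pos_of_lt_pi (by positivity) (by linarith)
  refine ⟨Real.pi * Real.sin (Real.pi / 5) * 1 / (10 * √2), by positivity, fun n => ?_⟩
  unfold TT
  have := ep_ge n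
  gcongr

theorem main_quot : Tendsto (fun n : ℕ => Acoef 1 5 n * (kap (Ln n) : ℝ) / (TT n : ℝ)) atTop (𝓝 1) := by
  obtain ⟨c, hc, hT⟩ := TT_ge
  have h0 : Tendsto (fun n : ℕ => (Acoef 1 5 n * (kap (Ln n) : ℝ) - (TT n : ℝ)) / (TT n : ℝ)) atTop (𝓝 0) := by
    have h1 := (main_diff.norm).div_const c
    rw [norm_zero, zero_div] at h1
    refine squeeze_zero_norm (fun n => ?_) h1
    rw [norm_div, Complex.norm_real, Real.norm_eq_abs, abs_of_pos (hc.trans_le (hT n))]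
    have := hT n
    gcongr
  have h2 := h0.add_const 1
  rw [zero_add] at h2
  refine h2.congr fun n => ?_
  have : (TT n : ℂ) ≠ 0 := by exact_mod_cast (hc.trans_le (hT n)).ne'
  field_simp
  ring

noncomputable def RR (n : ℕ) : ℝ := √(8 * (n : ℝ) - 1) / (2 * √(8 * n)) * (Real.exp (Real.pi * √(8 * n) / 20) / Real.cosh (Real.pi * √(8 * (n : ℝ) - 1) / 20))

theorem RR_lim : Tendsto RR atTop (𝓝 1) := by
  have hpi := Real.pi_pos
  have n8 : Tendsto (fun n : ℕ => 8 * (n : ℝ)) atTop atTop := Tendsto.const_mul_atTop (by norm_num) tendsto_natCast_atTop_atTop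
  have ha : Tendsto (fun n : ℕ => √(8 * (n : ℝ))) atTop atTop := Real.tendsto_sqrt_atTop.comp n8
  have hb : Tendsto (fun n : ℕ => √(8 * (n : ℝ) - 1)) atTop atTop :=
    Real.tendsto_sqrt_atTop.comp (tendsto_atTop_add_const_right _ _ n8)
  have hd : Tendsto (fun n : ℕ => √(8 * (n : ℝ)) - √(8 * (n : ℝ) - 1)) atTop (𝓝 0) := by
    have h1 : Tendsto (fun n : ℕ => (√(8 * (n : ℝ)) + √(8 * (n : ℝ) - 1))⁻¹) atTop (𝓝 0) :=
      tendsto_inv_atTop_zero.comp (ha.atTop_add_atTop hb)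
    refine h1.congr' ?_
    filter_upwards [eventually_ge_atTop 1] with n hn
    have hn' : (1 : ℝ) ≤ n := by exact_mod_cast hn
    have s1 : √(8 * (n : ℝ)) ^ 2 = 8 * n := Real.sq_sqrt (by linarith)
    have s2 : √(8 * (n : ℝ) - 1) ^ 2 = 8 * n - 1 := Real.sq_sqrt (by linarith)
    have p1 : 0 < √(8 * (n : ℝ)) := Real.sqrt_pos.mpr (by linarith)
    have p2 : 0 ≤ √(8 * (n : ℝ) - 1) := Real.sqrt_nonneg _
    rw [inv_eq_one_div, div_eq_iff (by positivity)]
    linarith [show (√(8 * (n : ℝ)) - √(8 * (n : ℝ) - 1)) * (√(8 * (n : ℝ)) + √(8 * (n : ℝ) - 1)) = √(8 * (n : ℝ)) ^ 2 - √(8 * (n : ℝ) - 1) ^ 2 by ring]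
  have l1 : Tendsto (fun n : ℕ => 1 - (√(8 * (n : ℝ)) - √(8 * (n : ℝ) - 1)) * (√(8 * (n : ℝ)))⁻¹) atTop (𝓝 1) := by
    have := (hd.mul (tendsto_inv_atTop_zero.comp ha)).const_sub 1
    simpa using this
  have l2 : Tendsto (fun n : ℕ => Real.exp (Real.pi / 20 * (√(8 * (n : ℝ)) - √(8 * (n : ℝ) - 1)))) atTop (𝓝 1) := by
    have := (Real.continuous_exp.tendsto _).comp (hd.const_mul (Real.pi / 20))
    simpa [Function.comp_def] using this
  have l3 : Tendsto (fun n : ℕ => 1 + Real.exp (-(Real.pi / 10 * √(8 * (n : ℝ) - 1)))) atTop (𝓝 1) := by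
    have h1 : Tendsto (fun n : ℕ => Real.pi / 10 * √(8 * (n : ℝ) - 1)) atTop atTop := Tendsto.const_mul_atTop (by positivity) hb
    have := (Real.tendsto_exp_neg_atTop_nhds_zero.comp h1).const_add 1
    simpa [Function.comp_def] using this
  have l4 := (l1.mul l2).div l3 one_ne_zero
  rw [mul_one, div_one] at l4
  refine l4.congr' ?_
  filter_upwards [eventually_ge_atTop 1] with n hn
  have hn' : (1 : ℝ) ≤ n := by exact_mod_cast hn
  have p1 : 0 < √(8 * (n : ℝ)) := Real.sqrt_pos.mpr (by linarith)
  simp only [RR, Pi.div_apply, Pi.mul_apply]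
  set a := √(8 * (n : ℝ))
  set b := √(8 * (n : ℝ) - 1)
  have e1 : Real.cosh (Real.pi * b / 20) = Real.exp (Real.pi * b / 20) * (1 + Real.exp (-(Real.pi / 10 * b))) / 2 := by
    rw [Real.cosh_eq, mul_add, ← Real.exp_add, mul_one]
    congr 3
    ring
  have e2 : Real.exp (Real.pi / 20 * (a - b)) = Real.exp (Real.pi * a / 20) / Real.exp (Real.pi * b / 20) := by
    rw [← Real.exp_sub]; congr 1; ring
  rw [e1, e2]
  have p3 := Real.exp_pos (Real.pi * b / 20)
  have p4 : 0 < 1 + Real.exp (-(Real.pi / 10 * b)) := by positivity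
  field_simp
  ring

lemma final_eq (n : ℕ) (hn : 1 ≤ n) : Acoef 1 5 n * (kap (Ln n) : ℝ) / (TT n : ℝ) * (RR n : ℝ) =
    Acoef 1 5 n * ((5 * Real.sqrt (8 * (n : ℝ) - 1) : ℝ) : ℂ) /
          (((ep n : ℝ) : ℂ) *
            ((Real.sin (Real.pi / 5) : ℝ) : ℂ) *
            ((Real.cosh (Real.pi * Real.sqrt (8 * (n : ℝ) - 1) / 20) : ℝ) : ℂ)) := by
  have hn' : (1 : ℝ) ≤ n := by exact_mod_cast hn
  have hpi := Real.pi_pos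
  have hs : 0 < Real.sin (Real.pi / 5) := Real.sin_pos_of_pos_of_lt_pi (by positivity) (by linarith)
  have he := ep_pos n
  have key : kap (Ln n) / TT n * RR n = 5 * √(8 * (n : ℝ) - 1) / (ep n * Real.sin (Real.pi / 5) * Real.cosh (Real.pi * √(8 * (n : ℝ) - 1) / 20)) := by
    have p1 : 0 < √(8 * (n : ℝ)) := Real.sqrt_pos.mpr (by linarith)
    have h8 : √(8 * (n : ℝ)) = 2 * √(2 * n) := by
      rw [show 8 * (n : ℝ) = 2 ^ 2 * (2 * n) by ring, Real.sqrt_mul (by norm_num), Real.sqrt_sq (by norm_num)]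
    have e1 : 2 * Ln n ^ 2 = Real.pi * √(8 * n) / 20 := by rw [Ln_sq, h8]; ring
    have e2 : 40 * Ln n ^ 2 = Real.pi * √(8 * n) := by linarith
    have hc := Real.cosh_pos (Real.pi * √(8 * (n : ℝ) - 1) / 20)
    unfold kap TT RR
    rw [e1, e2, Real.exp_neg]
    set a := √(8 * (n : ℝ))
    set b := √(8 * (n : ℝ) - 1)
    have p3 := Real.exp_pos (Real.pi * a / 20)
    field_simp
    ring
  have key' : ((kap (Ln n) / TT n * RR n : ℝ) : ℂ) = _ := congrArg Complex.ofReal key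
  rw [mul_div_assoc, mul_assoc, ← Complex.ofReal_div, ← Complex.ofReal_mul, key']
  push_cast
  ring

theorem final_lim : Tendsto (fun n : ℕ => Acoef 1 5 n * ((5 * Real.sqrt (8 * (n : ℝ) - 1) : ℝ) : ℂ) /
          (((ep n : ℝ) : ℂ) *
            ((Real.sin (Real.pi / 5) : ℝ) : ℂ) *
            ((Real.cosh (Real.pi * Real.sqrt (8 * (n : ℝ) - 1) / 20) : ℝ) : ℂ))) atTop (𝓝 1) := by
  have h1 := main_quot.mul ((Complex.continuous_ofReal.tendsto 1).comp RR_lim)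
  rw [Complex.ofReal_one, mul_one] at h1
  refine h1.congr' ?_
  filter_upwards [eventually_ge_atTop 1] with n hn
  exact final_eq n hn

end M2R

theorem Acoef_one_fifth_asymptotic :
    Filter.Tendsto
      (fun n : ℕ =>
        Acoef 1 5 n * ((5 * Real.sqrt (8 * (n : ℝ) - 1) : ℝ) : ℂ) /
          (((if n % 5 = 0 then 6 * Real.sqrt 2 * (5 - Real.sqrt 5)
             else if n % 5 = 1 then 2 * Real.sqrt 2 * (5 + Real.sqrt 5)
             else if n % 5 = 2 then 20 * Real.sqrt 2
             else if n % 5 = 3 then 2 * Real.sqrt 2 * (5 - Real.sqrt 5)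
             else 6 * Real.sqrt 2 * (5 + Real.sqrt 5) : ℝ) : ℂ) *
            ((Real.sin (Real.pi / 5) : ℝ) : ℂ) *
            ((Real.cosh (Real.pi * Real.sqrt (8 * (n : ℝ) - 1) / 20) : ℝ) : ℂ)))
      Filter.atTop (nhds 1) := by
  exact M2R.final_lim
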